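/- Let a > 0 and let U ∈ C^∞(ℝ³;ℝ³) and P ∈ C^∞(ℝ³;ℝ) satisfy −ΔU + aU + a(y·∇)U + (U·∇)U + ∇P = 0 and div U = 0 at every point y ∈ ℝ³. If ‖U‖_{L^{p⃗}(ℝ³)} < ∞ for some p⃗ = (p₁,p₂,p₃) with 1 < p_j < ∞ for each j and 1/p₁ + 1/p₂ + 1/p₃ < 2, then U ≡ 0 on ℝ³. -/

import Mathlib

open MeasureTheory ENNReal Set Metric Filter

noncomputable section

/-- Euclidean 3-space. -/
abbrev E3 : Type := EuclideanSpace ℝ (Fin 3)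

/-- The point (x₁,x₂,x₃) of ℝ³. -/
def pt3 (x1 x2 x3 : ℝ) : E3 := (WithLp.equiv 2 (Fin 3 → ℝ)).symm ![x1, x2, x3]

/-- Anisotropic Lebesgue (quasi-)norm `‖f‖_{L^{q⃗}(Ω)}` with finite exponents:
iterated L^{q₁}, L^{q₂}, L^{q₃} norms in x₁, x₂, x₃ of f extended by 0 outside Ω. -/
def anisoNorm (q1 q2 q3 : ℝ) (Ω : Set E3) (f : E3 → ℝ) : ℝ≥0∞ :=
  (∫⁻ x3 : ℝ, (∫⁻ x2 : ℝ, (∫⁻ x1 : ℝ,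
      (ENNReal.ofReal |Ω.indicator f (pt3 x1 x2 x3)|) ^ q1) ^ (q2 / q1)) ^ (q3 / q2)) ^ (1 / q3)

/-- Partial derivative in the i-th coordinate direction. -/
def pd (i : Fin 3) (f : E3 → ℝ) (x : E3) : ℝ := fderiv ℝ f x (EuclideanSpace.single i 1)

/-- Laplacian. -/
def lap (f : E3 → ℝ) (x : E3) : ℝ := ∑ i : Fin 3, pd i (fun y => pd i f y) x

set_option linter.unusedVariables false
set_option linter.unusedSimpArgs false

section Part1
lemma lintegral_E3 (G : E3 → ℝ≥0∞) (hG : Measurable G) :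
    ∫⁻ x, G x = ∫⁻ x3 : ℝ, ∫⁻ x2 : ℝ, ∫⁻ x1 : ℝ, G (pt3 x1 x2 x3) := by
  have h1 : ∫⁻ x, G x = ∫⁻ f : Fin 3 → ℝ, G (WithLp.toLp 2 f) :=
    ((PiLp.volume_preserving_toLp (Fin 3)).lintegral_comp hG).symm
  have hG1 : Measurable (fun f : Fin 3 → ℝ => G (WithLp.toLp 2 f)) :=
    hG.comp (PiLp.volume_preserving_toLp (Fin 3)).measurable
  have h2 := ((volume_preserving_piFinSuccAbove (fun _ : Fin 3 => ℝ) 2).symm).lintegral_comp hG1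
  have h3 := ((volume_preserving_finTwoArrow ℝ).symm)
  rw [h1, ← h2]
  rw [Measure.volume_eq_prod, lintegral_prod]
  · refine lintegral_congr fun x3 => ?_
    have hm : Measurable (fun y : Fin 2 → ℝ => G (WithLp.toLp 2
        ((MeasurableEquiv.piFinSuccAbove (fun _ : Fin 3 => ℝ) 2).symm (x3, y)))) := by
      apply hG1.comp
      exact (MeasurableEquiv.measurable _).comp measurable_prodMk_left
    rw [← h3.lintegral_comp hm, Measure.volume_eq_prod, lintegral_prod_symm]
    · refine lintegral_congr fun x2 => lintegral_congr fun x1 => ?_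
      congr 1
      unfold pt3
      simp only [WithLp.equiv_symm_apply]
      congr 1
      ext i
      fin_cases i <;> rfl
    · exact (hm.comp (MeasurableEquiv.measurable _)).aemeasurable
  · exact (hG1.comp (MeasurableEquiv.measurable _)).aemeasurable

lemma holder_interval (g : ℝ → ℝ≥0∞) (hg : Measurable g) (p : ℝ) (hp : 1 < p) (c s : ℝ) :
    ∫⁻ x in Icc (c - s) (c + s), g x ≤
      (∫⁻ x, g x ^ p) ^ (1 / p) * ENNReal.ofReal (2 * s) ^ (1 - 1 / p) := by
  have hpq := Real.HolderConjugate.conjExponent hp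
  have h := ENNReal.lintegral_mul_le_Lp_mul_Lq (volume.restrict (Icc (c - s) (c + s))) hpq
    (f := g) (g := fun _ => 1) hg.aemeasurable aemeasurable_const
  simp only [Pi.mul_apply, mul_one, ENNReal.one_rpow, lintegral_one, Measure.restrict_apply_univ,
    Real.volume_Icc] at h
  refine h.trans ?_
  have h1 : (c + s - (c - s)) = 2 * s := by ring
  have h2 : 1 / p.conjExponent = 1 - 1 / p := by
    have := hpq.inv_add_inv_eq_one
    rw [one_div, one_div]; linarith
  rw [h1, h2]
  gcongr
  exact Measure.restrict_le_self

lemma morrey_box (g : E3 → ℝ≥0∞) (hg : Measurable g) (p1 p2 p3 : ℝ) (hp1 : 1 < p1) (hp2 : 1 < p2)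
    (hp3 : 1 < p3) (y : E3) (s : ℝ) (hs : 0 < s) :
    ∫⁻ x in closedBall y s, g x ≤
      (∫⁻ x3 : ℝ, (∫⁻ x2 : ℝ, (∫⁻ x1 : ℝ, g (pt3 x1 x2 x3) ^ p1) ^ (p2 / p1)) ^ (p3 / p2)) ^ (1 / p3)
       * ENNReal.ofReal (2 * s) ^ (3 - (1 / p1 + 1 / p2 + 1 / p3)) := by
  have hpt : Measurable (fun q : ℝ × ℝ × ℝ => pt3 q.2.2 q.2.1 q.1) := by
    unfold pt3
    simp only [WithLp.equiv_symm_apply]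
    refine (PiLp.volume_preserving_toLp (Fin 3)).measurable.comp ?_
    refine measurable_pi_lambda _ fun i => ?_
    fin_cases i
    · exact measurable_snd.comp measurable_snd
    · exact measurable_fst.comp measurable_snd
    · exact measurable_fst
  have hg3 : Measurable (fun q : ℝ × ℝ × ℝ => g (pt3 q.2.2 q.2.1 q.1)) := hg.comp hpt
  set N1 : ℝ → ℝ → ℝ≥0∞ := fun x3 x2 => ∫⁻ x1 : ℝ, g (pt3 x1 x2 x3) ^ p1 with hN1
  have hN1m : Measurable (fun q : ℝ × ℝ => N1 q.1 q.2) := by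
    have : Measurable (fun r : (ℝ × ℝ) × ℝ => g (pt3 r.2 r.1.2 r.1.1) ^ p1) :=
      (hg3.comp (f := fun r : (ℝ × ℝ) × ℝ => (r.1.1, r.1.2, r.2)) (by fun_prop)).pow_const p1
    exact this.lintegral_prod_right'
  set N2 : ℝ → ℝ≥0∞ := fun x3 => ∫⁻ x2 : ℝ, N1 x3 x2 ^ (p2 / p1) with hN2
  have hN2m : Measurable N2 := (hN1m.pow_const (p2 / p1)).lintegral_prod_right'
  set ℓ := ENNReal.ofReal (2 * s) with hℓ
  have hℓ0 : ℓ ≠ 0 := by simp [hℓ, hs]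
  have hℓt : ℓ ≠ ∞ := ENNReal.ofReal_ne_top
  let I : Fin 3 → Set ℝ := fun i => Icc (y i - s) (y i + s)
  have hI : ∀ i, MeasurableSet (I i) := fun i => measurableSet_Icc
  have key : ∀ x1 x2 x3 : ℝ, (closedBall y s).indicator g (pt3 x1 x2 x3) ≤
      (I 2).indicator (fun _ => (I 1).indicator (fun _ => (I 0).indicator
        (fun x1 => g (pt3 x1 x2 x3)) x1) x2) x3 := by
    intro x1 x2 x3
    by_cases h : pt3 x1 x2 x3 ∈ closedBall y s
    · have hc : ∀ i, pt3 x1 x2 x3 i ∈ I i := by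
        intro i
        have h1 : ‖(pt3 x1 x2 x3 - y) i‖ ≤ ‖pt3 x1 x2 x3 - y‖ := PiLp.norm_apply_le _ i
        have h2 : ‖pt3 x1 x2 x3 - y‖ ≤ s := by rwa [mem_closedBall, dist_eq_norm] at h
        have h3 := abs_le.1 ((Real.norm_eq_abs _ ▸ h1).trans h2)
        simp only [PiLp.sub_apply] at h3
        constructor <;> linarith [h3.1, h3.2]
      have h0 : x1 ∈ I 0 := hc 0
      have h1 : x2 ∈ I 1 := hc 1
      have h2 : x3 ∈ I 2 := hc 2
      simp [h, h0, h1, h2]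
    · simp [h]
  rw [← lintegral_indicator measurableSet_closedBall, lintegral_E3 _ (hg.indicator measurableSet_closedBall)]
  calc _ ≤ ∫⁻ x3 : ℝ, ∫⁻ x2 : ℝ, ∫⁻ x1 : ℝ, (I 2).indicator (fun _ => (I 1).indicator
          (fun _ => (I 0).indicator (fun x1 => g (pt3 x1 x2 x3)) x1) x2) x3 := by
        refine lintegral_mono fun x3 => lintegral_mono fun x2 => lintegral_mono fun x1 => key x1 x2 x3
    _ ≤ ∫⁻ x3 : ℝ, (I 2).indicator (fun x3 => ∫⁻ x2 : ℝ, (I 1).indicator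
          (fun x2 => ∫⁻ x1 in I 0, g (pt3 x1 x2 x3)) x2) x3 := by
        refine lintegral_mono fun x3 => ?_
        by_cases h3 : x3 ∈ I 2
        · simp only [h3, indicator_of_mem]
          refine lintegral_mono fun x2 => ?_
          by_cases h2 : x2 ∈ I 1
          · simp only [h2, indicator_of_mem]
            rw [lintegral_indicator (hI 0)]
          · simp [h2]
        · simp [h3]
    _ = ∫⁻ x3 in I 2, ∫⁻ x2 in I 1, ∫⁻ x1 in I 0, g (pt3 x1 x2 x3) := by
        rw [lintegral_indicator (hI 2)]
        refine lintegral_congr fun x3 => ?_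
        rw [lintegral_indicator (hI 1)]
    _ ≤ ∫⁻ x3 in I 2, ∫⁻ x2 in I 1, N1 x3 x2 ^ (1 / p1) * ℓ ^ (1 - 1 / p1) := by
        refine lintegral_mono fun x3 => lintegral_mono fun x2 => ?_
        exact holder_interval _ (hg3.comp (f := fun x1 : ℝ => (x3, x2, x1)) (by fun_prop)) p1 hp1 _ _
    _ ≤ ∫⁻ x3 in I 2, (N2 x3 ^ (1 / p2) * ℓ ^ (1 - 1 / p2)) * ℓ ^ (1 - 1 / p1) := by
        refine lintegral_mono fun x3 => ?_
        have hm : Measurable fun x2 => N1 x3 x2 ^ (1 / p1) :=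
          (hN1m.comp (f := fun x2 : ℝ => (x3, x2)) (by fun_prop)).pow_const _
        rw [lintegral_mul_const _ hm]
        gcongr
        refine (holder_interval _ hm p2 hp2 _ _).trans (le_of_eq ?_)
        congr 2
        refine lintegral_congr fun x2 => ?_
        rw [← ENNReal.rpow_mul]; congr 1; ring
    _ ≤ ((∫⁻ x3, N2 x3 ^ (p3 / p2)) ^ (1 / p3) * ℓ ^ (1 - 1 / p3)) * (ℓ ^ (1 - 1 / p2) * ℓ ^ (1 - 1 / p1)) := by
        simp only [mul_assoc]
        rw [lintegral_mul_const _ (hN2m.pow_const _)]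
        simp only [← mul_assoc]
        gcongr
        refine (holder_interval _ (hN2m.pow_const _) p3 hp3 _ _).trans (le_of_eq ?_)
        congr 2
        refine lintegral_congr fun x2 => ?_
        rw [← ENNReal.rpow_mul]; congr 1; ring
    _ = _ := by
        rw [mul_assoc, ← ENNReal.rpow_add _ _ hℓ0 hℓt, ← ENNReal.rpow_add _ _ hℓ0 hℓt]
        congr 2; ring

/-- Integral of `F` over the unit ball around `y`, scaled by `s`. -/
def AV (s : ℝ) (F : E3 → ℝ≥0∞) (y : E3) : ℝ≥0∞ := ∫⁻ z in closedBall (0 : E3) 1, F (y + s • z)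

lemma AV_eq (s : ℝ) (hs : s ≠ 0) (F : E3 → ℝ≥0∞) (hF : Measurable F) (y : E3) :
    AV s F y = ENNReal.ofReal (|s|⁻¹ ^ 3) * ∫⁻ x in closedBall y |s|, F x := by
  unfold AV
  have h1 : ∫⁻ z in closedBall (0 : E3) 1, F (y + s • z) =
      ∫⁻ z, (closedBall y |s|).indicator F (y + s • z) := by
    rw [← lintegral_indicator measurableSet_closedBall]
    refine lintegral_congr fun z => ?_
    have : z ∈ closedBall (0 : E3) 1 ↔ y + s • z ∈ closedBall y |s| := by
      simp only [mem_closedBall, dist_eq_norm, sub_zero, add_sub_cancel_left, norm_smul,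
        Real.norm_eq_abs]
      constructor
      · intro h; nlinarith [abs_nonneg s]
      · intro h; exact le_of_mul_le_mul_left (by linarith) (abs_pos.2 hs)
    by_cases hz : z ∈ closedBall (0 : E3) 1
    · rw [indicator_of_mem hz, indicator_of_mem (this.1 hz)]
    · rw [indicator_of_notMem hz, indicator_of_notMem (fun h => hz (this.2 h))]
  have hm : Measurable ((closedBall y |s|).indicator F) := hF.indicator measurableSet_closedBall
  rw [h1, ← lintegral_indicator measurableSet_closedBall]
  have h2 : ∫⁻ z, (closedBall y |s|).indicator F (y + s • z) =
      ∫⁻ w, (closedBall y |s|).indicator F (y + w) ∂(Measure.map (fun z : E3 => s • z) volume) := by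
    rw [lintegral_map (f := fun w => (closedBall y |s|).indicator F (y + w))
      (hm.comp (measurable_const_add y)) (measurable_const_smul s)]
  rw [h2, Measure.map_addHaar_smul _ hs, lintegral_smul_measure, lintegral_add_left_eq_self]
  simp [abs_pow, abs_inv]

lemma AV_morrey (U : E3 → E3) (hU : Continuous U) (p1 p2 p3 : ℝ) (hp1 : 1 < p1) (hp2 : 1 < p2) (hp3 : 1 < p3)
    (hsum : 1/p1 + 1/p2 + 1/p3 < 2)
    (hfin : anisoNorm p1 p2 p3 univ (fun x => ‖U x‖) < ∞) :
    ∃ M : ℝ, 0 < M ∧ ∃ σ : ℝ, 0 < σ ∧ σ < 2 ∧ ∀ s : ℝ, s ≠ 0 → ∀ y,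
      AV s (fun x => ‖U x‖ₑ) y ≤ ENNReal.ofReal (M * |s| ^ (-σ)) := by
  set σ := 1/p1 + 1/p2 + 1/p3 with hσ
  set N := anisoNorm p1 p2 p3 univ (fun x => ‖U x‖) with hN
  refine ⟨(N.toReal + 1) * 2 ^ (3 - σ), by positivity, σ, by positivity, hsum, fun s hs y => ?_⟩
  have hgm : Measurable (fun x => ‖U x‖ₑ) := hU.enorm.measurable
  rw [AV_eq s hs _ hgm]
  have hb := morrey_box _ hgm p1 p2 p3 hp1 hp2 hp3 y |s| (abs_pos.2 hs)
  have hN' : (∫⁻ x3 : ℝ, (∫⁻ x2 : ℝ, (∫⁻ x1 : ℝ, ‖U (pt3 x1 x2 x3)‖ₑ ^ p1) ^ (p2 / p1)) ^ (p3 / p2)) ^ (1 / p3) = N := by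
    rw [hN]; unfold anisoNorm
    simp only [indicator_univ, abs_norm, ofReal_norm]
  rw [hN'] at hb
  have hs' : 0 < |s| := abs_pos.2 hs
  calc _ ≤ ENNReal.ofReal (|s|⁻¹ ^ 3) * (N * ENNReal.ofReal (2 * |s|) ^ (3 - σ)) := by gcongr
    _ ≤ ENNReal.ofReal (|s|⁻¹ ^ 3) * (ENNReal.ofReal (N.toReal + 1) * ENNReal.ofReal ((2 * |s|) ^ (3 - σ))) := by
      gcongr
      · refine (ENNReal.ofReal_toReal hfin.ne).symm.le.trans ?_
        exact ENNReal.ofReal_le_ofReal (by linarith)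
      · rw [ENNReal.ofReal_rpow_of_pos (by positivity)]
    _ = _ := by
      rw [← ENNReal.ofReal_mul (by positivity), ← ENNReal.ofReal_mul (by positivity)]
      congr 1
      rw [Real.mul_rpow (by norm_num) hs'.le, Real.rpow_sub hs' 3 σ, Real.rpow_neg hs'.le]
      have : |s| ^ (3:ℝ) = |s| ^ 3 := by norm_cast
      rw [this]
      field_simp

end Part1

section Part2
/-- The volume of the unit ball. -/
def cK : ℝ≥0∞ := volume (closedBall (0 : E3) 1)

lemma cK_ne_top : cK ≠ ∞ := measure_closedBall_lt_top.ne
lemma cK_ne_zero : cK ≠ 0 := (measure_closedBall_pos _ _ one_pos).ne'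

lemma cK_real_pos : 0 < cK.toReal := ENNReal.toReal_pos cK_ne_zero cK_ne_top

/-- Weighted integral of the scaled averages. -/
def IA (α δ : ℝ) (F : E3 → ℝ≥0∞) (y : E3) : ℝ≥0∞ :=
  ∫⁻ s in Ioo 0 δ, ENNReal.ofReal (s ^ α) * AV s F y

lemma AV_measurable (F : E3 → ℝ≥0∞) (hF : Measurable F) :
    Measurable (fun p : ℝ × E3 => AV p.1 F p.2) := by
  unfold AV
  have : Measurable (fun r : (ℝ × E3) × E3 => F (r.1.2 + r.1.1 • r.2)) := hF.comp (by fun_prop)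
  exact this.lintegral_prod_right'

lemma AV_measurable' (F : E3 → ℝ≥0∞) (hF : Measurable F) (s : ℝ) : Measurable (AV s F) :=
  (AV_measurable F hF).comp (f := fun y : E3 => (s, y)) (by fun_prop)

lemma AV_measurable'' (F : E3 → ℝ≥0∞) (hF : Measurable F) (y : E3) : Measurable (fun s => AV s F y) :=
  (AV_measurable F hF).comp (f := fun s : ℝ => (s, y)) (by fun_prop)

lemma IA_integrand_measurable (α : ℝ) (F : E3 → ℝ≥0∞) (hF : Measurable F) :
    Measurable (fun p : E3 × ℝ => ENNReal.ofReal (p.2 ^ α) * AV p.2 F p.1) := by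
  refine Measurable.mul (by fun_prop) ?_
  exact (AV_measurable F hF).comp measurable_swap

lemma IA_measurable (α δ : ℝ) (F : E3 → ℝ≥0∞) (hF : Measurable F) : Measurable (IA α δ F) := by
  unfold IA
  exact (IA_integrand_measurable α F hF).lintegral_prod_right'

lemma AV_one (s : ℝ) (y : E3) : AV s (fun _ => 1) y = cK := by
  simp [AV, cK]

lemma AV_mono (s : ℝ) {F G : E3 → ℝ≥0∞} (h : ∀ x, F x ≤ G x) (y : E3) : AV s F y ≤ AV s G y :=
  lintegral_mono fun _ => h _

lemma AV_le (F : E3 → ℝ≥0∞) (hF : Measurable F) (ρ s : ℝ) (hs : 0 < s) (y : E3)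
    (hy : y ∈ closedBall (0 : E3) ρ) :
    AV s F y ≤ ENNReal.ofReal (s⁻¹ ^ 3) * ∫⁻ x in closedBall (0 : E3) (ρ + s), F x := by
  rw [AV_eq s hs.ne' F hF, abs_of_pos hs]
  gcongr
  intro x hx
  rw [mem_closedBall, dist_zero_right] at *
  calc ‖x‖ = ‖(x - y) + y‖ := by simp
    _ ≤ ‖x - y‖ + ‖y‖ := norm_add_le _ _
    _ ≤ ρ + s := by rw [dist_eq_norm] at hx; linarith

lemma AV_swap (F G : E3 → ℝ≥0∞) (hF : Measurable F) (hG : Measurable G) (ρ s : ℝ) (hs : 0 ≤ s)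
    (m : ℝ≥0∞) (hm : ∀ x, AV (-s) G x ≤ m) :
    ∫⁻ y in closedBall (0 : E3) ρ, G y * AV s F y ≤ m * ∫⁻ x in closedBall (0 : E3) (ρ + s), F x := by
  unfold AV
  have h0 : ∀ z ∈ closedBall (0 : E3) 1,
      ∫⁻ y in closedBall (0 : E3) ρ, G y * F (y + s • z) ≤
      ∫⁻ x in closedBall (0 : E3) (ρ + s), G (x + (-s) • z) * F x := by
    intro z hz
    rw [← lintegral_indicator measurableSet_closedBall, ← lintegral_indicator measurableSet_closedBall]
    refine le_trans ?_ (le_of_eq (lintegral_add_right_eq_self _ (s • z)))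
    refine lintegral_mono fun y => ?_
    by_cases hy : y ∈ closedBall (0 : E3) ρ
    · have : y + s • z ∈ closedBall (0 : E3) (ρ + s) := by
        rw [mem_closedBall, dist_zero_right] at *
        calc ‖y + s • z‖ ≤ ‖y‖ + ‖s • z‖ := norm_add_le _ _
          _ ≤ ρ + s := by
            rw [norm_smul, Real.norm_eq_abs, abs_of_nonneg hs]; nlinarith [norm_nonneg z]
      rw [indicator_of_mem hy, indicator_of_mem this]
      simp
    · simp [indicator_of_notMem hy]
  calc ∫⁻ y in closedBall (0 : E3) ρ, G y * ∫⁻ z in closedBall (0 : E3) 1, F (y + s • z)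
      = ∫⁻ y in closedBall (0 : E3) ρ, ∫⁻ z in closedBall (0 : E3) 1, G y * F (y + s • z) := by
        refine lintegral_congr fun y => ?_
        rw [lintegral_const_mul]
        exact hF.comp (by fun_prop)
    _ = ∫⁻ z in closedBall (0 : E3) 1, ∫⁻ y in closedBall (0 : E3) ρ, G y * F (y + s • z) := by
        rw [lintegral_lintegral_swap]
        exact ((hG.comp measurable_fst).mul (hF.comp (by fun_prop))).aemeasurable
    _ ≤ ∫⁻ z in closedBall (0 : E3) 1, ∫⁻ x in closedBall (0 : E3) (ρ + s), G (x + (-s) • z) * F x :=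
        setLIntegral_mono' measurableSet_closedBall h0
    _ = ∫⁻ x in closedBall (0 : E3) (ρ + s), ∫⁻ z in closedBall (0 : E3) 1, G (x + (-s) • z) * F x := by
        rw [lintegral_lintegral_swap]
        refine Measurable.aemeasurable ?_
        exact (hG.comp (by fun_prop : Measurable fun r : E3 × E3 => r.2 + (-s) • r.1)).mul
          (hF.comp measurable_snd)
    _ = ∫⁻ x in closedBall (0 : E3) (ρ + s), AV (-s) G x * F x := by
        refine lintegral_congr fun x => ?_
        rw [lintegral_mul_const]; rfl
        exact hG.comp (by fun_prop)
    _ ≤ ∫⁻ x in closedBall (0 : E3) (ρ + s), m * F x := by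
        refine lintegral_mono fun x => ?_
        gcongr
        exact hm x
    _ = _ := by rw [lintegral_const_mul _ hF]

lemma lintegral_rpow_Ioo (δ β : ℝ) (hδ : 0 < δ) (hβ : -1 < β) :
    ∫⁻ s in Ioo 0 δ, ENNReal.ofReal (s ^ β) = ENNReal.ofReal (δ ^ (β + 1) / (β + 1)) := by
  have h := integral_rpow (a := 0) (b := δ) (r := β) (Or.inl hβ)
  rw [Real.zero_rpow (by linarith), sub_zero, intervalIntegral.integral_of_le hδ.le,
    integral_Ioc_eq_integral_Ioo] at h
  rw [← h, ofReal_integral_eq_lintegral_ofReal]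
  · have := intervalIntegral.intervalIntegrable_rpow' (a := 0) (b := δ) hβ
    rw [intervalIntegrable_iff_integrableOn_Ioo_of_le hδ.le] at this
    exact this
  · exact (ae_restrict_iff' measurableSet_Ioo).2 (ae_of_all _ fun s hs => Real.rpow_nonneg hs.1.le _)

lemma IA_swap (F G : E3 → ℝ≥0∞) (hF : Measurable F) (hG : Measurable G) (ρ δ α σ M : ℝ) (hδ : 0 < δ)
    (hM : 0 ≤ M)
    (hα : -1 < α - σ) (hm : ∀ s : ℝ, s ≠ 0 → ∀ x, AV s G x ≤ ENNReal.ofReal (M * |s| ^ (-σ))) :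
    ∫⁻ y in closedBall (0 : E3) ρ, G y * IA α δ F y ≤
      ENNReal.ofReal (M * (δ ^ (α - σ + 1) / (α - σ + 1))) * ∫⁻ x in closedBall (0 : E3) (ρ + δ), F x := by
  unfold IA
  have hme := IA_integrand_measurable α F hF
  calc _ = ∫⁻ y in closedBall (0 : E3) ρ, ∫⁻ s in Ioo 0 δ, G y * (ENNReal.ofReal (s ^ α) * AV s F y) := by
        refine lintegral_congr fun y => ?_
        rw [lintegral_const_mul]
        exact hme.comp (f := fun s : ℝ => (y, s)) (by fun_prop)
    _ = ∫⁻ s in Ioo 0 δ, ∫⁻ y in closedBall (0 : E3) ρ, G y * (ENNReal.ofReal (s ^ α) * AV s F y) := by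
        rw [lintegral_lintegral_swap]
        exact ((hG.comp measurable_fst).mul hme).aemeasurable
    _ ≤ ∫⁻ s in Ioo 0 δ, ENNReal.ofReal (s ^ (α - σ)) * (ENNReal.ofReal M * ∫⁻ x in closedBall (0 : E3) (ρ + δ), F x) := by
        refine setLIntegral_mono' measurableSet_Ioo fun s hs => ?_
        have h1 : ∫⁻ y in closedBall (0 : E3) ρ, G y * (ENNReal.ofReal (s ^ α) * AV s F y)
            = ENNReal.ofReal (s ^ α) * ∫⁻ y in closedBall (0 : E3) ρ, G y * AV s F y := by
          have hme2 : Measurable (fun y => G y * AV s F y) := hG.mul (AV_measurable' F hF s)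
          rw [← lintegral_const_mul _ hme2]
          refine lintegral_congr fun y => ?_
          ring
        rw [h1]
        have h2 := AV_swap F G hF hG ρ s hs.1.le (ENNReal.ofReal (M * s ^ (-σ)))
          (fun x => by have := hm (-s) (by linarith [hs.1]) x; rwa [abs_neg, abs_of_pos hs.1] at this)
        calc _ ≤ ENNReal.ofReal (s ^ α) * (ENNReal.ofReal (M * s ^ (-σ)) * ∫⁻ x in closedBall (0 : E3) (ρ + s), F x) := by
              gcongr
          _ ≤ ENNReal.ofReal (s ^ α) * (ENNReal.ofReal (M * s ^ (-σ)) * ∫⁻ x in closedBall (0 : E3) (ρ + δ), F x) := by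
              gcongr
              exact hs.2.le
          _ = _ := by
              rw [← mul_assoc, ← mul_assoc, ← ENNReal.ofReal_mul (Real.rpow_nonneg hs.1.le _),
                ← ENNReal.ofReal_mul (Real.rpow_nonneg hs.1.le _)]
              congr 2
              rw [sub_eq_add_neg, Real.rpow_add hs.1]; ring
    _ = _ := by
        rw [lintegral_mul_const _ (by fun_prop), lintegral_rpow_Ioo _ _ hδ hα, ← mul_assoc,
          ← ENNReal.ofReal_mul (by have : 0 < α - σ + 1 := by linarith
                                   positivity)]
        congr 2; ring

lemma cauchy_schwarz {X : Type*} [MeasurableSpace X] (μ : Measure X) (f g : X → ℝ≥0∞)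
    (hf : AEMeasurable f μ) (hg : AEMeasurable g μ) :
    (∫⁻ x, f x * g x ∂μ) ^ 2 ≤ (∫⁻ x, f x ^ 2 ∂μ) * ∫⁻ x, g x ^ 2 ∂μ := by
  have h := ENNReal.lintegral_mul_le_Lp_mul_Lq μ (Real.HolderConjugate.two_two) hf hg
  have h2 := pow_le_pow_left₀ bot_le h 2
  simp only [Pi.mul_apply] at h2
  refine h2.trans (le_of_eq ?_)
  rw [mul_pow, ← ENNReal.rpow_natCast, ← ENNReal.rpow_natCast, ← ENNReal.rpow_mul, ← ENNReal.rpow_mul]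
  norm_num

lemma IA_sq (F : E3 → ℝ≥0∞) (hF : Measurable F) (ρ : ℝ) :
    ∫⁻ y in closedBall (0 : E3) ρ, (IA (3/4) 1 F y) ^ 2 ≤
      16 * cK * (∫⁻ x in closedBall (0 : E3) (ρ + 1), F x) ^ 2 := by
  set A := ∫⁻ x in closedBall (0 : E3) (ρ + 1), F x with hA
  have h1 : ∀ y ∈ closedBall (0 : E3) ρ, (IA (3/4) 1 F y) ^ 2 ≤ 4 * A * IA (-3/4) 1 F y := by
    intro y hy
    unfold IA
    have hAVm := AV_measurable'' F hF y
    have hcs := cauchy_schwarz (volume.restrict (Ioo (0:ℝ) 1)) (fun s => ENNReal.ofReal (s ^ (-3/8 : ℝ)))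
      (fun s => ENNReal.ofReal (s ^ (9/8 : ℝ)) * AV s F y) (by fun_prop)
      (Measurable.mul (by fun_prop) hAVm).aemeasurable
    have e1 : ∫⁻ s in Ioo (0:ℝ) 1, ENNReal.ofReal (s ^ (-3/8 : ℝ)) * (ENNReal.ofReal (s ^ (9/8 : ℝ)) * AV s F y)
        = ∫⁻ s in Ioo (0:ℝ) 1, ENNReal.ofReal (s ^ (3/4 : ℝ)) * AV s F y := by
      refine setLIntegral_congr_fun measurableSet_Ioo fun s hs => ?_
      rw [← mul_assoc, ← ENNReal.ofReal_mul (Real.rpow_nonneg hs.1.le _), ← Real.rpow_add hs.1]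
      norm_num
    have e2 : ∫⁻ s in Ioo (0:ℝ) 1, ENNReal.ofReal (s ^ (-3/8 : ℝ)) ^ 2 = 4 := by
      have : ∫⁻ s in Ioo (0:ℝ) 1, ENNReal.ofReal (s ^ (-3/8 : ℝ)) ^ 2 = ∫⁻ s in Ioo (0:ℝ) 1, ENNReal.ofReal (s ^ (-3/4 : ℝ)) := by
        refine setLIntegral_congr_fun measurableSet_Ioo fun s hs => ?_
        rw [← ENNReal.ofReal_pow (Real.rpow_nonneg hs.1.le _), ← Real.rpow_natCast, ← Real.rpow_mul hs.1.le]
        norm_num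
      rw [this, lintegral_rpow_Ioo _ _ one_pos (by norm_num)]
      norm_num
    rw [e1, e2] at hcs
    refine hcs.trans ?_
    rw [mul_assoc]
    gcongr
    have hme2 : Measurable (fun s => ENNReal.ofReal (s ^ (-3/4 : ℝ)) * AV s F y) := Measurable.mul (by fun_prop) hAVm
    rw [← lintegral_const_mul _ hme2]
    refine setLIntegral_mono' measurableSet_Ioo fun s hs => ?_
    have hle : AV s F y ≤ ENNReal.ofReal (s⁻¹ ^ 3) * A := by
      refine (AV_le F hF ρ s hs.1 y hy).trans ?_
      rw [hA]; gcongr; exact hs.2.le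
    calc (ENNReal.ofReal (s ^ (9/8 : ℝ)) * AV s F y) ^ 2
        = ENNReal.ofReal (s ^ (9/8 : ℝ)) ^ 2 * (AV s F y * AV s F y) := by ring
      _ ≤ ENNReal.ofReal (s ^ (9/8 : ℝ)) ^ 2 * ((ENNReal.ofReal (s⁻¹ ^ 3) * A) * AV s F y) := by gcongr
      _ = (ENNReal.ofReal (s ^ (9/8 : ℝ)) ^ 2 * ENNReal.ofReal (s⁻¹ ^ 3)) * (A * AV s F y) := by ring
      _ = ENNReal.ofReal (s ^ (-3/4 : ℝ)) * (A * AV s F y) := by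
        congr 1
        rw [← ENNReal.ofReal_pow (Real.rpow_nonneg hs.1.le _), ← ENNReal.ofReal_mul (by positivity)]
        congr 1
        rw [← Real.rpow_natCast, ← Real.rpow_mul hs.1.le, inv_pow, ← Real.rpow_natCast, ← Real.rpow_neg hs.1.le,
          ← Real.rpow_add hs.1]
        norm_num
      _ = _ := by ring
  calc _ ≤ ∫⁻ y in closedBall (0 : E3) ρ, 4 * A * IA (-3/4) 1 F y := setLIntegral_mono' measurableSet_closedBall h1
    _ = 4 * A * ∫⁻ y in closedBall (0 : E3) ρ, 1 * IA (-3/4) 1 F y := by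
        simp only [one_mul]
        rw [lintegral_const_mul _ (IA_measurable _ _ _ hF)]
    _ ≤ 4 * A * (ENNReal.ofReal (cK.toReal * ((1:ℝ) ^ ((-3/4 : ℝ) - 0 + 1) / ((-3/4 : ℝ) - 0 + 1))) * A) := by
        gcongr
        refine IA_swap F (fun _ => 1) hF measurable_const ρ 1 (-3/4) 0 cK.toReal one_pos ENNReal.toReal_nonneg
          (by norm_num) ?_
        intro s hs x
        rw [AV_one]
        simp [ENNReal.ofReal_toReal cK_ne_top]
    _ = _ := by
        have : cK.toReal * ((1:ℝ) ^ ((-3/4 : ℝ) - 0 + 1) / ((-3/4 : ℝ) - 0 + 1)) = cK.toReal * 4 := by norm_num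
        rw [this, ENNReal.ofReal_mul ENNReal.toReal_nonneg, ENNReal.ofReal_toReal cK_ne_top]
        norm_num
        ring

variable {V : Type*} [NormedAddCommGroup V] [NormedSpace ℝ V] [CompleteSpace V]

lemma enorm_sub_le_line (f : E3 → V) (hf : ContDiff ℝ 1 f) (y z : E3) (δ : ℝ) (hδ : 0 < δ) (hz : ‖z‖ ≤ 1) :
    ‖f y‖ₑ ≤ ‖f (y + δ • z)‖ₑ + ∫⁻ s in Ioo 0 δ, ‖fderiv ℝ f (y + s • z)‖ₑ := by
  have hd : ∀ s : ℝ, HasDerivAt (fun s : ℝ => f (y + s • z)) (fderiv ℝ f (y + s • z) z) s := by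
    intro s
    have h1 : HasDerivAt (fun s : ℝ => y + s • z) z s := by
      simpa using ((hasDerivAt_id s).smul_const z).const_add y
    exact ((hf.differentiable one_ne_zero).differentiableAt.hasFDerivAt).comp_hasDerivAt s h1
  have hc : Continuous (fun s : ℝ => fderiv ℝ f (y + s • z) z) :=
    ((hf.continuous_fderiv one_ne_zero).comp (by fun_prop)).clm_apply continuous_const
  have hFTC := intervalIntegral.integral_eq_sub_of_hasDerivAt (a := 0) (b := δ) (fun s _ => hd s)
    (hc.intervalIntegrable _ _)
  rw [intervalIntegral.integral_of_le hδ.le, integral_Ioc_eq_integral_Ioo] at hFTC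
  simp only [zero_smul, add_zero] at hFTC
  have h1 : ‖f (y + δ • z) - f y‖ₑ ≤ ∫⁻ s in Ioo 0 δ, ‖fderiv ℝ f (y + s • z)‖ₑ := by
    rw [← hFTC]
    refine (enorm_integral_le_lintegral_enorm _).trans (lintegral_mono fun s => ?_)
    refine enorm_le_iff_norm_le.2 ?_
    exact ((fderiv ℝ f (y + s • z)).le_opNorm z).trans (mul_le_of_le_one_right (norm_nonneg _) hz)
  calc ‖f y‖ₑ = ‖f (y + δ • z) - (f (y + δ • z) - f y)‖ₑ := by simp
    _ ≤ ‖f (y + δ • z)‖ₑ + ‖f (y + δ • z) - f y‖ₑ := enorm_sub_le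
    _ ≤ _ := by gcongr

lemma pointwise_sq (f : E3 → V) (hf : ContDiff ℝ 1 f) (y : E3) (δ α : ℝ) (hδ : 0 < δ) (hα : α < 1) :
    (cK * ‖f y‖ₑ) ^ 2 ≤ 2 * (AV δ (fun x => ‖f x‖ₑ) y) ^ 2 +
      2 * cK * ENNReal.ofReal (δ ^ (1 - α) / (1 - α)) * IA α δ (fun x => ‖fderiv ℝ f x‖ₑ ^ 2) y := by
  set D : E3 → ℝ≥0∞ := fun x => ‖fderiv ℝ f x‖ₑ with hD
  have hDm : Measurable D := (hf.continuous_fderiv one_ne_zero).enorm.measurable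
  have hfm : Measurable (fun x => ‖f x‖ₑ) := hf.continuous.enorm.measurable
  have hjm : Measurable (fun r : ℝ × E3 => D (y + r.1 • r.2)) := hDm.comp (by fun_prop)
  have h1 : cK * ‖f y‖ₑ ≤ AV δ (fun x => ‖f x‖ₑ) y +
      ∫⁻ s in Ioo 0 δ, AV s D y := by
    have : cK * ‖f y‖ₑ = ∫⁻ z in closedBall (0 : E3) 1, ‖f y‖ₑ := by
      simp [cK, mul_comm]
    rw [this]
    calc _ ≤ ∫⁻ z in closedBall (0 : E3) 1, (‖f (y + δ • z)‖ₑ + ∫⁻ s in Ioo 0 δ, D (y + s • z)) := by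
          refine setLIntegral_mono' measurableSet_closedBall fun z hz => ?_
          exact enorm_sub_le_line f hf y z δ hδ (by simpa using hz)
      _ = _ := by
          have hme2 : Measurable (fun z => ‖f (y + δ • z)‖ₑ) := hfm.comp (by fun_prop)
          rw [lintegral_add_left hme2]
          congr 1
          rw [lintegral_lintegral_swap]
          · rfl
          · exact (hjm.comp measurable_swap).aemeasurable
  have h2 : (∫⁻ s in Ioo 0 δ, AV s D y) ^ 2 ≤
      cK * ENNReal.ofReal (δ ^ (1 - α) / (1 - α)) * IA α δ (fun x => D x ^ 2) y := by
    have hcs := cauchy_schwarz (volume.restrict (Ioo (0:ℝ) δ)) (fun s => ENNReal.ofReal (s ^ (-α/2 : ℝ)))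
      (fun s => ENNReal.ofReal (s ^ (α/2 : ℝ)) * AV s D y) (by fun_prop)
      (Measurable.mul (by fun_prop) (AV_measurable'' D hDm y)).aemeasurable
    have e1 : ∫⁻ s in Ioo (0:ℝ) δ, ENNReal.ofReal (s ^ (-α/2 : ℝ)) * (ENNReal.ofReal (s ^ (α/2 : ℝ)) * AV s D y)
        = ∫⁻ s in Ioo (0:ℝ) δ, AV s D y := by
      refine setLIntegral_congr_fun measurableSet_Ioo fun s hs => ?_
      rw [← mul_assoc, ← ENNReal.ofReal_mul (Real.rpow_nonneg hs.1.le _), ← Real.rpow_add hs.1]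
      ring_nf; simp
    have e2 : ∫⁻ s in Ioo (0:ℝ) δ, ENNReal.ofReal (s ^ (-α/2 : ℝ)) ^ 2 = ENNReal.ofReal (δ ^ (1 - α) / (1 - α)) := by
      have : ∫⁻ s in Ioo (0:ℝ) δ, ENNReal.ofReal (s ^ (-α/2 : ℝ)) ^ 2 = ∫⁻ s in Ioo (0:ℝ) δ, ENNReal.ofReal (s ^ (-α : ℝ)) := by
        refine setLIntegral_congr_fun measurableSet_Ioo fun s hs => ?_
        rw [← ENNReal.ofReal_pow (Real.rpow_nonneg hs.1.le _), ← Real.rpow_natCast, ← Real.rpow_mul hs.1.le]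
        congr 2; push_cast; ring
      rw [this, lintegral_rpow_Ioo _ _ hδ (by linarith)]
      ring_nf
    rw [e1, e2] at hcs
    refine hcs.trans ?_
    have e3 : ∫⁻ s in Ioo (0:ℝ) δ, (ENNReal.ofReal (s ^ (α/2 : ℝ)) * AV s D y) ^ 2 ≤ cK * IA α δ (fun x => D x ^ 2) y := by
      unfold IA
      have hme2 : Measurable (fun s => ENNReal.ofReal (s ^ α) * AV s (fun x => D x ^ 2) y) := Measurable.mul (by fun_prop) (AV_measurable'' _ (hDm.pow_const 2) y)
      rw [← lintegral_const_mul _ hme2]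
      refine setLIntegral_mono' measurableSet_Ioo fun s hs => ?_
      have h3 := cauchy_schwarz (volume.restrict (closedBall (0 : E3) 1)) (fun _ => 1) (fun z => D (y + s • z))
        aemeasurable_const (hDm.comp (by fun_prop)).aemeasurable
      simp only [one_mul, one_pow, lintegral_one, Measure.restrict_apply_univ] at h3
      have h4 : AV s D y ^ 2 ≤ cK * AV s (fun x => D x ^ 2) y := h3
      rw [mul_pow]
      calc _ ≤ ENNReal.ofReal (s ^ (α/2 : ℝ)) ^ 2 * (cK * AV s (fun x => D x ^ 2) y) := by gcongr
        _ = _ := by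
          rw [← ENNReal.ofReal_pow (Real.rpow_nonneg hs.1.le _), ← Real.rpow_natCast, ← Real.rpow_mul hs.1.le]
          have : α / 2 * (2:ℕ) = α := by push_cast; ring
          rw [this]; ring
    calc _ ≤ ENNReal.ofReal (δ ^ (1 - α) / (1 - α)) * (cK * IA α δ (fun x => D x ^ 2) y) := by gcongr
      _ = _ := by ring
  calc (cK * ‖f y‖ₑ) ^ 2 ≤ (AV δ (fun x => ‖f x‖ₑ) y + ∫⁻ s in Ioo 0 δ, AV s D y) ^ 2 := by gcongr
    _ ≤ 2 * (AV δ (fun x => ‖f x‖ₑ) y) ^ 2 + 2 * (∫⁻ s in Ioo 0 δ, AV s D y) ^ 2 := by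
      generalize AV δ (fun x => ‖f x‖ₑ) y = a
      generalize (∫⁻ s in Ioo 0 δ, AV s D y) = b
      have h := ENNReal.rpow_add_le_mul_rpow_add_rpow a b (p := 2) (by norm_num)
      norm_num at h
      rw [← mul_add]; exact h
    _ ≤ _ := by
      refine add_le_add le_rfl ?_
      calc _ ≤ 2 * (cK * ENNReal.ofReal (δ ^ (1 - α) / (1 - α)) * IA α δ (fun x => D x ^ 2) y) := by gcongr
        _ = _ := by ring

end Part2

section Part3
/-- Integral over the ball of radius ρ. -/
def BI (ρ : ℝ) (f : E3 → ℝ) : ℝ := ∫ y in closedBall (0 : E3) ρ, f y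

lemma intOn_ball {W : Type*} [NormedAddCommGroup W] {f : E3 → W} (hf : Continuous f) (ρ : ℝ) :
    IntegrableOn f (closedBall (0 : E3) ρ) :=
  hf.continuousOn.integrableOn_compact (isCompact_closedBall _ _)

lemma BI_mono {f g : E3 → ℝ} (hf : Continuous f) (hg : Continuous g) (ρ : ℝ)
    (h : ∀ y ∈ closedBall (0 : E3) ρ, f y ≤ g y) : BI ρ f ≤ BI ρ g :=
  setIntegral_mono_on (intOn_ball hf ρ) (intOn_ball hg ρ) measurableSet_closedBall h

lemma BI_nonneg {f : E3 → ℝ} (ρ : ℝ) (h : ∀ y, 0 ≤ f y) : 0 ≤ BI ρ f :=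
  integral_nonneg h

lemma BI_mono_radius {f : E3 → ℝ} (hf : Continuous f) (h : ∀ y, 0 ≤ f y) {ρ ρ' : ℝ} (hρ : ρ ≤ ρ') :
    BI ρ f ≤ BI ρ' f :=
  setIntegral_mono_set (intOn_ball hf ρ') (ae_of_all _ h) (closedBall_subset_closedBall hρ).eventuallyLE

lemma BI_add {f g : E3 → ℝ} (hf : Continuous f) (hg : Continuous g) (ρ : ℝ) :
    BI ρ (fun y => f y + g y) = BI ρ f + BI ρ g :=
  integral_add (intOn_ball hf ρ) (intOn_ball hg ρ)

lemma BI_const_mul (c : ℝ) (f : E3 → ℝ) (ρ : ℝ) :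
    BI ρ (fun y => c * f y) = c * BI ρ f := integral_const_mul _ _

lemma BI_lintegral {f : E3 → ℝ} (hf : Continuous f) (h : ∀ y, 0 ≤ f y) (ρ : ℝ) :
    ∫⁻ y in closedBall (0 : E3) ρ, ENNReal.ofReal (f y) = ENNReal.ofReal (BI ρ f) := by
  rw [BI, ofReal_integral_eq_lintegral_ofReal (intOn_ball hf ρ) (ae_of_all _ h)]

/-- Volume of unit ball as a real number. -/
def cB : ℝ := cK.toReal
lemma cB_pos : 0 < cB := cK_real_pos
lemma cK_eq : cK = ENNReal.ofReal cB := (ENNReal.ofReal_toReal cK_ne_top).symm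

variable {V : Type*} [NormedAddCommGroup V] [NormedSpace ℝ V] [CompleteSpace V]

lemma AV_sq (F : E3 → ℝ≥0∞) (hF : Measurable F) (s : ℝ) (y : E3) :
    AV s F y ^ 2 ≤ cK * AV s (fun x => F x ^ 2) y := by
  have h3 := cauchy_schwarz (volume.restrict (closedBall (0 : E3) 1)) (fun _ => 1) (fun z => F (y + s • z))
    aemeasurable_const (hF.comp (by fun_prop)).aemeasurable
  simp only [one_mul, one_pow, lintegral_one, Measure.restrict_apply_univ] at h3
  exact h3

lemma formBound_aux (G : E3 → ℝ≥0∞) (hG : Measurable G) (M σ : ℝ) (hM : 0 ≤ M) (hσ : σ < 2)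
    (hm : ∀ s : ℝ, s ≠ 0 → ∀ x, AV s G x ≤ ENNReal.ofReal (M * |s| ^ (-σ)))
    (f : E3 → V) (hf : ContDiff ℝ 1 f) (ρ δ : ℝ) (hδ : 0 < δ) :
    cK ^ 2 * ∫⁻ y in closedBall (0 : E3) ρ, G y * ‖f y‖ₑ ^ 2 ≤
      2 * cK * ENNReal.ofReal (M * δ ^ (-σ)) * (∫⁻ y in closedBall (0 : E3) (ρ + δ), ‖f y‖ₑ ^ 2) +
      2 * cK * ENNReal.ofReal (δ ^ (1 - σ/2) / (1 - σ/2)) *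
        (ENNReal.ofReal (M * (δ ^ (1 - σ/2) / (1 - σ/2))) *
          ∫⁻ y in closedBall (0 : E3) (ρ + δ), ‖fderiv ℝ f y‖ₑ ^ 2) := by
  have hDm : Measurable (fun x => ‖fderiv ℝ f x‖ₑ ^ 2) :=
    (hf.continuous_fderiv one_ne_zero).enorm.measurable.pow_const 2
  have hfm : Measurable (fun x => ‖f x‖ₑ) := hf.continuous.enorm.measurable
  have hfm2 : Measurable (fun x => ‖f x‖ₑ ^ 2) := hfm.pow_const 2
  have hm1 : Measurable (fun y => G y * AV δ (fun x => ‖f x‖ₑ ^ 2) y) := hG.mul (AV_measurable' _ hfm2 δ)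
  have hm2 : Measurable (fun y => G y * IA (σ/2) δ (fun x => ‖fderiv ℝ f x‖ₑ ^ 2) y) := hG.mul (IA_measurable _ _ _ hDm)
  have hm3 : Measurable (fun y => G y * ‖f y‖ₑ ^ 2) := hG.mul hfm2
  calc cK ^ 2 * ∫⁻ y in closedBall (0 : E3) ρ, G y * ‖f y‖ₑ ^ 2
      = ∫⁻ y in closedBall (0 : E3) ρ, cK ^ 2 * (G y * ‖f y‖ₑ ^ 2) := by rw [lintegral_const_mul _ hm3]
    _ ≤ ∫⁻ y in closedBall (0 : E3) ρ, (2 * cK * (G y * AV δ (fun x => ‖f x‖ₑ ^ 2) y) +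
        2 * cK * ENNReal.ofReal (δ ^ (1 - σ/2) / (1 - σ/2)) * (G y * IA (σ/2) δ (fun x => ‖fderiv ℝ f x‖ₑ ^ 2) y)) := by
        refine lintegral_mono fun y => ?_
        have h := pointwise_sq f hf y δ (σ/2) hδ (by linarith)
        calc cK ^ 2 * (G y * ‖f y‖ₑ ^ 2) = G y * (cK * ‖f y‖ₑ) ^ 2 := by ring
          _ ≤ G y * (2 * (AV δ (fun x => ‖f x‖ₑ) y) ^ 2 +
      2 * cK * ENNReal.ofReal (δ ^ (1 - σ/2) / (1 - σ/2)) * IA (σ/2) δ (fun x => ‖fderiv ℝ f x‖ₑ ^ 2) y) := by gcongr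
          _ ≤ G y * (2 * (cK * AV δ (fun x => ‖f x‖ₑ ^ 2) y) +
      2 * cK * ENNReal.ofReal (δ ^ (1 - σ/2) / (1 - σ/2)) * IA (σ/2) δ (fun x => ‖fderiv ℝ f x‖ₑ ^ 2) y) := by
            gcongr; exact AV_sq _ hfm _ _
          _ = _ := by ring
    _ = 2 * cK * (∫⁻ y in closedBall (0 : E3) ρ, G y * AV δ (fun x => ‖f x‖ₑ ^ 2) y) +
        2 * cK * ENNReal.ofReal (δ ^ (1 - σ/2) / (1 - σ/2)) *
        ∫⁻ y in closedBall (0 : E3) ρ, G y * IA (σ/2) δ (fun x => ‖fderiv ℝ f x‖ₑ ^ 2) y := by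
        rw [lintegral_add_left (hm1.const_mul _), lintegral_const_mul _ hm1, lintegral_const_mul _ hm2]
    _ ≤ _ := by
        rw [mul_assoc (2 * cK) (ENNReal.ofReal (M * δ ^ (-σ)))]
        gcongr
        · refine AV_swap _ G hfm2 hG ρ δ hδ.le _ fun x => ?_
          have := hm (-δ) (by linarith) x
          rwa [abs_neg, abs_of_pos hδ] at this
        · have := IA_swap _ G hDm hG ρ δ (σ/2) σ M hδ hM (by linarith) hm
          have e : σ/2 - σ + 1 = 1 - σ/2 := by ring
          rwa [e] at this

lemma BI_enorm_sq {W : Type*} [NormedAddCommGroup W] (f : E3 → W) (hf : Continuous f) (ρ : ℝ) :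
    ∫⁻ y in closedBall (0 : E3) ρ, ‖f y‖ₑ ^ 2 = ENNReal.ofReal (BI ρ (fun y => ‖f y‖ ^ 2)) := by
  rw [← BI_lintegral (by fun_prop) (fun y => by positivity)]
  refine lintegral_congr fun y => ?_
  rw [ENNReal.ofReal_pow (norm_nonneg _), ofReal_norm]

/-- Local form bound, real version. -/
lemma formBound (g : E3 → ℝ) (hg : Continuous g) (hg0 : ∀ x, 0 ≤ g x) (M σ : ℝ) (hM : 0 ≤ M) (hσ0 : 0 ≤ σ) (hσ : σ < 2)
    (hm : ∀ s : ℝ, s ≠ 0 → ∀ x, AV s (fun x => ENNReal.ofReal (g x)) x ≤ ENNReal.ofReal (M * |s| ^ (-σ)))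
    (f : E3 → V) (hf : ContDiff ℝ 1 f) (ρ δ : ℝ) (hδ : 0 < δ) :
    BI ρ (fun y => g y * ‖f y‖ ^ 2) ≤
      2 * M / (cB * (1 - σ/2) ^ 2) * (δ ^ (2 - σ) * BI (ρ + δ) (fun y => ‖fderiv ℝ f y‖ ^ 2)
        + δ ^ (-σ) * BI (ρ + δ) (fun y => ‖f y‖ ^ 2)) := by
  have hfc := hf.continuous
  have hdc := hf.continuous_fderiv one_ne_zero
  have h := formBound_aux _ (by fun_prop) M σ hM hσ hm f hf ρ δ hδ
  have hb := cB_pos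
  rw [BI_enorm_sq _ hfc, BI_enorm_sq _ hdc, cK_eq] at h
  have e : ∫⁻ y in closedBall (0 : E3) ρ, ENNReal.ofReal (g y) * ‖f y‖ₑ ^ 2 =
      ENNReal.ofReal (BI ρ (fun y => g y * ‖f y‖ ^ 2)) := by
    rw [← BI_lintegral (by fun_prop) (fun y => mul_nonneg (hg0 y) (by positivity))]
    refine lintegral_congr fun y => ?_
    rw [ENNReal.ofReal_mul (hg0 y), ENNReal.ofReal_pow (norm_nonneg _), ofReal_norm]
  rw [e] at h
  have hs : 0 < 1 - σ/2 := by linarith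
  set A := BI (ρ + δ) (fun y => ‖f y‖ ^ 2) with hA
  set D := BI (ρ + δ) (fun y => ‖fderiv ℝ f y‖ ^ 2) with hD
  have hA0 : 0 ≤ A := BI_nonneg _ fun y => by positivity
  have hD0 : 0 ≤ D := BI_nonneg _ fun y => by positivity
  have h2 : (2 : ℝ≥0∞) = ENNReal.ofReal 2 := by simp
  have hG0 : 0 ≤ BI ρ (fun y => g y * ‖f y‖ ^ 2) := BI_nonneg _ fun y => mul_nonneg (hg0 y) (by positivity)
  rw [h2, ← ENNReal.ofReal_pow hb.le, ← ENNReal.ofReal_mul (by positivity), ← ENNReal.ofReal_mul (by positivity),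
    ← ENNReal.ofReal_mul (by positivity), ← ENNReal.ofReal_mul (by positivity), ← ENNReal.ofReal_mul (by positivity),
    ← ENNReal.ofReal_mul (by positivity), ← ENNReal.ofReal_mul (by positivity),
    ← ENNReal.ofReal_add (by positivity) (by positivity), ENNReal.ofReal_le_ofReal_iff (by positivity)] at h
  have e2 : δ ^ (2 - σ) = δ ^ (1 - σ/2) * δ ^ (1 - σ/2) := by rw [← Real.rpow_add hδ]; ring_nf
  rw [e2]
  set t := δ ^ (1 - σ/2)
  set u := 1 - σ/2
  have hu1 : u ^ 2 ≤ 1 := by have : u ≤ 1 := by simp only [u]; linarith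
                             nlinarith
  have hlow : 0 ≤ δ ^ (-σ) := by positivity
  have hMA : M * δ ^ (-σ) * A ≤ M * δ ^ (-σ) * A / u ^ 2 := by
    rw [le_div_iff₀ (by positivity)]
    exact mul_le_of_le_one_right (by positivity) hu1
  have : cB * (cB * BI ρ (fun y => g y * ‖f y‖ ^ 2)) ≤ cB * (2 * (M * δ ^ (-σ) * A / u ^ 2) + 2 * (t/u) * (M * (t/u) * D)) := by
    calc _ ≤ 2 * cB * (M * δ ^ (-σ)) * A + 2 * cB * (t / u) * (M * (t / u) * D) := by
            refine le_trans (le_of_eq ?_) (h.trans (le_of_eq ?_)) <;> ring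
      _ ≤ _ := by nlinarith
  have := le_of_mul_le_mul_left this hb
  rw [← le_div_iff₀' hb] at this
  refine this.trans (le_of_eq ?_)
  field_simp
  ring

/-- Local Nash inequality. -/
lemma nash (f : E3 → V) (hf : ContDiff ℝ 1 f) (ρ δ : ℝ) (hδ : 0 < δ) :
    BI ρ (fun y => ‖f y‖ ^ 2) ≤ 2 * δ ^ 2 * BI (ρ + δ) (fun y => ‖fderiv ℝ f y‖ ^ 2)
      + 2 / cB * (δ⁻¹ ^ 3) * BI (ρ + δ) (fun y => ‖f y‖) ^ 2 := by
  have hb := cB_pos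
  have hfc := hf.continuous
  have hdc := hf.continuous_fderiv one_ne_zero
  have hDm : Measurable (fun x => ‖fderiv ℝ f x‖ₑ ^ 2) := hdc.enorm.measurable.pow_const 2
  have hfm : Measurable (fun x => ‖f x‖ₑ) := hfc.enorm.measurable
  have hfm2 : Measurable (fun x => ‖f x‖ₑ ^ 2) := hfm.pow_const 2
  have hm1 : Measurable (fun y => AV δ (fun x => ‖f x‖ₑ) y) := AV_measurable' _ hfm δ
  have hm2 : Measurable (fun y => IA 0 δ (fun x => ‖fderiv ℝ f x‖ₑ ^ 2) y) := IA_measurable _ _ _ hDm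
  set A := ∫⁻ y in closedBall (0 : E3) (ρ + δ), ‖f y‖ₑ with hA
  have h : cK ^ 2 * ∫⁻ y in closedBall (0 : E3) ρ, ‖f y‖ₑ ^ 2 ≤
      2 * (ENNReal.ofReal (δ⁻¹ ^ 3) * A * (cK * A)) + 2 * cK * ENNReal.ofReal δ * (ENNReal.ofReal (cB * δ) *
        ∫⁻ y in closedBall (0 : E3) (ρ + δ), ‖fderiv ℝ f y‖ₑ ^ 2) := by
    calc cK ^ 2 * ∫⁻ y in closedBall (0 : E3) ρ, ‖f y‖ₑ ^ 2
      = ∫⁻ y in closedBall (0 : E3) ρ, cK ^ 2 * (‖f y‖ₑ ^ 2) := by rw [lintegral_const_mul _ hfm2]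
    _ ≤ ∫⁻ y in closedBall (0 : E3) ρ, (2 * (ENNReal.ofReal (δ⁻¹ ^ 3) * A) * AV δ (fun x => ‖f x‖ₑ) y +
        2 * cK * ENNReal.ofReal δ * IA 0 δ (fun x => ‖fderiv ℝ f x‖ₑ ^ 2) y) := by
        refine setLIntegral_mono' measurableSet_closedBall fun y hy => ?_
        have h := pointwise_sq f hf y δ 0 hδ (by norm_num)
        simp only [sub_zero, Real.rpow_one, div_one] at h
        rw [← mul_pow]
        refine h.trans ?_
        refine add_le_add ?_ le_rfl
        rw [sq, mul_assoc]
        gcongr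
        exact AV_le _ hfm ρ δ hδ y hy
    _ = 2 * (ENNReal.ofReal (δ⁻¹ ^ 3) * A) * (∫⁻ y in closedBall (0 : E3) ρ, 1 * AV δ (fun x => ‖f x‖ₑ) y) +
        2 * cK * ENNReal.ofReal δ *
        ∫⁻ y in closedBall (0 : E3) ρ, 1 * IA 0 δ (fun x => ‖fderiv ℝ f x‖ₑ ^ 2) y := by
        simp only [one_mul]
        rw [lintegral_add_left (hm1.const_mul _), lintegral_const_mul _ hm1, lintegral_const_mul _ hm2]
    _ ≤ 2 * (ENNReal.ofReal (δ⁻¹ ^ 3) * A) * (cK * A) + 2 * cK * ENNReal.ofReal δ * (ENNReal.ofReal (cB * δ) *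
        ∫⁻ y in closedBall (0 : E3) (ρ + δ), ‖fderiv ℝ f y‖ₑ ^ 2) := by
        gcongr
        · refine AV_swap _ (fun _ => 1) hfm measurable_const ρ δ hδ.le _ fun x => ?_
          rw [AV_one]
        · have := IA_swap _ (fun _ => 1) hDm measurable_const ρ δ 0 0 cB hδ hb.le (by norm_num)
            (fun s hs x => by rw [AV_one, cK_eq]; simp)
          simpa using this
    _ = _ := by ring
  have eA : A = ENNReal.ofReal (BI (ρ + δ) (fun y => ‖f y‖)) := by
    rw [← BI_lintegral (by fun_prop) (fun y => by positivity)]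
    refine lintegral_congr fun y => ?_
    rw [ofReal_norm]
  rw [eA, BI_enorm_sq _ hfc, BI_enorm_sq _ hdc, cK_eq] at h
  set A' := BI (ρ + δ) (fun y => ‖f y‖)
  set D := BI (ρ + δ) (fun y => ‖fderiv ℝ f y‖ ^ 2)
  set X := BI ρ (fun y => ‖f y‖ ^ 2)
  have hA0 : 0 ≤ A' := BI_nonneg _ fun y => by positivity
  have hD0 : 0 ≤ D := BI_nonneg _ fun y => by positivity
  have hX0 : 0 ≤ X := BI_nonneg _ fun y => by positivity
  have h2 : (2 : ℝ≥0∞) = ENNReal.ofReal 2 := by simp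
  rw [h2, ← ENNReal.ofReal_pow hb.le, ← ENNReal.ofReal_mul (by positivity), ← ENNReal.ofReal_mul (by positivity),
    ← ENNReal.ofReal_mul (by positivity), ← ENNReal.ofReal_mul (by positivity), ← ENNReal.ofReal_mul (by positivity),
    ← ENNReal.ofReal_mul (by positivity), ← ENNReal.ofReal_mul (by positivity), ← ENNReal.ofReal_mul (by positivity),
    ← ENNReal.ofReal_mul (by positivity),
    ← ENNReal.ofReal_add (by positivity) (by positivity), ENNReal.ofReal_le_ofReal_iff (by positivity)] at h
  have : cB ^ 2 * X ≤ cB ^ 2 * (2 * δ ^ 2 * D + 2 / cB * (δ⁻¹ ^ 3) * A' ^ 2) := by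
    refine h.trans (le_of_eq ?_)
    field_simp
    ring
  exact le_of_mul_le_mul_left this (by positivity)

/-- Local L⁴ bound. -/
lemma l4_bound (f : E3 → V) (hf : ContDiff ℝ 1 f) (M ρ : ℝ) (hM : 0 ≤ M)
    (hm : ∀ y, AV 1 (fun x => ‖f x‖ₑ) y ≤ ENNReal.ofReal M) :
    ∃ C, 0 < C ∧ ∀ ρ, BI ρ (fun y => ‖f y‖ ^ 4) ≤ C * (BI ρ (fun _ => 1) + BI (ρ + 1) (fun y => ‖fderiv ℝ f y‖ ^ 2) ^ 2) := by
  have hb := cB_pos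
  have hfc := hf.continuous
  have hdc := hf.continuous_fderiv one_ne_zero
  have hDm : Measurable (fun x => ‖fderiv ℝ f x‖ₑ ^ 2) := hdc.enorm.measurable.pow_const 2
  refine ⟨(8 * M ^ 4 + 128 * cB ^ 2 * (16 * cB)) / cB ^ 4, by positivity, fun ρ => ?_⟩
  have h : cK ^ 4 * ∫⁻ y in closedBall (0 : E3) ρ, ‖f y‖ₑ ^ 4 ≤
      8 * ENNReal.ofReal M ^ 4 * (∫⁻ y in closedBall (0 : E3) ρ, ENNReal.ofReal 1) + 128 * cK ^ 2 *
        (16 * cK * (∫⁻ x in closedBall (0 : E3) (ρ + 1), ‖fderiv ℝ f x‖ₑ ^ 2) ^ 2) := by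
    calc cK ^ 4 * ∫⁻ y in closedBall (0 : E3) ρ, ‖f y‖ₑ ^ 4
       = ∫⁻ y in closedBall (0 : E3) ρ, cK ^ 4 * (‖f y‖ₑ ^ 4) := by
          rw [lintegral_const_mul _ (hfc.enorm.measurable.pow_const 4)]
    _ ≤ ∫⁻ y in closedBall (0 : E3) ρ, (8 * ENNReal.ofReal M ^ 4 * ENNReal.ofReal 1 +
        128 * cK ^ 2 * IA (3/4) 1 (fun x => ‖fderiv ℝ f x‖ₑ ^ 2) y ^ 2) := by
        refine lintegral_mono fun y => ?_
        have h := pointwise_sq f hf y 1 (3/4) one_pos (by norm_num)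
        norm_num at h
        calc cK ^ 4 * (‖f y‖ₑ ^ 4) = ((cK * ‖f y‖ₑ) ^ 2) ^ 2 := by ring
          _ ≤ (2 * ENNReal.ofReal M ^ 2 + 2 * cK * 4 * IA (3/4) 1 (fun x => ‖fderiv ℝ f x‖ₑ ^ 2) y) ^ 2 := by
            gcongr
            refine h.trans ?_
            gcongr
            exact hm y
          _ ≤ 2 * (2 * ENNReal.ofReal M ^ 2) ^ 2 + 2 * (2 * cK * 4 * IA (3/4) 1 (fun x => ‖fderiv ℝ f x‖ₑ ^ 2) y) ^ 2 := by
            have h := ENNReal.rpow_add_le_mul_rpow_add_rpow (2 * ENNReal.ofReal M ^ 2) (2 * cK * 4 * IA (3/4) 1 (fun x => ‖fderiv ℝ f x‖ₑ ^ 2) y) (p := 2) (by norm_num)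
            rw [← mul_add]
            have e : (2:ℝ≥0∞) ^ ((2:ℝ) - 1) = 2 := by norm_num
            rw [e] at h
            simpa only [ENNReal.rpow_two] using h
          _ = _ := by simp only [ENNReal.ofReal_one]; ring
    _ = 8 * ENNReal.ofReal M ^ 4 * (∫⁻ y in closedBall (0 : E3) ρ, ENNReal.ofReal 1) + 128 * cK ^ 2 *
        ∫⁻ y in closedBall (0 : E3) ρ, IA (3/4) 1 (fun x => ‖fderiv ℝ f x‖ₑ ^ 2) y ^ 2 := by
        rw [lintegral_add_left measurable_const, lintegral_const_mul _ measurable_const, lintegral_const_mul _ ((IA_measurable _ _ _ hDm).pow_const 2)]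
    _ ≤ _ := by
        gcongr
        exact IA_sq _ hDm ρ
  have e4 : ∫⁻ y in closedBall (0 : E3) ρ, ‖f y‖ₑ ^ 4 = ENNReal.ofReal (BI ρ (fun y => ‖f y‖ ^ 4)) := by
    rw [← BI_lintegral (by fun_prop) (fun y => by positivity)]
    refine lintegral_congr fun y => ?_
    rw [ENNReal.ofReal_pow (norm_nonneg _), ofReal_norm]
  rw [e4, BI_enorm_sq _ hdc, BI_lintegral (f := fun _ => 1) (by fun_prop) (fun _ => zero_le_one), cK_eq] at h
  set D := BI (ρ + 1) (fun y => ‖fderiv ℝ f y‖ ^ 2)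
  set X := BI ρ (fun y => ‖f y‖ ^ 4)
  set T := BI ρ (fun _ => 1)
  have hD0 : 0 ≤ D := BI_nonneg _ fun y => by positivity
  have hX0 : 0 ≤ X := BI_nonneg _ fun y => by positivity
  have hT0 : 0 ≤ T := BI_nonneg _ fun y => by positivity
  have h8 : (8 : ℝ≥0∞) = ENNReal.ofReal 8 := by simp
  have h16 : (16 : ℝ≥0∞) = ENNReal.ofReal 16 := by simp
  have h128 : (128 : ℝ≥0∞) = ENNReal.ofReal 128 := by simp
  rw [h8, h16, h128, ← ENNReal.ofReal_pow hb.le, ← ENNReal.ofReal_pow hb.le, ← ENNReal.ofReal_pow hM, ← ENNReal.ofReal_pow hD0, ← ENNReal.ofReal_mul (by positivity), ← ENNReal.ofReal_mul (by positivity),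
    ← ENNReal.ofReal_mul (by positivity), ← ENNReal.ofReal_mul (by positivity), ← ENNReal.ofReal_mul (by positivity),
    ← ENNReal.ofReal_mul (by positivity), ← ENNReal.ofReal_mul (by positivity), 
    ← ENNReal.ofReal_add (by positivity) (by positivity), ENNReal.ofReal_le_ofReal_iff (by positivity)] at h
  rw [div_mul_eq_mul_div, le_div_iff₀ (by positivity)]
  nlinarith [show 0 ≤ 8 * M ^ 4 * D ^ 2 by positivity, show 0 ≤ 128 * cB ^ 2 * (16 * cB) * T by positivity]

end Part3

section Part4
/-- Smooth scalar functions. -/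
abbrev Sm (f : E3 → ℝ) : Prop := ContDiff ℝ (⊤ : ℕ∞) f

lemma Sm.diff {f : E3 → ℝ} (hf : Sm f) : Differentiable ℝ f := hf.differentiable (by simp)

lemma Sm.c1 {f : E3 → ℝ} (hf : Sm f) : ContDiff ℝ 1 f := hf.of_le (by exact_mod_cast le_top)

lemma Sm.pd {f : E3 → ℝ} (hf : Sm f) (i : Fin 3) : Sm (pd i f) := by
  unfold _root_.pd
  have : ContDiff ℝ (⊤ : ℕ∞) (fderiv ℝ f) := hf.fderiv_right (by simp)
  exact this.clm_apply contDiff_const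

lemma Sm.coord (i : Fin 3) : Sm (fun y : E3 => y i) := by
  unfold Sm; fun_prop

lemma Sm.cst (c : ℝ) : Sm (fun _ : E3 => c) := contDiff_const

lemma Sm.lap {f : E3 → ℝ} (hf : Sm f) : Sm (lap f) := by
  unfold _root_.lap
  exact ContDiff.sum fun i _ => (hf.pd i).pd i

lemma pd_add {f g : E3 → ℝ} (hf : Sm f) (hg : Sm g) (i : Fin 3) (y : E3) :
    pd i (fun z => f z + g z) y = pd i f y + pd i g y := by
  unfold pd; rw [fderiv_fun_add (hf.diff y) (hg.diff y)]; simp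

lemma pd_sub {f g : E3 → ℝ} (hf : Sm f) (hg : Sm g) (i : Fin 3) (y : E3) :
    pd i (fun z => f z - g z) y = pd i f y - pd i g y := by
  unfold pd; rw [fderiv_fun_sub (hf.diff y) (hg.diff y)]; simp

lemma pd_mul {f g : E3 → ℝ} (hf : Sm f) (hg : Sm g) (i : Fin 3) (y : E3) :
    pd i (fun z => f z * g z) y = pd i f y * g y + f y * pd i g y := by
  unfold pd; rw [fderiv_fun_mul (hf.diff y) (hg.diff y)]; simp; ring

lemma pd_neg {f : E3 → ℝ} (i : Fin 3) (y : E3) :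
    pd i (fun z => - f z) y = - pd i f y := by
  unfold pd; rw [fderiv_fun_neg]; simp

lemma pd_cmul {f : E3 → ℝ} (hf : Sm f) (c : ℝ) (i : Fin 3) (y : E3) :
    pd i (fun z => c * f z) y = c * pd i f y := by
  unfold pd; rw [fderiv_const_mul (hf.diff y)]; simp

lemma pd_const (c : ℝ) (i : Fin 3) (y : E3) : pd i (fun _ => c) y = 0 := by
  unfold pd; simp

lemma pd_coord (i k : Fin 3) (y : E3) : pd i (fun z => z k) y = if k = i then 1 else 0 := by
  have : HasFDerivAt (fun z : E3 => z k) (EuclideanSpace.proj k : E3 →L[ℝ] ℝ) y :=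
    (EuclideanSpace.proj k : E3 →L[ℝ] ℝ).hasFDerivAt
  unfold pd
  rw [this.fderiv]
  simp [Pi.single_apply]

lemma pd_sum {f : Fin 3 → E3 → ℝ} (hf : ∀ j, Sm (f j)) (i : Fin 3) (y : E3) :
    pd i (fun z => ∑ j, f j z) y = ∑ j, pd i (f j) y := by
  unfold pd; rw [fderiv_fun_sum (fun j _ => (hf j).diff y)]; simp

lemma pd_comm {f : E3 → ℝ} (hf : Sm f) (i j : Fin 3) (y : E3) :
    pd i (pd j f) y = pd j (pd i f) y := by
  have h : IsSymmSndFDerivAt ℝ f y := by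
    refine (hf.contDiffAt).isSymmSndFDerivAt ?_
    simp only [minSmoothness_of_isRCLikeNormedField]
    exact WithTop.coe_le_coe.2 (le_top : (2 : ℕ∞) ≤ ⊤)
  have hd : DifferentiableAt ℝ (fderiv ℝ f) y :=
    ((hf.fderiv_right (m := (⊤ : ℕ∞)) (by simp)).differentiable (by simp)) y
  have key : ∀ i j, pd i (pd j f) y = fderiv ℝ (fderiv ℝ f) y (EuclideanSpace.single i 1) (EuclideanSpace.single j 1) := by
    intro i j
    unfold pd
    rw [fderiv_clm_apply hd (differentiableAt_const _)]
    simp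
  rw [key, key]
  exact h _ _

lemma hasDerivAt_line (x v : E3) (s : ℝ) : HasDerivAt (fun s : ℝ => x + s • v) v s := by
  simpa using ((hasDerivAt_id s).smul_const v).const_add x

lemma single_decomp (v : E3) : v = ∑ i, v i • EuclideanSpace.single i (1:ℝ) := by
  ext j
  simp [Pi.single_apply, Fin.sum_univ_three]
  fin_cases j <;> simp

lemma fderiv_eq_sum (f : E3 → ℝ) (x v : E3) : fderiv ℝ f x v = ∑ i, v i * pd i f x := by
  conv_lhs => rw [single_decomp v]
  rw [map_sum]
  simp [pd]

lemma hasDerivAt_along {f : E3 → ℝ} (hf : Sm f) (x v : E3) (s : ℝ) :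
    HasDerivAt (fun s : ℝ => f (x + s • v)) (∑ i, v i * pd i f (x + s • v)) s := by
  have := (hf.diff (x + s • v)).hasFDerivAt.comp_hasDerivAt s (hasDerivAt_line x v s)
  rwa [fderiv_eq_sum] at this

lemma Sm.affine {f : E3 → ℝ} (hf : Sm f) (x : E3) (s : ℝ) : Sm (fun z => f (x + s • z)) :=
  hf.comp (by fun_prop : ContDiff ℝ (⊤ : ℕ∞) (fun z : E3 => x + s • z))

lemma pd_affine {f : E3 → ℝ} (hf : Sm f) (x : E3) (s : ℝ) (i : Fin 3) (z : E3) :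
    pd i (fun z => f (x + s • z)) z = s * pd i f (x + s • z) := by
  have h1 : HasFDerivAt (fun z : E3 => x + s • z) (s • ContinuousLinearMap.id ℝ E3) z :=
    ((hasFDerivAt_id z).const_smul s).const_add x
  have h2 := (hf.diff (x + s • z)).hasFDerivAt.comp z h1
  unfold pd
  rw [show (fun z => f (x + s • z)) = f ∘ (fun z : E3 => x + s • z) from rfl, h2.fderiv]
  simp

lemma pd_comp {f : E3 → ℝ} (hf : Sm f) {q : ℝ → ℝ} {q' : ℝ} (i : Fin 3) (y : E3) (hq : HasDerivAt q q' (f y)) :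
    pd i (fun z => q (f z)) y = q' * pd i f y := by
  have h2 := hq.comp_hasFDerivAt y (hf.diff y).hasFDerivAt
  unfold pd
  rw [show (fun z => q (f z)) = q ∘ f from rfl, h2.fderiv]
  simp

lemma Sm.normsq (x0 : E3) : Sm (fun y => ‖y - x0‖ ^ 2) :=
  (contDiff_id.sub contDiff_const).norm_sq ℝ

lemma normsq_eq (y : E3) : ‖y‖ ^ 2 = ∑ i, y i ^ 2 := by
  rw [EuclideanSpace.norm_sq_eq]; simp

lemma pd_normsq (x0 : E3) (i : Fin 3) (y : E3) : pd i (fun y => ‖y - x0‖ ^ 2) y = 2 * (y i - x0 i) := by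
  have : (fun y : E3 => ‖y - x0‖ ^ 2) = fun y => ∑ j, (y j - x0 j) * (y j - x0 j) := by
    ext y; rw [normsq_eq]; simp [sq]
  have hs : ∀ j, Sm (fun y : E3 => y j - x0 j) := fun j => (Sm.coord j).sub (Sm.cst _)
  rw [this, pd_sum (fun j => (hs j).mul (hs j))]
  simp_rw [fun j => pd_mul (hs j) (hs j) i y, fun j => pd_sub (Sm.coord j) (Sm.cst (x0 j)) i y, pd_coord, pd_const]
  fin_cases i <;> simp [Fin.sum_univ_three] <;> ring

lemma pd_radial (x0 : E3) {q : ℝ → ℝ} {q' : ℝ} (i : Fin 3) (y : E3) (hq : HasDerivAt q q' (‖y - x0‖ ^ 2)) :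
    pd i (fun z => q (‖z - x0‖ ^ 2)) y = 2 * (y i - x0 i) * q' := by
  rw [pd_comp (Sm.normsq x0) i y hq, pd_normsq]; ring

lemma lap_radial (x0 : E3) {q q1 : ℝ → ℝ} {q2 : ℝ} (y : E3) (hq : ∀ r, 0 ≤ r → HasDerivAt q (q1 r) r)
    (hq1 : Sm fun z => q1 (‖z - x0‖ ^ 2))
    (hq2 : HasDerivAt q1 q2 (‖y - x0‖ ^ 2)) :
    lap (fun z => q (‖z - x0‖ ^ 2)) y = 6 * q1 (‖y - x0‖ ^ 2) + 4 * ‖y - x0‖ ^ 2 * q2 := by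
  unfold lap
  have h1 : ∀ i : Fin 3, (fun z => pd i (fun z => q (‖z - x0‖ ^ 2)) z) = fun z => (2 * (z i - x0 i)) * q1 (‖z - x0‖ ^ 2) := by
    intro i; ext z; rw [pd_radial x0 i z (hq _ (by positivity))]
  have hs : ∀ j, Sm (fun y : E3 => y j - x0 j) := fun j => (Sm.coord j).sub (Sm.cst _)
  simp_rw [h1]
  have h2 : ∀ i : Fin 3, pd i (fun z => (2 * (z i - x0 i)) * q1 (‖z - x0‖ ^ 2)) y =
      2 * q1 (‖y - x0‖ ^ 2) + 4 * (y i - x0 i) ^ 2 * q2 := by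
    intro i
    rw [pd_mul ((Sm.cst 2).mul (hs i)) hq1, pd_cmul (hs i), pd_sub (Sm.coord i) (Sm.cst _), pd_coord, pd_const,
      pd_radial x0 i y hq2]
    simp; ring
  simp_rw [h2, normsq_eq, Fin.sum_univ_three]
  simp; ring

lemma int_pd_zero {f : E3 → ℝ} (hf : Sm f) (hc : HasCompactSupport f) (i : Fin 3) : ∫ y, pd i f y = 0 := by
  have hc' : HasCompactSupport (fun y => fderiv ℝ f y (EuclideanSpace.single i 1)) := hc.fderiv_apply ℝ _
  have hi' : Integrable (fun y => fderiv ℝ f y (EuclideanSpace.single i 1)) :=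
    (hf.pd i).continuous.integrable_of_hasCompactSupport hc'
  have hi : Integrable f := hf.continuous.integrable_of_hasCompactSupport hc
  have := integral_mul_fderiv_eq_neg_fderiv_mul_of_integrable (μ := (volume : Measure E3)) (f := fun _ : E3 => (1:ℝ)) (g := f)
    (v := EuclideanSpace.single i 1) (by simp) (by simpa using hi') (by simpa using hi) (by simp) (fun x _ => hf.diff x)
  simpa [pd] using this

lemma int_div_zero {V : Fin 3 → E3 → ℝ} (hf : ∀ k, Sm (V k)) (hc : ∀ k, HasCompactSupport (V k)) :
    ∫ y, ∑ k, pd k (V k) y = 0 := by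
  rw [integral_finsetSum]
  · exact Finset.sum_eq_zero fun k _ => int_pd_zero (hf k) (hc k) k
  · intro k _
    exact ((hf k).pd k).continuous.integrable_of_hasCompactSupport ((hc k).fderiv_apply ℝ _)

lemma int_by_parts {f g : E3 → ℝ} (hf : Sm f) (hg : Sm g) (hc : HasCompactSupport f) (i : Fin 3) :
    ∫ y, f y * pd i g y = - ∫ y, pd i f y * g y := by
  have h := int_pd_zero (hf.mul hg) (hc.mul_right (f' := g)) i
  have hfc : HasCompactSupport (pd i f) := hc.fderiv_apply ℝ _
  rw [show (fun y => pd i (fun y => f y * g y) y) = fun y => pd i f y * g y + f y * pd i g y from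
    funext fun y => pd_mul hf hg i y] at h
  have h1 : Integrable (fun y => pd i f y * g y) :=
    ((hf.pd i).continuous.mul hg.continuous).integrable_of_hasCompactSupport hfc.mul_right
  have h2 : Integrable (fun y => f y * pd i g y) :=
    (hf.continuous.mul (hg.pd i).continuous).integrable_of_hasCompactSupport hc.mul_right
  rw [integral_add h1 h2] at h
  linarith

end Part4

section Part5
/-- First derivative of the smooth transition. -/
def st1 : ℝ → ℝ := deriv Real.smoothTransition
/-- Second derivative of the smooth transition. -/
def st2 : ℝ → ℝ := deriv st1

lemma st_contDiff : ContDiff ℝ (⊤ : ℕ∞) Real.smoothTransition := Real.smoothTransition.contDiff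
lemma st1_contDiff : ContDiff ℝ (⊤ : ℕ∞) st1 := (contDiff_infty_iff_deriv.1 st_contDiff).2
lemma st2_contDiff : ContDiff ℝ (⊤ : ℕ∞) st2 := (contDiff_infty_iff_deriv.1 st1_contDiff).2

lemma st_hasDerivAt (t : ℝ) : HasDerivAt Real.smoothTransition (st1 t) t :=
  ((st_contDiff.differentiable (by simp)) t).hasDerivAt
lemma st1_hasDerivAt (t : ℝ) : HasDerivAt st1 (st2 t) t :=
  ((st1_contDiff.differentiable (by simp)) t).hasDerivAt

lemma st1_neg {t : ℝ} (ht : t < 0) : st1 t = 0 := by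
  have : Real.smoothTransition =ᶠ[nhds t] fun _ => 0 := by
    filter_upwards [Iio_mem_nhds ht] with x hx
    exact Real.smoothTransition.zero_of_nonpos (le_of_lt hx)
  rw [st1, this.deriv_eq]; simp

lemma st1_gt {t : ℝ} (ht : 1 < t) : st1 t = 0 := by
  have : Real.smoothTransition =ᶠ[nhds t] fun _ => 1 := by
    filter_upwards [Ioi_mem_nhds ht] with x hx
    exact Real.smoothTransition.one_of_one_le (le_of_lt hx)
  rw [st1, this.deriv_eq]; simp

lemma st2_neg {t : ℝ} (ht : t < 0) : st2 t = 0 := by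
  have : st1 =ᶠ[nhds t] fun _ => 0 := by
    filter_upwards [Iio_mem_nhds ht] with x hx
    exact st1_neg hx
  rw [st2, this.deriv_eq]; simp

lemma st2_gt {t : ℝ} (ht : 1 < t) : st2 t = 0 := by
  have : st1 =ᶠ[nhds t] fun _ => 0 := by
    filter_upwards [Ioi_mem_nhds ht] with x hx
    exact st1_gt hx
  rw [st2, this.deriv_eq]; simp

lemma st_bound : ∃ S, 0 < S ∧ ∀ t, |st1 t| ≤ S ∧ |st2 t| ≤ S := by
  obtain ⟨C1, h1⟩ := (isCompact_Icc (a := (0:ℝ)) (b := 1)).exists_bound_of_continuousOn st1_contDiff.continuous.continuousOn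
  obtain ⟨C2, h2⟩ := (isCompact_Icc (a := (0:ℝ)) (b := 1)).exists_bound_of_continuousOn st2_contDiff.continuous.continuousOn
  refine ⟨max (max C1 C2) 1, by positivity, fun t => ?_⟩
  by_cases h0 : t < 0
  · simp [st1_neg h0, st2_neg h0]
  by_cases h0' : 1 < t
  · simp [st1_gt h0', st2_gt h0']
  have ht : t ∈ Icc (0:ℝ) 1 := ⟨not_lt.1 h0, not_lt.1 h0'⟩
  exact ⟨(h1 t ht).trans ((le_max_left _ _).trans (le_max_left _ _)), (h2 t ht).trans ((le_max_right _ _).trans (le_max_left _ _))⟩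

lemma compactSupport_of_norm {f : E3 → ℝ} (ρ : ℝ) (h : ∀ y, ρ < ‖y‖ → f y = 0) : HasCompactSupport f := by
  refine HasCompactSupport.intro (isCompact_closedBall (0 : E3) ρ) fun y hy => h y ?_
  simpa using hy

lemma abs_coord_le (y : E3) (i : Fin 3) : |y i| ≤ ‖y‖ := by
  have := PiLp.norm_apply_le y i
  simpa using this

lemma cutoff_exists : ∃ C, 0 < C ∧ ∀ ρ d : ℝ, 1 ≤ ρ → 0 < d → d ≤ 1 → ∃ χ : E3 → ℝ, Sm χ ∧ (∀ y, 0 ≤ χ y) ∧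
    (∀ y, χ y ≤ 1) ∧ (∀ y, ‖y‖ ≤ ρ → χ y = 1) ∧ (∀ y, ρ + d < ‖y‖ → χ y = 0) ∧
    (∀ i y, |pd i χ y| ≤ C * d⁻¹) ∧ (∀ y, |lap χ y| ≤ C * d⁻¹ ^ 2) ∧
    (∀ i y, ρ + d < ‖y‖ → pd i χ y = 0) ∧ (∀ y, ρ + d < ‖y‖ → lap χ y = 0) ∧
    (∀ i y, ‖y‖ < ρ → pd i χ y = 0) ∧ (∀ y, ‖y‖ < ρ → lap χ y = 0) := by
  obtain ⟨S, hS, hSb⟩ := st_bound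
  refine ⟨10 * S, by positivity, fun ρ d hρ hd hd1 => ?_⟩
  set ρ' := ρ + d with hρ'
  set L := ρ' ^ 2 - ρ ^ 2 with hL
  have hLd : L = d * (2 * ρ + d) := by rw [hL, hρ']; ring
  have hL0 : 0 < L := by rw [hLd]; positivity
  set A : ℝ → ℝ := fun r => (ρ' ^ 2 - r) / L with hA
  have hAd : ∀ r, HasDerivAt A (-1 / L) r := fun r => by
    simpa [hA] using ((hasDerivAt_id r).const_sub (ρ' ^ 2)).div_const L
  have hAs : Sm (fun z => A (‖z - 0‖ ^ 2)) := by
    simp only [hA]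
    exact (contDiff_const.sub (Sm.normsq 0)).div_const L
  set q : ℝ → ℝ := fun r => Real.smoothTransition (A r) with hq
  set q1 : ℝ → ℝ := fun r => st1 (A r) * (-1 / L) with hq1
  set q2 : ℝ → ℝ := fun r => st2 (A r) * (-1 / L) * (-1 / L) with hq2
  have hqd : ∀ r, HasDerivAt q (q1 r) r := fun r => (st_hasDerivAt (A r)).comp r (hAd r)
  have hq1d : ∀ r, HasDerivAt q1 (q2 r) r := fun r => ((st1_hasDerivAt (A r)).comp r (hAd r)).mul_const _
  have hχs : Sm (fun z => q (‖z - 0‖ ^ 2)) := st_contDiff.comp hAs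
  have hq1s : Sm (fun z => q1 (‖z - 0‖ ^ 2)) := (st1_contDiff.comp hAs).mul contDiff_const
  have hpd : ∀ i y, pd i (fun z => q (‖z - 0‖ ^ 2)) y = 2 * (y i - 0) * q1 (‖y - 0‖ ^ 2) := fun i y =>
    pd_radial 0 i y (hqd _)
  have hlap : ∀ y, lap (fun z => q (‖z - 0‖ ^ 2)) y = 6 * q1 (‖y - 0‖ ^ 2) + 4 * ‖y - 0‖ ^ 2 * q2 (‖y - 0‖ ^ 2) := fun y =>
    lap_radial 0 y (fun r _ => hqd r) hq1s (hq1d _)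
  have hAout : ∀ y : E3, ρ' < ‖y‖ → A (‖y - 0‖ ^ 2) < 0 := by
    intro y hy
    simp only [hA, sub_zero]
    apply div_neg_of_neg_of_pos _ hL0
    have : 0 < ρ' := by positivity
    nlinarith
  have hAin : ∀ y : E3, ‖y‖ < ρ → 1 < A (‖y - 0‖ ^ 2) := by
    intro y hy
    simp only [hA, sub_zero]
    rw [lt_div_iff₀ hL0]
    nlinarith [norm_nonneg y]
  have hAin' : ∀ y : E3, ‖y‖ ≤ ρ → 1 ≤ A (‖y - 0‖ ^ 2) := by
    intro y hy
    simp only [hA, sub_zero]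
    rw [le_div_iff₀ hL0]
    nlinarith [norm_nonneg y]
  have q1out : ∀ y : E3, ρ' < ‖y‖ → q1 (‖y - 0‖ ^ 2) = 0 := fun y hy => by simp only [hq1, st1_neg (hAout y hy), zero_mul]
  have q2out : ∀ y : E3, ρ' < ‖y‖ → q2 (‖y - 0‖ ^ 2) = 0 := fun y hy => by simp only [hq2, st2_neg (hAout y hy), zero_mul]
  have q1in : ∀ y : E3, ‖y‖ < ρ → q1 (‖y - 0‖ ^ 2) = 0 := fun y hy => by simp only [hq1, st1_gt (hAin y hy), zero_mul]
  have q2in : ∀ y : E3, ‖y‖ < ρ → q2 (‖y - 0‖ ^ 2) = 0 := fun y hy => by simp only [hq2, st2_gt (hAin y hy), zero_mul]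
  have hq1b : ∀ r, |q1 r| ≤ S / L := fun r => by
    simp only [hq1]; rw [abs_mul, abs_div, abs_neg, abs_one, abs_of_pos hL0, mul_one_div]
    gcongr; exact (hSb _).1
  have hq2b : ∀ r, |q2 r| ≤ S / L ^ 2 := fun r => by
    simp only [hq2]; rw [abs_mul, abs_mul, abs_div, abs_neg, abs_one, abs_of_pos hL0]
    rw [mul_assoc, show 1 / L * (1 / L) = 1 / L ^ 2 by field_simp, mul_one_div]
    gcongr; exact (hSb _).2
  have hLρ : d * ρ' ≤ L := by rw [hLd, hρ']; gcongr; linarith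
  have hρ'1 : 1 ≤ ρ' := by linarith
  have hb1 : ρ' / L ≤ d⁻¹ := by
    rw [div_le_iff₀ hL0, inv_mul_eq_div, le_div_iff₀ hd]; linarith
  have hb2 : 1 / L ≤ d⁻¹ := le_trans (by gcongr) hb1
  refine ⟨fun z => q (‖z - 0‖ ^ 2), hχs, fun y => Real.smoothTransition.nonneg _, fun y => Real.smoothTransition.le_one _,
    fun y hy => Real.smoothTransition.one_of_one_le (hAin' y hy),
    fun y hy => Real.smoothTransition.zero_of_nonpos (hAout y hy).le, ?_, ?_, ?_, ?_, ?_, ?_⟩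
  · intro i y
    rw [hpd]
    by_cases hy : ρ' < ‖y‖
    · rw [q1out y hy]; simp; positivity
    · have h1 := abs_coord_le y i
      rw [sub_zero, abs_mul, abs_mul, abs_two]
      calc 2 * |y i| * |q1 (‖y - 0‖ ^ 2)| ≤ 2 * ρ' * (S / L) := by
            gcongr
            · exact h1.trans (not_lt.1 hy)
            · exact hq1b _
        _ = 2 * S * (ρ' / L) := by ring
        _ ≤ 2 * S * d⁻¹ := by gcongr
        _ ≤ _ := by gcongr; norm_num
  · intro y
    rw [hlap]
    by_cases hy : ρ' < ‖y‖
    · rw [q1out y hy, q2out y hy]; simp; positivity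
    · calc |6 * q1 (‖y - 0‖ ^ 2) + 4 * ‖y - 0‖ ^ 2 * q2 (‖y - 0‖ ^ 2)|
          ≤ |6 * q1 (‖y - 0‖ ^ 2)| + |4 * ‖y - 0‖ ^ 2 * q2 (‖y - 0‖ ^ 2)| := abs_add_le _ _
        _ = 6 * |q1 (‖y - 0‖ ^ 2)| + 4 * ‖y‖ ^ 2 * |q2 (‖y - 0‖ ^ 2)| := by
          rw [abs_mul, abs_mul, abs_mul]; simp
        _ ≤ 6 * (S / L) + 4 * ρ' ^ 2 * (S / L ^ 2) := by
          gcongr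
          · exact hq1b _
          · exact not_lt.1 hy
          · exact hq2b _
        _ = 6 * S * (1 / L) + 4 * S * (ρ' / L) ^ 2 := by field_simp
        _ ≤ 6 * S * d⁻¹ ^ 2 + 4 * S * d⁻¹ ^ 2 := by
          gcongr
          refine hb2.trans ?_
          have : 1 ≤ d⁻¹ := (one_le_inv₀ hd).2 hd1
          nlinarith
        _ = _ := by ring
  · intro i y hy; rw [hpd, q1out y hy]; simp
  · intro y hy; rw [hlap, q1out y hy, q2out y hy]; simp
  · intro i y hy; rw [hpd, q1in y hy]; simp
  · intro y hy; rw [hlap, q1in y hy, q2in y hy]; simp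

lemma kernel_exists : ∃ φ Φ : E3 → ℝ, Sm φ ∧ Sm Φ ∧ (∀ z, 1 < ‖z‖ → φ z = 0) ∧ (∀ z, 1 < ‖z‖ → Φ z = 0) ∧
    (∫ z, φ z = 1) ∧ (∀ i z, pd i Φ z = - (z i * φ z)) := by
  have hAs : Sm (fun z => 1 - ‖z - 0‖ ^ 2) := contDiff_const.sub (Sm.normsq 0)
  have hAd : ∀ r : ℝ, HasDerivAt (fun r => 1 - r) (-1) r := fun r => (hasDerivAt_id r).const_sub 1
  have hqd : ∀ r, HasDerivAt (fun r => Real.smoothTransition (1 - r)) (st1 (1 - r) * (-1)) r := fun r => (st_hasDerivAt (1 - r)).comp r (hAd r)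
  set φ0 : E3 → ℝ := fun z => 2 * st1 (1 - ‖z - 0‖ ^ 2) with hφ0
  set Φ0 : E3 → ℝ := fun z => Real.smoothTransition (1 - ‖z - 0‖ ^ 2) with hΦ0
  have hφs : Sm φ0 := contDiff_const.mul (st1_contDiff.comp hAs)
  have hΦs : Sm Φ0 := st_contDiff.comp hAs
  have hout : ∀ z : E3, 1 < ‖z‖ → 1 - ‖z - 0‖ ^ 2 < 0 := by
    intro z hz; rw [sub_zero]; nlinarith
  have h1 : ∀ z : E3, 1 < ‖z‖ → φ0 z = 0 := fun z hz => by simp only [hφ0, st1_neg (hout z hz), mul_zero]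
  have h2 : ∀ z : E3, 1 < ‖z‖ → Φ0 z = 0 := fun z hz => Real.smoothTransition.zero_of_nonpos (hout z hz).le
  have h3 : ∀ i z, pd i Φ0 z = - (z i * φ0 z) := by
    intro i z
    rw [hΦ0, pd_radial 0 i z (hqd _)]; simp [hφ0]; ring
  have hpos : 0 < ∫ z, φ0 z := by
    obtain ⟨t, ht, hdt⟩ := exists_hasDerivAt_eq_slope Real.smoothTransition st1 one_pos
      (Real.smoothTransition.continuous.continuousOn) (fun x _ => st_hasDerivAt x)
    simp at hdt
    refine hφs.continuous.integral_pos_of_hasCompactSupport_nonneg_nonzero (compactSupport_of_norm 1 h1) ?_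
      (x := EuclideanSpace.single 0 (Real.sqrt (1 - t))) ?_
    · intro z
      have : 0 ≤ st1 (1 - ‖z - 0‖ ^ 2) := Real.smoothTransition.monotone.deriv_nonneg
      simp only [hφ0, Pi.zero_apply]; positivity
    · simp only [hφ0, sub_zero]
      rw [PiLp.norm_single, Real.norm_eq_abs, sq_abs, Real.sq_sqrt (by linarith [ht.2])]
      rw [show (1:ℝ) - (1 - t) = t by ring, hdt]; norm_num
  set c := ∫ z, φ0 z with hc
  refine ⟨fun z => c⁻¹ * φ0 z, fun z => c⁻¹ * Φ0 z, contDiff_const.mul hφs, contDiff_const.mul hΦs,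
    fun z hz => by simp [h1 z hz], fun z hz => by simp [h2 z hz], ?_, ?_⟩
  · rw [integral_const_mul]; exact inv_mul_cancel₀ hpos.ne'
  · intro i z
    rw [pd_cmul hΦs, h3]; ring

/-- Averaging kernel. -/
def phiK : E3 → ℝ := kernel_exists.choose
/-- Potential kernel. -/
def PhiK : E3 → ℝ := kernel_exists.choose_spec.choose
lemma phiK_sm : Sm phiK := kernel_exists.choose_spec.choose_spec.1
lemma PhiK_sm : Sm PhiK := kernel_exists.choose_spec.choose_spec.2.1
lemma phiK_out {z : E3} : 1 < ‖z‖ → phiK z = 0 := kernel_exists.choose_spec.choose_spec.2.2.1 z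
lemma PhiK_out {z : E3} : 1 < ‖z‖ → PhiK z = 0 := kernel_exists.choose_spec.choose_spec.2.2.2.1 z
lemma phiK_int : ∫ z, phiK z = 1 := kernel_exists.choose_spec.choose_spec.2.2.2.2.1
lemma PhiK_pd (i : Fin 3) (z : E3) : pd i PhiK z = - (z i * phiK z) := kernel_exists.choose_spec.choose_spec.2.2.2.2.2 i z
lemma phiK_cs : HasCompactSupport phiK := compactSupport_of_norm 1 fun z => phiK_out
lemma PhiK_cs : HasCompactSupport PhiK := compactSupport_of_norm 1 fun z => PhiK_out

end Part5

section Part6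
lemma int_kernel {φ g : E3 → ℝ} (hφ : Continuous φ) (hs : ∀ z, 1 < ‖z‖ → φ z = 0) (hg : Continuous g) :
    Integrable (fun z => φ z * g z) :=
  (hφ.mul hg).integrable_of_hasCompactSupport (compactSupport_of_norm 1 hs).mul_right

lemma avg_ftc (φ : E3 → ℝ) (hφ : Continuous φ) (hs : ∀ z, 1 < ‖z‖ → φ z = 0) (G G' : ℝ → E3 → ℝ)
    (hG : ∀ s z, HasDerivAt (fun s => G s z) (G' s z) s) (hGc : ∀ s, Continuous (G s))
    (hG' : Continuous (Function.uncurry G')) (b : ℝ) (hb : 0 ≤ b) :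
    (∫ z, φ z * G b z) - (∫ z, φ z * G 0 z) = ∫ s in (0:ℝ)..b, ∫ z, φ z * G' s z := by
  rw [← integral_sub (int_kernel hφ hs (hGc b)) (int_kernel hφ hs (hGc 0))]
  have h1 : ∀ z, φ z * G b z - φ z * G 0 z = ∫ s in Ioc 0 b, φ z * G' s z := by
    intro z
    have hc : Continuous (fun s => G' s z) := hG'.comp (by fun_prop : Continuous fun s : ℝ => (s, z))
    have := intervalIntegral.integral_eq_sub_of_hasDerivAt (a := 0) (b := b) (fun s _ => hG s z) (hc.intervalIntegrable _ _)
    rw [intervalIntegral.integral_of_le hb] at this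
    rw [integral_const_mul, this]; ring
  simp_rw [h1]
  rw [intervalIntegral.integral_of_le hb]
  refine integral_integral_swap ?_
  have hcont : Continuous (Function.uncurry fun (z : E3) (s : ℝ) => φ z * G' s z) := by
    refine (hφ.comp continuous_fst).mul (hG'.comp (by fun_prop : Continuous fun p : E3 × ℝ => (p.2, p.1)))
  have e : (volume : Measure E3).prod (volume.restrict (Ioc 0 b)) = ((volume : Measure E3).prod (volume : Measure ℝ)).restrict (univ ×ˢ Ioc 0 b) := by
    rw [← Measure.prod_restrict, Measure.restrict_univ]
  rw [e]
  have hK : IntegrableOn (Function.uncurry fun (z : E3) (s : ℝ) => φ z * G' s z) (closedBall 0 1 ×ˢ Icc 0 b)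
      ((volume : Measure E3).prod (volume : Measure ℝ)) :=
    hcont.continuousOn.integrableOn_compact ((isCompact_closedBall _ _).prod isCompact_Icc)
  refine IntegrableOn.of_forall_diff_eq_zero (hK.mono_set (prod_mono_right Ioc_subset_Icc_self)) (MeasurableSet.univ.prod measurableSet_Ioc) ?_
  rintro ⟨z, s⟩ ⟨⟨_, h2⟩, h3⟩
  have : z ∉ closedBall (0 : E3) 1 := fun h => h3 ⟨h, h2⟩
  simp only [Function.uncurry]
  rw [hs z (by simpa using this), zero_mul]

lemma int_lap (h : E3 → ℝ) (hh : Sm h) (y : E3) (s : ℝ) :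
    ∫ z, phiK z * ∑ i, z i * pd i h (y + s • z) = s * ∫ z, PhiK z * lap h (y + s • z) := by
  have h1 : ∀ i : Fin 3, ∫ z, phiK z * (z i * pd i h (y + s • z)) = s * ∫ z, PhiK z * pd i (pd i h) (y + s • z) := by
    intro i
    have := int_by_parts PhiK_sm ((hh.pd i).affine y s) PhiK_cs i
    simp_rw [pd_affine (hh.pd i) y s i, PhiK_pd] at this
    rw [← integral_const_mul]
    calc _ = - ∫ z, -(z i * phiK z) * pd i h (y + s • z) := by
          rw [← integral_neg]; congr 1; ext z; ring
      _ = _ := by rw [← this]; congr 1; ext z; ring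
  simp_rw [Finset.mul_sum, lap, Finset.mul_sum]
  rw [integral_finsetSum, integral_finsetSum, Finset.mul_sum]
  · exact Finset.sum_congr rfl fun i _ => h1 i
  · intro i _
    exact int_kernel PhiK_sm.continuous (fun z => PhiK_out) (((hh.pd i).pd i).affine y s).continuous
  · intro i _
    exact int_kernel phiK_sm.continuous (fun z => phiK_out) ((Sm.coord i).continuous.mul ((hh.pd i).affine y s).continuous)

lemma avg_formula (h : E3 → ℝ) (hh : Sm h) (y : E3) (δ : ℝ) (hδ : 0 ≤ δ) :
    h y = (∫ z, phiK z * h (y + δ • z)) - ∫ s in (0:ℝ)..δ, s * ∫ z, PhiK z * lap h (y + s • z) := by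
  have := avg_ftc phiK phiK_sm.continuous (fun z => phiK_out) (fun s z => h (y + s • z))
    (fun s z => ∑ i, z i * pd i h (y + s • z)) (fun s z => hasDerivAt_along hh y z s)
    (fun s => (hh.affine y s).continuous) ?_ δ hδ
  · simp_rw [int_lap h hh y] at this
    rw [← this]
    simp only [zero_smul, add_zero]
    rw [integral_mul_const, phiK_int]; ring
  · have : ∀ i, Continuous (pd i h) := fun i => (hh.pd i).continuous
    simp only [Function.uncurry_def]
    refine continuous_finsetSum _ fun i _ => ?_
    refine Continuous.mul (by fun_prop) ((this i).comp (by fun_prop))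

lemma kernel_bound (φ : E3 → ℝ) (hφ : Continuous φ) (hs : ∀ z, 1 < ‖z‖ → φ z = 0) :
    ∃ C, 0 < C ∧ ∀ z, |φ z| ≤ C := by
  obtain ⟨C, hC⟩ := (isCompact_closedBall (0 : E3) 1).exists_bound_of_continuousOn hφ.continuousOn
  refine ⟨max C 1, by positivity, fun z => ?_⟩
  by_cases hz : 1 < ‖z‖
  · rw [hs z hz]; simp
  · exact (hC z (by simpa using hz)).trans (le_max_left _ _)

lemma kernel_int_le (φ g : E3 → ℝ) (hφ : Continuous φ) (hs : ∀ z, 1 < ‖z‖ → φ z = 0) (C : ℝ) (hC : ∀ z, |φ z| ≤ C)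
    (y : E3) (s : ℝ) :
    ‖∫ z, φ z * g (y + s • z)‖ₑ ≤ ENNReal.ofReal C * AV s (fun x => ‖g x‖ₑ) y := by
  have : ∫ z, φ z * g (y + s • z) = ∫ z in closedBall (0 : E3) 1, φ z * g (y + s • z) := by
    rw [setIntegral_eq_integral_of_forall_compl_eq_zero]
    intro z hz
    rw [hs z (by simpa using hz), zero_mul]
  rw [this, AV, ← lintegral_const_mul' _ _ ENNReal.ofReal_ne_top]
  refine (enorm_integral_le_lintegral_enorm _).trans (lintegral_mono fun z => ?_)
  rw [enorm_mul]
  gcongr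
  rw [← ofReal_norm]
  exact ENNReal.ofReal_le_ofReal (hC z)

lemma avg_bound : ∃ C, 0 < C ∧ ∀ (h : E3 → ℝ) (hh : Sm h) (y : E3) (δ : ℝ), 0 < δ →
    ‖h y - ∫ z, phiK z * h (y + δ • z)‖ₑ ≤ ENNReal.ofReal C * IA 1 δ (fun x => ‖lap h x‖ₑ) y := by
  obtain ⟨C, hC0, hC⟩ := kernel_bound PhiK PhiK_sm.continuous (fun z => PhiK_out)
  refine ⟨C, hC0, fun h hh y δ hδ => ?_⟩
  have e := avg_formula h hh y δ hδ.le
  have e2 : h y - ∫ z, phiK z * h (y + δ • z) = - ∫ s in (0:ℝ)..δ, s * ∫ z, PhiK z * lap h (y + s • z) := by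
    linarith
  rw [e2, enorm_neg, intervalIntegral.integral_of_le hδ.le, integral_Ioc_eq_integral_Ioo, IA,
    ← lintegral_const_mul' _ _ ENNReal.ofReal_ne_top]
  refine (enorm_integral_le_lintegral_enorm _).trans (setLIntegral_mono' measurableSet_Ioo fun s hs => ?_)
  rw [enorm_mul, Real.rpow_one]
  have h1 : ‖s‖ₑ = ENNReal.ofReal s := by rw [← ofReal_norm, Real.norm_eq_abs, abs_of_pos hs.1]
  rw [h1]
  calc _ ≤ ENNReal.ofReal s * (ENNReal.ofReal C * AV s (fun x => ‖lap h x‖ₑ) y) := by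
        gcongr
        exact kernel_int_le _ _ PhiK_sm.continuous (fun z => PhiK_out) C hC y s
    _ = _ := by ring

end Part6

section Part7
/-- Component form of the profile equations. -/
structure SolC (a : ℝ) (u : Fin 3 → E3 → ℝ) (P : E3 → ℝ) : Prop where
  hu : ∀ i, Sm (u i)
  hP : Sm P
  heq : ∀ (y : E3) (i : Fin 3), - lap (u i) y + a * u i y + a * (∑ k : Fin 3, y k * pd k (u i) y)
        + (∑ k : Fin 3, u k y * pd k (u i) y) + pd i P y = 0
  hdiv : ∀ y : E3, (∑ k : Fin 3, pd k (u k) y) = 0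

variable {a : ℝ} {u : Fin 3 → E3 → ℝ} {P : E3 → ℝ}

lemma SolC.div1 (h : SolC a u P) (k : Fin 3) (y : E3) : ∑ i, pd k (pd i (u i)) y = 0 := by
  rw [← pd_sum (fun i => (h.hu i).pd i) k y]
  have : (fun z => ∑ j, pd j (u j) z) = fun _ => 0 := by ext z; exact h.hdiv z
  rw [this, pd_const]

lemma SolC.div2 (h : SolC a u P) (k l : Fin 3) (y : E3) : ∑ i, pd k (pd l (pd i (u i))) y = 0 := by
  rw [← pd_sum (fun i => ((h.hu i).pd i).pd l) k y]
  have : (fun z => ∑ j, pd l (pd j (u j)) z) = fun _ => 0 := by ext z; exact h.div1 l z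
  rw [this, pd_const]

lemma pd_eta (i : Fin 3) (f : E3 → ℝ) : (fun y => pd i f y) = pd i f := rfl

lemma SolC.pdP (h : SolC a u P) (i : Fin 3) :
    pd i P = fun y => (lap (u i) y - a * u i y) - (a * (∑ k : Fin 3, y k * pd k (u i) y)
        + (∑ k : Fin 3, u k y * pd k (u i) y)) := by
  ext y; linarith [h.heq y i]

lemma SolC.pdpdP (h : SolC a u P) (i : Fin 3) (y : E3) :
    pd i (pd i P) y = (∑ k, pd i (pd k (pd k (u i))) y) - a * pd i (u i) y
      - (a * (∑ k : Fin 3, ((if k = i then 1 else 0) * pd k (u i) y + y k * pd i (pd k (u i)) y))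
        + (∑ k : Fin 3, (pd i (u k) y * pd k (u i) y + u k y * pd i (pd k (u i)) y))) := by
  rw [h.pdP i]
  have hu := h.hu
  have s1 : ∀ k, Sm (fun y : E3 => y k * pd k (u i) y) := fun k => (Sm.coord k).mul ((hu i).pd k)
  have s2 : ∀ k, Sm (fun y : E3 => u k y * pd k (u i) y) := fun k => (hu k).mul ((hu i).pd k)
  have s3 : Sm (fun y : E3 => a * u i y) := (Sm.cst a).mul (hu i)
  have s4 : Sm (fun y : E3 => ∑ k, y k * pd k (u i) y) := ContDiff.sum fun k _ => s1 k
  have s5 : Sm (fun y : E3 => ∑ k, u k y * pd k (u i) y) := ContDiff.sum fun k _ => s2 k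
  have s6 : Sm (fun y : E3 => a * ∑ k, y k * pd k (u i) y) := (Sm.cst a).mul s4
  have e1 : pd i (lap (u i)) y = ∑ k, pd i (pd k (pd k (u i))) y := by
    rw [← pd_sum (fun k => ((hu i).pd k).pd k)]; rfl
  rw [pd_sub ((hu i).lap.sub s3) (s6.add s5), pd_sub (hu i).lap s3, pd_add s6 s5, pd_cmul (hu i), pd_cmul s4,
    pd_sum s1, pd_sum s2, e1]
  simp_rw [fun k => pd_mul (Sm.coord k) ((hu i).pd k) i y, fun k => pd_mul (hu k) ((hu i).pd k) i y, pd_coord]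

lemma SolC.lapP (h : SolC a u P) (y : E3) :
    lap P y = - ∑ i, ∑ k, pd i (u k) y * pd k (u i) y := by
  have hu := h.hu
  have c2 : ∀ i k l, pd i (pd k (pd k (u l))) y = pd k (pd k (pd i (u l))) y := by
    intro i k l
    rw [pd_comm ((hu l).pd k)]
    have : pd i (pd k (u l)) = pd k (pd i (u l)) := by ext z; exact pd_comm (hu l) i k z
    rw [this]
  have e : lap P y = ∑ i, pd i (pd i P) y := rfl
  rw [e]
  simp_rw [fun i => h.pdpdP i y]
  have d1 := fun k => h.div1 k y
  have d2 := fun k => h.div2 k k y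
  have d0 := h.hdiv y
  have c1 := fun i k l => pd_comm (hu l) i k y
  simp only [Fin.sum_univ_three] at d0 d1 d2 ⊢
  have d10 := d1 0
  have d11 := d1 1
  have d12 := d1 2
  have d20 := d2 0
  have d21 := d2 1
  have d22 := d2 2
  rw [c1 0 1 1, c1 0 2 2] at d10
  rw [c1 1 0 0, c1 1 2 2] at d11
  rw [c1 2 0 0, c1 2 1 1] at d12
  rw [c2 0 1 0, c2 0 2 0, c2 1 0 1, c2 1 2 1, c2 2 0 2, c2 2 1 2]
  simp
  linear_combination d20 + d21 + d22 - 2 * a * d0 - (a * y 0 + u 0 y) * d10 - (a * y 1 + u 1 y) * d11 - (a * y 2 + u 2 y) * d12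

/-- sum of squares of all first derivatives -/
def DU2 (u : Fin 3 → E3 → ℝ) (y : E3) : ℝ := ∑ i, ∑ k, (pd k (u i) y) ^ 2

lemma SolC.abs_lapP (h : SolC a u P) (y : E3) : |lap P y| ≤ DU2 u y := by
  rw [h.lapP, DU2, abs_neg, abs_le]
  simp only [Fin.sum_univ_three]
  constructor <;> nlinarith [sq_nonneg (pd 0 (u 1) y - pd 1 (u 0) y), sq_nonneg (pd 0 (u 2) y - pd 2 (u 0) y), sq_nonneg (pd 1 (u 2) y - pd 2 (u 1) y), sq_nonneg (pd 0 (u 1) y + pd 1 (u 0) y), sq_nonneg (pd 0 (u 2) y + pd 2 (u 0) y), sq_nonneg (pd 1 (u 2) y + pd 2 (u 1) y), sq_nonneg (pd 0 (u 0) y), sq_nonneg (pd 1 (u 1) y), sq_nonneg (pd 2 (u 2) y)]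

lemma DU2_nonneg (u : Fin 3 → E3 → ℝ) (y : E3) : 0 ≤ DU2 u y := by unfold DU2; positivity

lemma SolC.DU2_cont (h : SolC a u P) : Continuous (DU2 u) := by
  unfold DU2
  exact continuous_finsetSum _ fun i _ => continuous_finsetSum _ fun k _ => ((h.hu i).pd k).continuous.pow 2

/-- kinetic energy density (half norm squared) -/
def qU (u : Fin 3 → E3 → ℝ) (y : E3) : ℝ := (1/2) * ∑ i, u i y * u i y

lemma SolC.qU_sm (h : SolC a u P) : Sm (qU u) :=
  (Sm.cst _).mul (ContDiff.sum fun i _ => (h.hu i).mul (h.hu i))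

lemma SolC.pd_qU (h : SolC a u P) (k : Fin 3) (y : E3) : pd k (qU u) y = ∑ i, u i y * pd k (u i) y := by
  unfold qU
  rw [pd_cmul (ContDiff.sum fun i _ => (h.hu i).mul (h.hu i)), pd_sum (fun i => (h.hu i).mul (h.hu i))]
  simp_rw [fun i => pd_mul (h.hu i) (h.hu i) k y]
  simp only [Fin.sum_univ_three]; ring

lemma SolC.lap_qU (h : SolC a u P) (y : E3) : lap (qU u) y = DU2 u y + ∑ i, u i y * lap (u i) y := by
  have : ∀ k, pd k (qU u) = fun y => ∑ i, u i y * pd k (u i) y := fun k => by ext y; exact h.pd_qU k y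
  unfold lap DU2
  simp_rw [this]
  simp_rw [fun k => pd_sum (fun i => (h.hu i).mul ((h.hu i).pd k)) k y]
  simp_rw [fun i k => pd_mul (h.hu i) ((h.hu i).pd k) k y]
  simp only [Fin.sum_univ_three]; ring

lemma energy_identity (h : SolC a u P) {χ : E3 → ℝ} (hχ : Sm χ) (hc : HasCompactSupport χ) (c : ℝ) :
    ∫ y, DU2 u y * χ y = ∫ y, (qU u y * lap χ y + a * (qU u y * χ y) + a * (qU u y * ∑ k, y k * pd k χ y)
      + qU u y * (∑ k, u k y * pd k χ y) + (P y - c) * ∑ k, u k y * pd k χ y) := by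
  have hu := h.hu
  have hq := h.qU_sm
  have hPc : Sm (fun y => P y - c) := h.hP.sub (Sm.cst c)
  -- T k: the factor multiplying χ
  have sw : ∀ k, Sm (fun y => a * y k + u k y) := fun k => ((Sm.cst a).mul (Sm.coord k)).add (hu k)
  set T : Fin 3 → E3 → ℝ := fun k y => pd k (qU u) y - ((a * y k + u k y) * qU u y + (P y - c) * u k y) with hT
  have sT : ∀ k, Sm (T k) := fun k => (hq.pd k).sub (((sw k).mul hq).add (hPc.mul (hu k)))
  have s1 : ∀ k, Sm (fun y => χ y * T k y) := fun k => hχ.mul (sT k)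
  have s2 : ∀ k, Sm (fun y => pd k χ y * qU u y) := fun k => (hχ.pd k).mul hq
  have hz := int_div_zero (V := fun k y => χ y * T k y - pd k χ y * qU u y) (fun k => (s1 k).sub (s2 k))
    (fun k => (hc.mul_right).sub ((hc.fderiv_apply ℝ (EuclideanSpace.single k 1)).mul_right (f' := qU u)))
  have key : ∀ y, ∑ k, pd k (fun y => χ y * T k y - pd k χ y * qU u y) y = DU2 u y * χ y -
      (qU u y * lap χ y + a * (qU u y * χ y) + a * (qU u y * ∑ k, y k * pd k χ y)
      + qU u y * (∑ k, u k y * pd k χ y) + (P y - c) * ∑ k, u k y * pd k χ y) := by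
    intro y
    have pT : ∀ k, pd k (T k) y = pd k (pd k (qU u)) y - ((a + pd k (u k) y) * qU u y + (a * y k + u k y) * pd k (qU u) y
        + (pd k P y * u k y + (P y - c) * pd k (u k) y)) := by
      intro k
      rw [hT]
      simp only
      have e1 : Sm (fun y => (a * y k + u k y) * qU u y) := (sw k).mul hq
      have e2 : Sm (fun y => (P y - c) * u k y) := hPc.mul (hu k)
      have e3 : Sm (fun y => a * y k) := (Sm.cst a).mul (Sm.coord k)
      rw [pd_sub (hq.pd k) (e1.add e2), pd_add e1 e2, pd_mul (sw k) hq, pd_mul hPc (hu k), pd_add e3 (hu k),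
        pd_cmul (Sm.coord k), pd_sub h.hP (Sm.cst c), pd_const, pd_coord]
      simp
    have pV : ∀ k, pd k (fun y => χ y * T k y - pd k χ y * qU u y) y = pd k χ y * T k y + χ y * pd k (T k) y
        - (pd k (pd k χ) y * qU u y + pd k χ y * pd k (qU u) y) := by
      intro k
      rw [pd_sub (s1 k) (s2 k), pd_mul hχ (sT k), pd_mul (hχ.pd k) hq]
    simp_rw [pV, pT]
    have l1 : ∑ k, pd k (pd k (qU u)) y = DU2 u y + ∑ i, u i y * lap (u i) y := h.lap_qU y
    have l2 : lap χ y = ∑ k, pd k (pd k χ) y := rfl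
    have l3 := fun k => h.pd_qU k y
    have l4 : qU u y = (1/2) * ∑ i, u i y * u i y := rfl
    have he := h.heq y
    have hd := h.hdiv y
    rw [l2]
    simp only [hT]
    simp only [Fin.sum_univ_three] at l1 l3 l4 hd he ⊢
    have he0 := he 0
    have he1 := he 1
    have he2 := he 2
    rw [l3 0, l3 1, l3 2]
    linear_combination χ y * l1 - χ y * (qU u y + (P y - c)) * hd - χ y * (u 0 y * he0 + u 1 y * he1 + u 2 y * he2)
      - 2 * a * χ y * l4
  simp_rw [key] at hz
  have cq := hq.continuous
  have cu := fun k => (hu k).continuous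
  have cχ := hχ.continuous
  have cχ1 := fun k => (hχ.pd k).continuous
  have cχ2 := hχ.lap.continuous
  have cP := h.hP.continuous
  have supp0 : ∀ y ∉ tsupport χ, χ y = 0 := fun y hy => image_eq_zero_of_notMem_tsupport hy
  have supp1 : ∀ k, ∀ y ∉ tsupport χ, pd k χ y = 0 := fun k y hy => by
    have : fderiv ℝ χ y = 0 := image_eq_zero_of_notMem_tsupport (fun hh => hy (tsupport_fderiv_subset ℝ hh))
    simp [pd, this]
  have supp2 : ∀ y ∉ tsupport χ, lap χ y = 0 := fun y hy => by
    unfold lap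
    refine Finset.sum_eq_zero fun k _ => ?_
    have hs : tsupport (pd k χ) ⊆ tsupport χ := by
      refine closure_minimal (fun z hz => ?_) (isClosed_tsupport _)
      by_contra hcon; exact hz (supp1 k z hcon)
    have : fderiv ℝ (pd k χ) y = 0 := image_eq_zero_of_notMem_tsupport (fun hh => hy (hs (tsupport_fderiv_subset ℝ hh)))
    change fderiv ℝ (pd k χ) y _ = 0
    simp [this]
  have csum1 : Continuous (fun y => ∑ k, y k * pd k χ y) := continuous_finsetSum _ fun k _ => (Sm.coord k).continuous.mul (cχ1 k)
  have csum2 : Continuous (fun y => ∑ k, u k y * pd k χ y) := continuous_finsetSum _ fun k _ => (cu k).mul (cχ1 k)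
  have i1 : Integrable (fun y => DU2 u y * χ y) := (h.DU2_cont.mul cχ).integrable_of_hasCompactSupport hc.mul_left
  have i2 : Integrable (fun y => (qU u y * lap χ y + a * (qU u y * χ y) + a * (qU u y * ∑ k, y k * pd k χ y)
      + qU u y * (∑ k, u k y * pd k χ y) + (P y - c) * ∑ k, u k y * pd k χ y)) := by
    refine Continuous.integrable_of_hasCompactSupport (by fun_prop) ?_
    refine HasCompactSupport.intro hc fun y hy => ?_
    simp [supp0 y hy, supp1 _ y hy, supp2 y hy]
  rw [integral_sub i1 i2] at hz
  linarith

/-- Leray head pressure. -/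
def PiF (a : ℝ) (u : Fin 3 → E3 → ℝ) (P : E3 → ℝ) (y : E3) : ℝ := qU u y + P y + a * ∑ k, y k * u k y

lemma SolC.Pi_sm (h : SolC a u P) : Sm (PiF a u P) :=
  (h.qU_sm.add h.hP).add ((Sm.cst a).mul (ContDiff.sum fun k _ => (Sm.coord k).mul (h.hu k)))

lemma SolC.pd_Pi (h : SolC a u P) (k : Fin 3) (y : E3) : pd k (PiF a u P) y =
    pd k (qU u) y + pd k P y + a * (u k y + ∑ j, y j * pd k (u j) y) := by
  have s1 : ∀ j, Sm (fun y : E3 => y j * u j y) := fun j => (Sm.coord j).mul (h.hu j)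
  have s2 : Sm (fun y : E3 => ∑ j, y j * u j y) := ContDiff.sum fun j _ => s1 j
  unfold PiF
  rw [pd_add (h.qU_sm.add h.hP) ((Sm.cst a).mul s2), pd_add h.qU_sm h.hP, pd_cmul s2, pd_sum s1]
  simp_rw [fun j => pd_mul (Sm.coord j) (h.hu j) k y, pd_coord]
  congr 2
  simp only [Fin.sum_univ_three]
  fin_cases k <;> simp <;> ring

lemma SolC.LPi (h : SolC a u P) (y : E3) :
    lap (PiF a u P) y - ∑ k, (u k y + a * y k) * pd k (PiF a u P) y
      = (1/2) * ∑ i, ∑ j, (pd i (u j) y - pd j (u i) y) ^ 2 := by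
  have hu := h.hu
  have e1 : ∀ k, pd k (pd k (PiF a u P)) y = pd k (pd k (qU u)) y + pd k (pd k P) y +
     a * (pd k (u k) y + ∑ j, ((if j = k then 1 else 0) * pd k (u j) y + y j * pd k (pd k (u j)) y)) := by
    intro k
    rw [show pd k (PiF a u P) = fun y => pd k (qU u) y + pd k P y + a * (u k y + ∑ j, y j * pd k (u j) y) from
      funext fun y => h.pd_Pi k y]
    have s1 : ∀ j, Sm (fun y : E3 => y j * pd k (u j) y) := fun j => (Sm.coord j).mul ((h.hu j).pd k)
    have s2 : Sm (fun y : E3 => ∑ j, y j * pd k (u j) y) := ContDiff.sum fun j _ => s1 j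
    have s3 : Sm (fun y : E3 => u k y + ∑ j, y j * pd k (u j) y) := (hu k).add s2
    rw [pd_add ((h.qU_sm.pd k).add (h.hP.pd k)) ((Sm.cst a).mul s3), pd_add (h.qU_sm.pd k) (h.hP.pd k), pd_cmul s3,
      pd_add (hu k) s2, pd_sum s1]
    simp_rw [fun j => pd_mul (Sm.coord j) ((h.hu j).pd k) k y, pd_coord]
  have e2 : lap (PiF a u P) y = ∑ k, pd k (pd k (PiF a u P)) y := rfl
  have e3 : ∀ j, ∑ k, pd k (pd k (u j)) y = lap (u j) y := fun j => rfl
  have e4 : ∑ k, pd k (pd k (qU u)) y = DU2 u y + ∑ i, u i y * lap (u i) y := h.lap_qU y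
  have e5 : ∑ k, pd k (pd k P) y = - ∑ i, ∑ k, pd i (u k) y * pd k (u i) y := h.lapP y
  have e6 : DU2 u y = ∑ i, ∑ k, (pd k (u i) y) ^ 2 := rfl
  have hd := h.hdiv y
  have he := h.heq y
  have l3 := fun k => h.pd_qU k y
  rw [e2]
  simp_rw [e1, fun k => h.pd_Pi k y, l3]
  simp only [Fin.sum_univ_three] at e3 e4 e5 e6 hd he ⊢
  have f0 := e3 0
  have f1 := e3 1
  have f2 := e3 2
  have he0 := he 0
  have he1 := he 1
  have he2 := he 2
  simp
  linear_combination e4 + e5 + e6 + a * y 0 * f0 + a * y 1 * f1 + a * y 2 * f2 + 2 * a * hd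
    - (u 0 y + a * y 0) * he0 - (u 1 y + a * y 1) * he1 - (u 2 y + a * y 2) * he2

end Part7

section Part8
/-- Full set of working hypotheses. -/
structure Sol (a : ℝ) (U : E3 → E3) (P : E3 → ℝ) (M σ : ℝ) : Prop where
  ha : 0 < a
  hU : ContDiff ℝ (⊤ : ℕ∞) U
  hc : SolC a (fun i y => U y i) P
  hM : 0 < M
  hσ0 : 0 < σ
  hσ : σ < 2
  hm : ∀ s : ℝ, s ≠ 0 → ∀ x, AV s (fun x => ‖U x‖ₑ) x ≤ ENNReal.ofReal (M * |s| ^ (-σ))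

lemma iteration (e : ℝ → ℝ) (he0 : ∀ r, 0 ≤ e r) (hm : Monotone e) (R : ℝ) (K : ℕ) (B : ℝ) (hB : 0 ≤ B)
    (h : ∀ ρ d, R ≤ ρ → 0 < d → d ≤ 1 → ρ + d ≤ R + 1 → e ρ ≤ (1/2) ^ (K+1) * e (ρ + d) + B * (d⁻¹) ^ K) :
    e R ≤ 2 ^ (K + 1) * B := by
  set r : ℕ → ℝ := fun n => R + 1 - (1/2) ^ n with hr
  have step : ∀ n, ((1/2 : ℝ)^n) ^ K * e (r n) ≤ (1/2) * (((1/2 : ℝ)^(n+1)) ^ K * e (r (n+1))) + 2 ^ K * B := by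
    intro n
    have hp : (0:ℝ) < (1/2)^(n+1) := by positivity
    have hp1 : ((1:ℝ)/2)^n ≤ 1 := pow_le_one₀ (by norm_num) (by norm_num)
    have hp2 : ((1:ℝ)/2)^(n+1) = (1/2)^n * (1/2) := pow_succ _ _
    have h0 := h (r n) ((1/2)^(n+1)) (by simp only [hr]; linarith) hp (pow_le_one₀ (by norm_num) (by norm_num))
      (by simp only [hr]; nlinarith [pow_pos (by norm_num : (0:ℝ) < 1/2) n])
    have e1 : r n + (1/2)^(n+1) = r (n+1) := by simp only [hr]; rw [hp2]; ring
    rw [e1] at h0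
    have e2 : ((1/2 : ℝ)^n) ^ K * ((((1:ℝ)/2)^(n+1))⁻¹) ^ K = 2 ^ K := by
      rw [← mul_pow, hp2]
      congr 1
      have : ((1:ℝ)/2)^n ≠ 0 := by positivity
      field_simp
    calc ((1/2 : ℝ)^n) ^ K * e (r n) ≤ ((1/2 : ℝ)^n) ^ K * ((1/2) ^ (K+1) * e (r (n+1)) + B * ((((1:ℝ)/2)^(n+1))⁻¹) ^ K) :=
          mul_le_mul_of_nonneg_left h0 (by positivity)
      _ = (1/2) * (((1/2 : ℝ)^n * (1/2)) ^ K * e (r (n+1))) + (((1/2 : ℝ)^n) ^ K * ((((1:ℝ)/2)^(n+1))⁻¹) ^ K) * B := by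
          rw [mul_pow, pow_succ]; ring
      _ = _ := by rw [e2, hp2]
  have ind : ∀ n, e R ≤ (1/2)^n * (((1/2 : ℝ)^n) ^ K * e (r n)) + 2 ^ (K+1) * B * (1 - (1/2)^n) := by
    intro n
    induction n with
    | zero => simp [hr]
    | succ n ih =>
      have := mul_le_mul_of_nonneg_left (step n) (by positivity : (0:ℝ) ≤ (1/2)^n)
      rw [pow_succ ((1:ℝ)/2) n] at this ⊢
      rw [pow_succ (2:ℝ) K] at ih ⊢
      linarith
  have bd : ∀ n, e R ≤ (1/2)^n * e (R+1) + 2 ^ (K+1) * B := by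
    intro n
    refine (ind n).trans ?_
    have h1 : ((1/2 : ℝ)^n) ^ K * e (r n) ≤ 1 * e (R+1) :=
      mul_le_mul (pow_le_one₀ (by positivity) (pow_le_one₀ (by norm_num) (by norm_num)))
        (hm (by simp only [hr]; linarith [pow_pos (by norm_num : (0:ℝ) < 1/2) n])) (he0 _) (by norm_num)
    have h2 := mul_le_mul_of_nonneg_left h1 (by positivity : (0:ℝ) ≤ (1/2)^n)
    have h3 : 2 ^ (K+1) * B * (1 - (1/2)^n) ≤ 2 ^ (K+1) * B * 1 :=
      mul_le_mul_of_nonneg_left (by linarith [pow_pos (by norm_num : (0:ℝ) < 1/2) n]) (by positivity)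
    linarith
  have lim : Tendsto (fun n : ℕ => ((1:ℝ)/2)^n * e (R+1) + 2 ^ (K+1) * B) atTop (nhds (0 * e (R+1) + 2 ^ (K+1) * B)) :=
    ((_root_.tendsto_pow_atTop_nhds_zero_of_lt_one (by norm_num) (by norm_num)).mul_const _).add_const _
  have := ge_of_tendsto' lim bd
  simpa using this

lemma AV_mono_loc (s : ℝ) {F G : E3 → ℝ≥0∞} (y : E3) (h : ∀ x, ‖x‖ ≤ ‖y‖ + |s| → F x ≤ G x) : AV s F y ≤ AV s G y := by
  refine setLIntegral_mono' measurableSet_closedBall fun z hz => h _ ?_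
  refine (norm_add_le _ _).trans ?_
  rw [norm_smul, Real.norm_eq_abs]
  have : ‖z‖ ≤ 1 := by simpa using hz
  nlinarith [abs_nonneg s]

lemma kernel_real (U : E3 → E3) (hU : Continuous U) (ψ g : E3 → ℝ) (hψ : Continuous ψ) (hs : ∀ z, 1 < ‖z‖ → ψ z = 0)
    (C0 : ℝ) (hC0 : 0 ≤ C0) (hC : ∀ z, |ψ z| ≤ C0) (ρ δ B : ℝ) (hδ : 0 < δ) (hB : 0 ≤ B) (x : E3) (hx : ‖x‖ ≤ ρ)
    (hg : ∀ x, ‖x‖ ≤ ρ + δ → |g x| ≤ B * (1 + ‖U x‖ ^ 2)) :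
    |∫ z, ψ z * g (x + δ • z)| ≤ C0 * B * (cB + δ⁻¹ ^ 3 * BI (ρ + δ) (fun y => ‖U y‖ ^ 2)) := by
  have h1 := kernel_int_le ψ g hψ hs C0 hC x δ
  have hmeas : Measurable (fun x => ENNReal.ofReal (‖U x‖ ^ 2)) := by
    have : Continuous (fun x => ‖U x‖ ^ 2) := by fun_prop
    exact this.measurable.ennreal_ofReal
  have h2 : AV δ (fun x => ‖g x‖ₑ) x ≤ AV δ (fun x => ENNReal.ofReal B * (1 + ENNReal.ofReal (‖U x‖ ^ 2))) x := by
    refine AV_mono_loc _ _ fun w hw => ?_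
    rw [abs_of_pos hδ] at hw
    rw [← ofReal_norm, Real.norm_eq_abs, ← ENNReal.ofReal_one, ← ENNReal.ofReal_add zero_le_one (by positivity),
      ← ENNReal.ofReal_mul hB]
    exact ENNReal.ofReal_le_ofReal (hg w (by linarith))
  have hA0 : 0 ≤ BI (ρ + δ) (fun y => ‖U y‖ ^ 2) := BI_nonneg _ (fun y => by positivity)
  have h3 : AV δ (fun x => ENNReal.ofReal B * (1 + ENNReal.ofReal (‖U x‖ ^ 2))) x =
      ENNReal.ofReal B * (cK + AV δ (fun x => ENNReal.ofReal (‖U x‖ ^ 2)) x) := by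
    rw [← AV_one δ x]
    unfold AV
    rw [lintegral_const_mul' _ _ ENNReal.ofReal_ne_top, lintegral_add_left measurable_const]
  have h4 := AV_le _ hmeas ρ δ hδ x (by simpa using hx)
  rw [BI_lintegral (by fun_prop) (fun y => by positivity), ← ENNReal.ofReal_mul (by positivity)] at h4
  have h5 : ‖∫ z, ψ z * g (x + δ • z)‖ₑ ≤ ENNReal.ofReal (C0 * B * (cB + δ⁻¹ ^ 3 * BI (ρ + δ) (fun y => ‖U y‖ ^ 2))) := by
    refine h1.trans ?_
    rw [mul_assoc, ENNReal.ofReal_mul hC0, ENNReal.ofReal_mul hB, ENNReal.ofReal_add cB_pos.le (by positivity), ← cK_eq]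
    gcongr
    exact h2.trans (h3.le.trans (by gcongr))
  rw [← ofReal_norm, Real.norm_eq_abs] at h5
  have hb := cB_pos
  exact (ENNReal.ofReal_le_ofReal_iff (by positivity)).1 h5

lemma kernel_pd (φ g : E3 → ℝ) (hφ : Sm φ) (hc : HasCompactSupport φ) (hg : Sm g) (x : E3) (δ : ℝ) (hδ : 0 < δ) (k : Fin 3) :
    ∫ z, φ z * pd k g (x + δ • z) = - (δ⁻¹ * ∫ z, pd k φ z * g (x + δ • z)) := by
  have := int_by_parts hφ (hg.affine x δ) hc k
  simp_rw [pd_affine hg x δ k] at this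
  have e : ∫ z, φ z * (δ * pd k g (x + δ • z)) = δ * ∫ z, φ z * pd k g (x + δ • z) := by
    rw [← integral_const_mul]; congr 1; ext z; ring
  rw [e] at this
  field_simp
  linarith

lemma pd_phiK_out (k : Fin 3) {z : E3} (hz : 1 < ‖z‖) {φ : E3 → ℝ} (h : ∀ z, 1 < ‖z‖ → φ z = 0) : pd k φ z = 0 := by
  have : φ =ᶠ[nhds z] fun _ => 0 := by
    filter_upwards [(isOpen_lt continuous_const continuous_norm).mem_nhds hz] with w hw using h w hw
  unfold pd
  rw [this.fderiv_eq]; simp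

variable {a M σ : ℝ} {U : E3 → E3} {P : E3 → ℝ}

lemma Sol.pdP_div (h : Sol a U P M σ) (i : Fin 3) (y : E3) : pd i P y =
    ∑ k, (pd k (pd k (fun y => U y i)) y - pd k (fun y => (a * y k + U y k) * U y i) y) + 2 * a * U y i := by
  have hu := h.hc.hu
  have s : ∀ k, Sm (fun y : E3 => a * y k) := fun k => (Sm.cst a).mul (Sm.coord k)
  have e : ∀ k, pd k (fun y => (a * y k + U y k) * U y i) y = (a + pd k (fun y => U y k) y) * U y i +
     (a * y k + U y k) * pd k (fun y => U y i) y := by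
    intro k
    rw [pd_mul ((s k).add (hu k)) (hu i), pd_add (s k) (hu k), pd_cmul (Sm.coord k), pd_coord]
    simp
  simp_rw [e]
  have he := h.hc.heq y i
  have hd := h.hc.hdiv y
  have hl : lap (fun y => U y i) y = ∑ k, pd k (pd k (fun y => U y i)) y := rfl
  rw [hl] at he
  simp only [Fin.sum_univ_three] at he hd ⊢
  linear_combination he + U y i * hd

lemma Sol.coord_le (U : E3 → E3) (y : E3) (i : Fin 3) : |U y i| ≤ ‖U y‖ := abs_coord_le _ _

lemma Sol.avgP_grad (h : Sol a U P M σ) : ∃ C, 0 < C ∧ ∀ (R ρ δ : ℝ) (x : E3) (i : Fin 3), 1 ≤ R → ρ ≤ 2 * R → 0 < δ → δ ≤ 1 → ‖x‖ ≤ ρ →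
    |∫ z, phiK z * pd i P (x + δ • z)| ≤ C * R * δ⁻¹ ^ 5 * (1 + BI (ρ + δ) (fun y => ‖U y‖ ^ 2)) := by
  have hUc := h.hU.continuous
  have hu := h.hc.hu
  have ha := h.ha
  have hb := cB_pos
  obtain ⟨C1, hC1, hb1⟩ := kernel_bound phiK phiK_sm.continuous (fun z => phiK_out)
  have o1 : ∀ k z, 1 < ‖z‖ → pd k phiK z = 0 := fun k z hz => pd_phiK_out k hz (fun z => phiK_out)
  have o2 : ∀ k z, 1 < ‖z‖ → pd k (pd k phiK) z = 0 := fun k z hz => pd_phiK_out k hz (o1 k)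
  choose C2 hC2 hb2 using fun k => kernel_bound (pd k phiK) (phiK_sm.pd k).continuous (o1 k)
  choose C3 hC3 hb3 using fun k => kernel_bound (pd k (pd k phiK)) ((phiK_sm.pd k).pd k).continuous (o2 k)
  set D := C1 + ∑ k, C2 k + ∑ k, C3 k with hD
  have sC2 : ∀ k, C2 k ≤ ∑ k, C2 k := fun k => Finset.single_le_sum (f := C2) (fun j _ => (hC2 j).le) (Finset.mem_univ k)
  have sC3 : ∀ k, C3 k ≤ ∑ k, C3 k := fun k => Finset.single_le_sum (f := C3) (fun j _ => (hC3 j).le) (Finset.mem_univ k)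
  have hD1 : ∀ z, |phiK z| ≤ D := fun z => (hb1 z).trans (by rw [hD]; linarith [sC2 0, sC3 0, hC2 0, hC3 0])
  have hD2 : ∀ k z, |pd k phiK z| ≤ D := fun k z => (hb2 k z).trans (by rw [hD]; linarith [sC2 k, sC3 0, hC2 0, hC3 0])
  have hD3 : ∀ k z, |pd k (pd k phiK) z| ≤ D := fun k z => (hb3 k z).trans (by rw [hD]; linarith [sC2 0, sC3 k, hC2 0, hC3 0])
  have hD0 : 0 < D := by rw [hD]; linarith [sC2 0, sC3 0, hC2 0, hC3 0]
  refine ⟨D * (3 * (1 + (3*a + 1)) + 2 * a) * (cB + 1), by positivity, ?_⟩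
  intro R ρ δ x i hR hρ hδ hδ1 hx
  set A := BI (ρ + δ) (fun y => ‖U y‖ ^ 2) with hA
  have hA0 : 0 ≤ A := BI_nonneg _ (fun y => by positivity)
  set N := cB + δ⁻¹ ^ 3 * A with hN
  have s : ∀ k, Sm (fun y : E3 => a * y k) := fun k => (Sm.cst a).mul (Sm.coord k)
  have sg : ∀ k, Sm (fun y : E3 => (a * y k + U y k) * U y i) := fun k => ((s k).add (hu k)).mul (hu i)
  have ub : ∀ x, |U x i| ≤ 1 * (1 + ‖U x‖ ^ 2) := fun x => by nlinarith [Sol.coord_le U x i, sq_nonneg (‖U x‖ - 1), norm_nonneg (U x)]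
  have b1 : ∀ k, |∫ z, pd k (pd k phiK) z * U (x + δ • z) i| ≤ D * 1 * N := fun k =>
    kernel_real U hUc _ (fun y => U y i) ((phiK_sm.pd k).pd k).continuous (o2 k) D hD0.le (hD3 k) ρ δ 1 hδ zero_le_one x hx (fun x _ => ub x)
  have b2 : ∀ k, |∫ z, pd k phiK z * (fun y : E3 => (a * y k + U y k) * U y i) (x + δ • z)| ≤ D * ((3*a + 1) * R) * N := fun k => by
    refine kernel_real U hUc _ (fun y => (a * y k + U y k) * U y i) (phiK_sm.pd k).continuous (o1 k) D hD0.le (hD2 k) ρ δ _ hδ (by positivity) x hx ?_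
    intro w hw
    have h1 := Sol.coord_le U w i
    have h2 := Sol.coord_le U w k
    have h3 := abs_coord_le w k
    have h4 := norm_nonneg (U w)
    have h5 : |w k| ≤ 3 * R := by linarith
    rw [abs_mul]
    calc |a * w k + U w k| * |U w i| ≤ (a * (3 * R) + ‖U w‖) * ‖U w‖ := by
          gcongr
          refine (abs_add_le _ _).trans ?_
          rw [abs_mul, abs_of_pos ha]
          gcongr
      _ ≤ _ := by nlinarith [sq_nonneg (‖U w‖ - 1), mul_pos ha (by linarith : 0 < R)]
  have b3 : |∫ z, phiK z * U (x + δ • z) i| ≤ D * 1 * N := 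
    kernel_real U hUc _ (fun y => U y i) phiK_sm.continuous (fun z => phiK_out) D hD0.le hD1 ρ δ 1 hδ zero_le_one x hx (fun x _ => ub x)
  have cs1 : ∀ k, HasCompactSupport (pd k phiK) := fun k => compactSupport_of_norm 1 (o1 k)
  have e1 : ∀ k, ∫ z, phiK z * pd k (pd k (fun y => U y i)) (x + δ • z) = δ⁻¹ * (δ⁻¹ * ∫ z, pd k (pd k phiK) z * U (x + δ • z) i) := by
    intro k
    rw [kernel_pd phiK _ phiK_sm phiK_cs ((hu i).pd k) x δ hδ k, kernel_pd _ _ (phiK_sm.pd k) (cs1 k) (hu i) x δ hδ k]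
    ring
  have e2 : ∀ k, ∫ z, phiK z * pd k (fun y => (a * y k + U y k) * U y i) (x + δ • z) = -(δ⁻¹ * ∫ z, pd k phiK z * (fun y : E3 => (a * y k + U y k) * U y i) (x + δ • z)) :=
    fun k => kernel_pd phiK _ phiK_sm phiK_cs (sg k) x δ hδ k
  have i1 : ∀ k, Integrable (fun z => phiK z * pd k (pd k (fun y => U y i)) (x + δ • z)) := fun k =>
    int_kernel phiK_sm.continuous (fun z => phiK_out) ((((hu i).pd k).pd k).affine x δ).continuous
  have i2 : ∀ k, Integrable (fun z => phiK z * pd k (fun y => (a * y k + U y k) * U y i) (x + δ • z)) := fun k =>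
    int_kernel phiK_sm.continuous (fun z => phiK_out) (((sg k).pd k).affine x δ).continuous
  have i3 : Integrable (fun z => phiK z * U (x + δ • z) i) :=
    int_kernel phiK_sm.continuous (fun z => phiK_out) ((hu i).affine x δ).continuous
  have main : ∫ z, phiK z * pd i P (x + δ • z) = ∑ k, (δ⁻¹ * (δ⁻¹ * ∫ z, pd k (pd k phiK) z * U (x + δ • z) i) +
      (δ⁻¹ * ∫ z, pd k phiK z * (fun y : E3 => (a * y k + U y k) * U y i) (x + δ • z))) + 2 * a * ∫ z, phiK z * U (x + δ • z) i := by
    have : ∀ z, phiK z * pd i P (x + δ • z) = ∑ k, (phiK z * pd k (pd k (fun y => U y i)) (x + δ • z) - 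
        phiK z * pd k (fun y => (a * y k + U y k) * U y i) (x + δ • z)) + 2 * a * (phiK z * U (x + δ • z) i) := by
      intro z
      rw [h.pdP_div]
      simp only [Fin.sum_univ_three]; ring
    simp_rw [this]
    have i4 : ∀ k ∈ Finset.univ, Integrable (fun z => (phiK z * pd k (pd k (fun y => U y i)) (x + δ • z) - 
        phiK z * pd k (fun y => (a * y k + U y k) * U y i) (x + δ • z))) := fun k _ => (i1 k).sub (i2 k)
    rw [integral_add (integrable_finsetSum _ i4) (i3.const_mul _), integral_finsetSum _ i4, integral_const_mul]
    congr 1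
    refine Finset.sum_congr rfl fun k _ => ?_
    rw [integral_sub (i1 k) (i2 k), e1, e2]; ring
  have hd1 : 1 ≤ δ⁻¹ := (one_le_inv₀ hδ).2 hδ1
  have hN0 : 0 ≤ N := by positivity
  have hNle : N ≤ (cB + 1) * (δ⁻¹ ^ 3 * (1 + A)) := by
    have : 1 ≤ δ⁻¹ ^ 3 := one_le_pow₀ hd1
    have h2 := mul_nonneg hb.le (mul_nonneg (by linarith : 0 ≤ δ⁻¹ ^ 3) hA0)
    rw [hN]; nlinarith [mul_le_mul_of_nonneg_left this hb.le]
  rw [main]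
  have bk : ∀ k, |δ⁻¹ * (δ⁻¹ * ∫ z, pd k (pd k phiK) z * U (x + δ • z) i) +
      (δ⁻¹ * ∫ z, pd k phiK z * (fun y : E3 => (a * y k + U y k) * U y i) (x + δ • z))| ≤ D * (1 + (3 * a + 1)) * R * δ⁻¹ ^ 2 * N := by
    intro k
    refine (abs_add_le _ _).trans ?_
    rw [abs_mul, abs_mul, abs_mul, abs_of_pos (by positivity : 0 < δ⁻¹)]
    have t1 : δ⁻¹ * (δ⁻¹ * |∫ z, pd k (pd k phiK) z * U (x + δ • z) i|) ≤ δ⁻¹ * (δ⁻¹ * (D * R * N)) := by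
      gcongr
      refine (b1 k).trans ?_
      gcongr
    have t2 : δ⁻¹ * |∫ z, pd k phiK z * (fun y : E3 => (a * y k + U y k) * U y i) (x + δ • z)| ≤ δ⁻¹ * (δ⁻¹ * (D * ((3*a + 1) * R) * N)) := by
      gcongr
      refine (b2 k).trans ?_
      exact le_mul_of_one_le_left (by positivity) hd1
    linarith
  have b3' : |2 * a * ∫ z, phiK z * U (x + δ • z) i| ≤ D * (2 * a) * R * δ⁻¹ ^ 2 * N := by
    rw [abs_mul, abs_of_pos (by positivity : 0 < 2 * a)]
    have : 1 * 1 ≤ R * δ⁻¹ ^ 2 := mul_le_mul hR (one_le_pow₀ hd1) zero_le_one (by linarith)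
    calc 2 * a * |∫ z, phiK z * U (x + δ • z) i| ≤ 2 * a * (D * 1 * N) := by gcongr
      _ = (D * (2 * a) * N) * (1 * 1) := by ring
      _ ≤ (D * (2 * a) * N) * (R * δ⁻¹ ^ 2) := by gcongr
      _ = _ := by ring
  refine (abs_add_le _ _).trans ?_
  refine (add_le_add (Finset.abs_sum_le_sum_abs _ _) b3').trans ?_
  refine (add_le_add (Finset.sum_le_sum fun k _ => bk k) le_rfl).trans ?_
  simp only [Finset.sum_const, Finset.card_univ, Fintype.card_fin, nsmul_eq_mul]
  push_cast
  calc 3 * (D * (1 + (3 * a + 1)) * R * δ⁻¹ ^ 2 * N) + D * (2 * a) * R * δ⁻¹ ^ 2 * N =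
        D * (3 * (1 + (3*a + 1)) + 2 * a) * R * δ⁻¹ ^ 2 * N := by ring
    _ ≤ D * (3 * (1 + (3*a + 1)) + 2 * a) * R * δ⁻¹ ^ 2 * ((cB + 1) * (δ⁻¹ ^ 3 * (1 + A))) := by gcongr
    _ = _ := by ring

lemma Sol.avgP (h : Sol a U P M σ) : ∃ C, 0 < C ∧ ∀ (R ρ δ : ℝ) (x : E3), 1 ≤ R → ρ ≤ 2 * R → 0 < δ → δ ≤ 1 → ‖x‖ ≤ ρ →
    |(∫ z, phiK z * P (x + δ • z)) - ∫ z, phiK z * P (δ • z)| ≤ C * R ^ 2 * δ⁻¹ ^ 5 * (1 + BI (ρ + δ) (fun y => ‖U y‖ ^ 2)) := by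
  obtain ⟨C, hC, hb⟩ := h.avgP_grad
  refine ⟨6 * C, by positivity, ?_⟩
  intro R ρ δ x hR hρ hδ hδ1 hx
  have hP := h.hc.hP
  have hP1 : ∀ i, Continuous (pd i P) := fun i => (hP.pd i).continuous
  have hPc := hP.continuous
  have := avg_ftc phiK phiK_sm.continuous (fun z => phiK_out) (fun s z => P (δ • z + s • x))
    (fun s z => ∑ i, x i * pd i P (δ • z + s • x)) (fun s z => hasDerivAt_along hP (δ • z) x s)
    (fun s => by fun_prop) (by simp only [Function.uncurry_def]; fun_prop) 1 zero_le_one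
  simp only [one_smul, zero_smul, add_zero] at this
  have e0 : ∀ z : E3, δ • z + x = x + δ • z := fun z => add_comm _ _
  simp_rw [e0] at this
  rw [this]
  set A := BI (ρ + δ) (fun y => ‖U y‖ ^ 2) with hA
  have hA0 : 0 ≤ A := BI_nonneg _ (fun y => by positivity)
  have key : ∀ s ∈ uIoc (0:ℝ) 1, ‖∫ z, phiK z * ∑ i, x i * pd i P (δ • z + s • x)‖ ≤ 6 * C * R ^ 2 * δ⁻¹ ^ 5 * (1 + A) := by
    intro s hs
    rw [uIoc_of_le zero_le_one] at hs
    have e : ∫ z, phiK z * ∑ i, x i * pd i P (δ • z + s • x) = ∑ i, x i * ∫ z, phiK z * pd i P (s • x + δ • z) := by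
      simp_rw [Finset.mul_sum]
      rw [integral_finsetSum]
      · refine Finset.sum_congr rfl fun i _ => ?_
        rw [← integral_const_mul]
        congr 1; ext z; rw [add_comm (δ • z)]; ring
      · intro i _
        exact int_kernel phiK_sm.continuous (fun z => phiK_out) (by fun_prop)
    have hsx : ‖s • x‖ ≤ ρ := by
      rw [norm_smul, Real.norm_eq_abs, abs_of_pos hs.1]
      nlinarith [norm_nonneg x, hs.2]
    rw [e, Real.norm_eq_abs]
    refine (Finset.abs_sum_le_sum_abs _ _).trans ?_
    have : ∀ i ∈ Finset.univ, |x i * ∫ z, phiK z * pd i P (s • x + δ • z)| ≤ 2 * R * (C * R * δ⁻¹ ^ 5 * (1 + A)) := by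
      intro i _
      rw [abs_mul]
      gcongr
      · exact (abs_coord_le x i).trans (hx.trans hρ)
      · exact hb R ρ δ (s • x) i hR hρ hδ hδ1 hsx
    refine (Finset.sum_le_sum this).trans ?_
    simp only [Finset.sum_const, Finset.card_univ, Fintype.card_fin, nsmul_eq_mul]
    push_cast
    apply le_of_eq; ring
  have := intervalIntegral.norm_integral_le_of_norm_le_const key
  simpa using this

end Part8

section Part9
lemma cs3 (v : E3) (w : Fin 3 → ℝ) : (∑ k, v k * w k) ^ 2 ≤ ‖v‖ ^ 2 * ∑ k, w k ^ 2 := by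
  rw [normsq_eq]
  exact Finset.sum_mul_sq_le_sq_mul_sq _ _ _

lemma fderiv_sq_le (f : E3 → ℝ) (x : E3) : ‖fderiv ℝ f x‖ ^ 2 ≤ ∑ k, (pd k f x) ^ 2 := by
  have h0 : 0 ≤ ∑ k, (pd k f x) ^ 2 := by positivity
  have : ‖fderiv ℝ f x‖ ≤ Real.sqrt (∑ k, (pd k f x) ^ 2) := by
    refine ContinuousLinearMap.opNorm_le_bound _ (Real.sqrt_nonneg _) fun v => ?_
    rw [fderiv_eq_sum, Real.norm_eq_abs]
    refine abs_le_of_sq_le_sq ?_ (by positivity)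
    rw [mul_pow, Real.sq_sqrt h0, mul_comm]
    exact cs3 v _
  calc _ ≤ Real.sqrt (∑ k, (pd k f x) ^ 2) ^ 2 := by gcongr
    _ = _ := Real.sq_sqrt h0

lemma sq_le_fderiv (f : E3 → ℝ) (x : E3) : ∑ k, (pd k f x) ^ 2 ≤ 3 * ‖fderiv ℝ f x‖ ^ 2 := by
  have : ∀ k ∈ Finset.univ, (pd k f x) ^ 2 ≤ ‖fderiv ℝ f x‖ ^ 2 := by
    intro k _
    rw [← sq_abs]
    gcongr
    have := (fderiv ℝ f x).le_opNorm (EuclideanSpace.single k 1)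
    simpa [pd] using this
  refine (Finset.sum_le_sum this).trans ?_
  simp

lemma fderivU_sq_le (U : E3 → E3) (hU : ContDiff ℝ (⊤ : ℕ∞) U) (x : E3) :
    ‖fderiv ℝ U x‖ ^ 2 ≤ DU2 (fun i y => U y i) x := by
  have h0 : 0 ≤ DU2 (fun i y => U y i) x := DU2_nonneg _ _
  have hd : DifferentiableAt ℝ U x := (hU.differentiable (by simp)) x
  have : ‖fderiv ℝ U x‖ ≤ Real.sqrt (DU2 (fun i y => U y i) x) := by
    refine ContinuousLinearMap.opNorm_le_bound _ (Real.sqrt_nonneg _) fun v => ?_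
    have e : ∀ i, (fderiv ℝ U x v) i = ∑ k, v k * pd k (fun y => U y i) x := by
      intro i
      rw [← fderiv_eq_sum]
      have := ((EuclideanSpace.proj i : E3 →L[ℝ] ℝ).hasFDerivAt.comp x hd.hasFDerivAt).fderiv
      rw [show (fun y => U y i) = (EuclideanSpace.proj i : E3 →L[ℝ] ℝ) ∘ U from rfl, this]
      simp
    refine le_of_sq_le_sq ?_ (by positivity)
    rw [mul_pow, Real.sq_sqrt h0, normsq_eq, mul_comm]
    simp_rw [e]
    unfold DU2
    rw [Finset.mul_sum]
    exact Finset.sum_le_sum fun i _ => cs3 v _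
  calc _ ≤ Real.sqrt (DU2 (fun i y => U y i) x) ^ 2 := by gcongr
    _ = _ := Real.sq_sqrt h0

lemma choose_theta (κ C0 ε : ℝ) (hκ : 0 < κ) (hC : 0 < C0) (hε : 0 < ε) (m : ℕ) (hm : 1 ≤ m * κ) :
    ∃ θ, 0 < θ ∧ θ ≤ 1 ∧ ∀ d : ℝ, 0 < d → d ≤ 1 → C0 * d⁻¹ * (θ * d ^ m) ^ κ ≤ ε := by
  refine ⟨min 1 ((ε / C0) ^ (1/κ)), by positivity, min_le_left _ _, fun d hd hd1 => ?_⟩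
  set θ := min 1 ((ε / C0) ^ (1/κ)) with hθ
  have hθ0 : 0 < θ := by positivity
  have h1 : θ ^ κ ≤ ε / C0 := by
    calc θ ^ κ ≤ ((ε / C0) ^ (1/κ)) ^ κ := Real.rpow_le_rpow hθ0.le (min_le_right _ _) hκ.le
      _ = _ := by rw [← Real.rpow_mul (by positivity), one_div, inv_mul_cancel₀ hκ.ne', Real.rpow_one]
  have h2 : (d ^ m) ^ κ ≤ d := by
    rw [← Real.rpow_natCast, ← Real.rpow_mul hd.le]
    calc d ^ (m * κ) ≤ d ^ (1:ℝ) := Real.rpow_le_rpow_of_exponent_ge hd hd1 hm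
      _ = d := Real.rpow_one d
  rw [Real.mul_rpow hθ0.le (by positivity)]
  calc C0 * d⁻¹ * (θ ^ κ * (d ^ m) ^ κ) ≤ C0 * d⁻¹ * (ε / C0 * d) := by gcongr
    _ = ε := by field_simp

/-- polynomial boundedness -/
def PB (f : ℝ → ℝ) : Prop := ∃ C : ℝ, 0 < C ∧ ∃ N : ℕ, ∀ R, 1 ≤ R → f R ≤ C * R ^ N

lemma PB.mono {f g : ℝ → ℝ} (hg : PB g) (h : ∀ R, 1 ≤ R → f R ≤ g R) : PB f := by
  obtain ⟨C, hC, N, hb⟩ := hg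
  exact ⟨C, hC, N, fun R hR => (h R hR).trans (hb R hR)⟩

lemma PB.add {f g : ℝ → ℝ} (hf : PB f) (hg : PB g) : PB (fun R => f R + g R) := by
  obtain ⟨C, hC, N, hb⟩ := hf
  obtain ⟨C', hC', N', hb'⟩ := hg
  refine ⟨C + C', by positivity, N + N', fun R hR => ?_⟩
  have h1 : R ^ N ≤ R ^ (N + N') := pow_le_pow_right₀ hR (by omega)
  have h2 : R ^ N' ≤ R ^ (N + N') := pow_le_pow_right₀ hR (by omega)
  have := hb R hR
  have := hb' R hR
  nlinarith

lemma PB.mul {f g : ℝ → ℝ} (hf : PB f) (hg : PB g) (hg0 : ∀ R, 1 ≤ R → 0 ≤ g R) : PB (fun R => f R * g R) := by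
  obtain ⟨C, hC, N, hb⟩ := hf
  obtain ⟨C', hC', N', hb'⟩ := hg
  refine ⟨C * C', by positivity, N + N', fun R hR => ?_⟩
  calc f R * g R ≤ (C * R ^ N) * (C' * R ^ N') :=
        mul_le_mul (hb R hR) (hb' R hR) (hg0 R hR) (by positivity)
    _ = _ := by rw [pow_add]; ring

lemma PB.cst (c : ℝ) : PB (fun _ => c) := ⟨|c| + 1, by positivity, 0, fun R _ => by simp; linarith [le_abs_self c]⟩

lemma PB.pow (N : ℕ) : PB (fun R => R ^ N) := ⟨1, by positivity, N, fun R _ => by simp⟩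

lemma PB.shift {f : ℝ → ℝ} (hf : PB f) : PB (fun R => f (R + 1)) := by
  obtain ⟨C, hC, N, hb⟩ := hf
  refine ⟨C * 2 ^ N, by positivity, N, fun R hR => (hb (R+1) (by linarith)).trans ?_⟩
  rw [mul_assoc, ← mul_pow]
  gcongr
  linarith

lemma PB.cmul {f : ℝ → ℝ} (hf : PB f) (c : ℝ) (hc : 0 ≤ c) : PB (fun R => c * f R) := by
  obtain ⟨C, hC, N, hb⟩ := hf
  refine ⟨(c + 1) * C, by positivity, N, fun R hR => ?_⟩
  have := hb R hR
  have h2 : 0 ≤ C * R ^ N := by positivity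
  nlinarith

lemma iter_poly (e : ℝ → ℝ) (he0 : ∀ r, 0 ≤ e r) (hm : Monotone e) (K N : ℕ)
    (h : ∀ ε : ℝ, 0 < ε → ∃ C : ℝ, 0 < C ∧ ∀ R ρ d, 1 ≤ R → R ≤ ρ → 0 < d → d ≤ 1 → ρ + d ≤ R + 1 →
      e ρ ≤ ε * e (ρ + d) + C * R ^ N * d⁻¹ ^ K) : PB e := by
  obtain ⟨C, hC, hb⟩ := h ((1/2)^(K+1)) (by positivity)
  refine ⟨2 ^ (K+1) * C, by positivity, N, fun R hR => ?_⟩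
  rw [mul_assoc]
  exact iteration e he0 hm R K (C * R ^ N) (by positivity) fun ρ d h1 h2 h3 h4 => hb R ρ d hR h1 h2 h3 h4

lemma exists_m (κ : ℝ) (hκ : 0 < κ) : ∃ m : ℕ, 1 ≤ m ∧ 1 ≤ m * κ := by
  obtain ⟨m, hm⟩ := exists_nat_ge (1/κ)
  refine ⟨m + 1, by omega, ?_⟩
  rw [div_le_iff₀ hκ] at hm
  push_cast; nlinarith

lemma IA_mono (α δ : ℝ) {F G : E3 → ℝ≥0∞} (h : ∀ x, F x ≤ G x) (y : E3) : IA α δ F y ≤ IA α δ G y := by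
  unfold IA
  refine lintegral_mono fun s => ?_
  gcongr
  exact AV_mono _ h y

variable {a M σ : ℝ} {U : E3 → E3} {P : E3 → ℝ}

lemma Sol.hm' (h : Sol a U P M σ) : ∀ s : ℝ, s ≠ 0 → ∀ x, AV s (fun x => ENNReal.ofReal ‖U x‖) x ≤ ENNReal.ofReal (M * |s| ^ (-σ)) := by
  intro s hs x
  simp_rw [ofReal_norm]
  exact h.hm s hs x

lemma Sol.l1 (h : Sol a U P M σ) (r : ℝ) (hr : 1 ≤ r) : BI r (fun y => ‖U y‖) ≤ M * r ^ 3 := by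
  have hUc := h.hU.continuous
  have h1 := h.hm' r (by linarith) 0
  rw [AV_eq r (by linarith) _ (by have := hUc.norm.measurable; exact this.ennreal_ofReal), abs_of_pos (by linarith),
    BI_lintegral (by fun_prop) (fun y => by positivity), ← ENNReal.ofReal_mul (by positivity),
    ENNReal.ofReal_le_ofReal_iff (by have := h.hM; positivity)] at h1
  have h2 : r ^ (-σ) ≤ 1 := Real.rpow_le_one_of_one_le_of_nonpos hr (by linarith [h.hσ0])
  have h3 : r⁻¹ ^ 3 * BI r (fun y => ‖U y‖) ≤ M := h1.trans (by nlinarith [h.hM])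
  have hr0 : 0 < r := by linarith
  rw [inv_pow, inv_mul_le_iff₀ (by positivity)] at h3
  linarith

lemma Sol.neg_sigma (h : Sol a U P M σ) {δ : ℝ} (hδ : 0 < δ) (hδ1 : δ ≤ 1) : δ ^ (-σ) ≤ δ⁻¹ ^ 2 := by
  rw [Real.rpow_neg hδ.le, inv_pow]
  have : δ ^ (2:ℝ) ≤ δ ^ σ := Real.rpow_le_rpow_of_exponent_ge hδ hδ1 h.hσ.le
  rw [Real.rpow_two] at this
  gcongr

lemma Sol.cubic (h : Sol a U P M σ) : ∃ C, 0 < C ∧ ∀ ρ δ, 0 < δ → δ ≤ 1 →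
    BI ρ (fun y => ‖U y‖ * ‖U y‖ ^ 2) ≤ C * (δ ^ (2 - σ) * BI (ρ + δ) (DU2 (fun i y => U y i))
      + δ⁻¹ ^ 2 * BI (ρ + δ) (fun y => ‖U y‖ ^ 2)) := by
  have hM := h.hM
  have hb := cB_pos
  have : 0 < 1 - σ/2 := by linarith [h.hσ]
  refine ⟨2 * M / (cB * (1 - σ/2) ^ 2), by positivity, fun ρ δ hδ hδ1 => ?_⟩
  have hc1 : ContDiff ℝ 1 U := h.hU.of_le (by exact_mod_cast le_top)
  have hcd := hc1.continuous_fderiv one_ne_zero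
  have hUc := h.hU.continuous
  refine (formBound (fun y => ‖U y‖) hUc.norm (fun y => norm_nonneg _) M σ hM.le h.hσ0.le h.hσ h.hm' U hc1 ρ δ hδ).trans ?_
  gcongr
  · exact BI_mono (by fun_prop) h.hc.DU2_cont _ (fun y _ => fderivU_sq_le U h.hU y)
  · exact BI_nonneg _ fun y => by positivity
  · exact h.neg_sigma hδ hδ1

/-- Pointwise pressure deviation bound. -/
lemma Sol.press_pt (h : Sol a U P M σ) : ∃ C, 0 < C ∧ ∀ (R ρ δ : ℝ) (y : E3), 1 ≤ R → ρ ≤ 2 * R → 0 < δ → δ ≤ 1 → ‖y‖ ≤ ρ →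
    ‖P y - ∫ z, phiK z * P (δ • z)‖ₑ ≤ ENNReal.ofReal C * IA 1 δ (fun x => ENNReal.ofReal (DU2 (fun i y => U y i) x)) y +
      ENNReal.ofReal (C * R ^ 2 * δ⁻¹ ^ 5 * (1 + BI (ρ + δ) (fun y => ‖U y‖ ^ 2))) := by
  obtain ⟨C1, hC1, hb1⟩ := avg_bound
  obtain ⟨C2, hC2, hb2⟩ := h.avgP
  refine ⟨C1 + C2, by positivity, fun R ρ δ y hR hρ hδ hδ1 hy => ?_⟩
  have hA0 : 0 ≤ BI (ρ + δ) (fun y => ‖U y‖ ^ 2) := BI_nonneg _ (fun y => by positivity)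
  have e : P y - ∫ z, phiK z * P (δ • z) = (P y - ∫ z, phiK z * P (y + δ • z)) +
      ((∫ z, phiK z * P (y + δ • z)) - ∫ z, phiK z * P (δ • z)) := by ring
  rw [e]
  refine (enorm_add_le _ _).trans (add_le_add ?_ ?_)
  · refine (hb1 P h.hc.hP y δ hδ).trans ?_
    gcongr
    · linarith
    · refine IA_mono _ _ (fun x => ?_) y
      rw [← ofReal_norm, Real.norm_eq_abs]
      exact ENNReal.ofReal_le_ofReal (h.hc.abs_lapP x)
  · rw [← ofReal_norm, Real.norm_eq_abs]
    refine ENNReal.ofReal_le_ofReal ((hb2 R ρ δ y hR hρ hδ hδ1 hy).trans ?_)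
    gcongr
    linarith

lemma Sol.press (h : Sol a U P M σ) : ∃ C, 0 < C ∧ ∀ (R ρ δ : ℝ), 1 ≤ R → 1 ≤ ρ → ρ ≤ 2 * R → 0 < δ → δ ≤ 1 →
    BI ρ (fun y => ‖U y‖ * |P y - ∫ z, phiK z * P (δ • z)|) ≤ C * (δ ^ (2 - σ) * BI (ρ + δ) (DU2 (fun i y => U y i))
      + R ^ 5 * δ⁻¹ ^ 5 * (1 + BI (ρ + δ) (fun y => ‖U y‖ ^ 2))) := by
  obtain ⟨C, hC, hb⟩ := h.press_pt
  have hM := h.hM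
  have hσ := h.hσ
  have hσ' : 0 < 2 - σ := by linarith
  refine ⟨C * (M / (2 - σ)) + C * (M * 8), by positivity, fun R ρ δ hR hρ1 hρ hδ hδ1 => ?_⟩
  set c := ∫ z, phiK z * P (δ • z)
  have hUc := h.hU.continuous
  have hPc := h.hc.hP.continuous
  have hDc := h.hc.DU2_cont
  set A := BI (ρ + δ) (fun y => ‖U y‖ ^ 2) with hA
  set E := BI (ρ + δ) (DU2 (fun i y => U y i)) with hE
  have hA0 : 0 ≤ A := BI_nonneg _ (fun y => by positivity)
  have hE0 : 0 ≤ E := BI_nonneg _ (fun y => DU2_nonneg _ _)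
  set K := C * R ^ 2 * δ⁻¹ ^ 5 * (1 + A) with hK
  have hK0 : 0 ≤ K := by positivity
  set F : E3 → ℝ≥0∞ := fun x => ENNReal.ofReal (DU2 (fun i y => U y i) x) with hF
  have hFm : Measurable F := hDc.measurable.ennreal_ofReal
  have hGm : Measurable (fun x => ENNReal.ofReal ‖U x‖) := hUc.norm.measurable.ennreal_ofReal
  have hsw := IA_swap F _ hFm hGm ρ δ 1 σ M hδ hM.le (by linarith) h.hm'
  rw [BI_lintegral hDc (fun y => DU2_nonneg _ _), ← ENNReal.ofReal_mul (by
    have : 0 < 1 - σ + 1 := by linarith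
    positivity), show 1 - σ + 1 = 2 - σ by ring] at hsw
  have key : ENNReal.ofReal (BI ρ (fun y => ‖U y‖ * |P y - c|)) ≤
      ENNReal.ofReal (C * (M * (δ ^ (2 - σ) / (2 - σ)) * E) + K * BI ρ (fun y => ‖U y‖)) := by
    rw [← BI_lintegral (by fun_prop) (fun y => by positivity)]
    have p1 : ∀ y ∈ closedBall (0 : E3) ρ, ENNReal.ofReal (‖U y‖ * |P y - c|) ≤
        ENNReal.ofReal C * (ENNReal.ofReal ‖U y‖ * IA 1 δ F y) + ENNReal.ofReal K * ENNReal.ofReal ‖U y‖ := by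
      intro y hy
      rw [ENNReal.ofReal_mul (norm_nonneg _), ← Real.norm_eq_abs, ofReal_norm (P y - c)]
      calc _ ≤ ENNReal.ofReal ‖U y‖ * (ENNReal.ofReal C * IA 1 δ F y + ENNReal.ofReal K) := by
            gcongr
            exact hb R ρ δ y hR hρ hδ hδ1 (by simpa using hy)
        _ = _ := by ring
    refine (setLIntegral_mono' measurableSet_closedBall p1).trans ?_
    rw [lintegral_add_right _ (hGm.const_mul _), lintegral_const_mul' _ _ ENNReal.ofReal_ne_top,
      lintegral_const_mul' _ _ ENNReal.ofReal_ne_top, BI_lintegral hUc.norm (fun y => norm_nonneg _),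
      ENNReal.ofReal_add (by positivity) (mul_nonneg hK0 (BI_nonneg _ fun y => norm_nonneg _)), ENNReal.ofReal_mul hC.le,
      ENNReal.ofReal_mul hK0]
    gcongr
  rw [ENNReal.ofReal_le_ofReal_iff (add_nonneg (by positivity) (mul_nonneg hK0 (BI_nonneg _ fun y => norm_nonneg _)))] at key
  have hl1 : BI ρ (fun y => ‖U y‖) ≤ M * 8 * R ^ 3 := by
    refine (h.l1 ρ hρ1).trans ?_
    rw [mul_assoc]
    gcongr
    calc ρ ^ 3 ≤ (2 * R) ^ 3 := by gcongr
      _ = 8 * R ^ 3 := by ring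
  have h1 : K * BI ρ (fun y => ‖U y‖) ≤ C * (M * 8) * (R ^ 5 * δ⁻¹ ^ 5 * (1 + A)) := by
    calc _ ≤ K * (M * 8 * R ^ 3) := by gcongr
      _ = _ := by rw [hK]; ring
  have h2 : C * (M * (δ ^ (2 - σ) / (2 - σ)) * E) = C * (M / (2 - σ)) * (δ ^ (2 - σ) * E) := by ring
  have h3 : 0 ≤ C * (M * 8) * (δ ^ (2 - σ) * E) := by positivity
  have h4 : 0 ≤ C * (M / (2 - σ)) * (R ^ 5 * δ⁻¹ ^ 5 * (1 + A)) := by positivity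
  nlinarith

end Part9

section Part10
variable {a M σ : ℝ} {U : E3 → E3} {P : E3 → ℝ}

lemma int_eq_BI {f : E3 → ℝ} (ρ : ℝ) (h : ∀ y, ρ < ‖y‖ → f y = 0) : ∫ y, f y = BI ρ f := by
  rw [BI, setIntegral_eq_integral_of_forall_compl_eq_zero]
  intro y hy
  exact h y (by simpa using hy)

lemma sum_mul_le (v w : Fin 3 → ℝ) (A B : ℝ) (hA : 0 ≤ A) (hv : ∀ k, |v k| ≤ A) (hw : ∀ k, |w k| ≤ B) :
    |∑ k, v k * w k| ≤ 3 * (A * B) := by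
  refine (Finset.abs_sum_le_sum_abs _ _).trans ?_
  have : ∀ k ∈ Finset.univ, |v k * w k| ≤ A * B := by
    intro k _
    rw [abs_mul]
    exact mul_le_mul (hv k) (hw k) (abs_nonneg _) hA
  refine (Finset.sum_le_sum this).trans ?_
  simp

lemma qU_norm (U : E3 → E3) (y : E3) : qU (fun i y => U y i) y = (1/2) * ‖U y‖ ^ 2 := by
  rw [qU, normsq_eq]; simp [sq]

lemma energy_alg (N p C a R D l x S1 S2 Pc : ℝ) (hN : 0 ≤ N) (hC : 0 < C) (ha : 0 < a) (hR : 1 ≤ R) (hD : 1 ≤ D)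
    (h1 : l ≤ C * D ^ 2) (h2 : x ≤ 1) (h3 : S1 ≤ 3 * (2 * R * (C * D))) (h4 : |S2| ≤ 3 * (N * (C * D))) (hp : |Pc| = p) :
    (1/2) * N ^ 2 * l + a * ((1/2) * N ^ 2 * x) + a * ((1/2) * N ^ 2 * S1) + (1/2) * N ^ 2 * S2 + Pc * S2 ≤
      ((C + a + 3 * a * C + 3 * C) * (R * D ^ 2)) * N ^ 2 + ((C + a + 3 * a * C + 3 * C) * D) * (N * N ^ 2)
        + ((C + a + 3 * a * C + 3 * C) * D) * (N * p) := by
  have hp0 : 0 ≤ p := hp ▸ abs_nonneg _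
  have x1 : D ≤ D ^ 2 := le_self_pow₀ hD (by norm_num)
  have x2 : D ^ 2 ≤ R * D ^ 2 := le_mul_of_one_le_left (by positivity) hR
  have x4 : R * D ≤ R * D ^ 2 := by gcongr
  have t1 : (1/2) * N ^ 2 * l ≤ (1/2) * N ^ 2 * (C * (R * D ^ 2)) := by
    gcongr; exact h1.trans (by gcongr)
  have t2 : a * ((1/2) * N ^ 2 * x) ≤ a * ((1/2) * N ^ 2 * (R * D ^ 2)) := by gcongr; linarith
  have t3 : a * ((1/2) * N ^ 2 * S1) ≤ a * ((1/2) * N ^ 2 * (6 * C * (R * D ^ 2))) := by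
    gcongr
    calc S1 ≤ 6 * C * (R * D) := by linarith
      _ ≤ _ := by gcongr
  have t4 : (1/2) * N ^ 2 * S2 ≤ (1/2) * N ^ 2 * (3 * (N * (C * D))) := by
    gcongr; exact (le_abs_self _).trans h4
  have t5 : Pc * S2 ≤ p * (3 * (N * (C * D))) := by
    refine (le_abs_self _).trans ?_
    rw [abs_mul, hp]; gcongr
  have key : ((C + a + 3 * a * C + 3 * C) * (R * D ^ 2)) * N ^ 2 + ((C + a + 3 * a * C + 3 * C) * D) * (N * N ^ 2)
        + ((C + a + 3 * a * C + 3 * C) * D) * (N * p) = (1/2) * N ^ 2 * (C * (R * D ^ 2)) + a * ((1/2) * N ^ 2 * (R * D ^ 2))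
        + a * ((1/2) * N ^ 2 * (6 * C * (R * D ^ 2))) + (1/2) * N ^ 2 * (3 * (N * (C * D))) + p * (3 * (N * (C * D)))
        + ((1/2 * C + 1/2 * a + 3 * C) * (R * D ^ 2) * N ^ 2 + (C + a + 3 * a * C + 3/2 * C) * D * (N * N ^ 2) + (C + a + 3 * a * C) * D * (N * p)) := by ring
  rw [key]
  have : 0 ≤ ((1/2 * C + 1/2 * a + 3 * C) * (R * D ^ 2) * N ^ 2 + (C + a + 3 * a * C + 3/2 * C) * D * (N * N ^ 2) + (C + a + 3 * a * C) * D * (N * p)) := by positivity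
  linarith

set_option maxHeartbeats 1000000 in
lemma Sol.energy1 (h : Sol a U P M σ) : ∃ C, 0 < C ∧ ∀ (R ρ d c : ℝ), 1 ≤ R → R ≤ ρ → 0 < d → d ≤ 1 → ρ + d ≤ 2 * R →
    BI ρ (DU2 (fun i y => U y i)) ≤ C * (R * d⁻¹ ^ 2 * BI (ρ + d) (fun y => ‖U y‖ ^ 2)
      + d⁻¹ * BI (ρ + d) (fun y => ‖U y‖ * ‖U y‖ ^ 2) + d⁻¹ * BI (ρ + d) (fun y => ‖U y‖ * |P y - c|)) := by
  obtain ⟨C, hC, hcut⟩ := cutoff_exists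
  have ha := h.ha
  have hUc := h.hU.continuous
  have hPc := h.hc.hP.continuous
  have hDc := h.hc.DU2_cont
  have hu := h.hc.hu
  refine ⟨C + a + 3 * a * C + 3 * C, by positivity, fun R ρ d c hR hρ hd hd1 hρ2 => ?_⟩
  obtain ⟨χ, sχ, χ0, χ1, χin, χout, χb1, χb2, χo1, χo2, -, -⟩ := hcut ρ d (by linarith) hd hd1
  have hcs : HasCompactSupport χ := compactSupport_of_norm (ρ + d) χout
  have hid := energy_identity h.hc sχ hcs c
  have cχ1 := fun k => (sχ.pd k).continuous
  have cχ2 := sχ.lap.continuous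
  have cχ := sχ.continuous
  have cu : ∀ k, Continuous (fun y => U y k) := fun k => (hu k).continuous
  have cq := h.hc.qU_sm.continuous
  have step1 : BI ρ (DU2 (fun i y => U y i)) ≤ ∫ y, DU2 (fun i y => U y i) y * χ y := by
    rw [int_eq_BI (ρ + d) (fun y hy => by rw [χout y hy, mul_zero])]
    calc _ = BI ρ (fun y => DU2 (fun i y => U y i) y * χ y) := by
          refine setIntegral_congr_fun measurableSet_closedBall fun y hy => ?_
          simp only
          rw [χin y (by simpa using hy), mul_one]
      _ ≤ _ := BI_mono_radius (hDc.mul cχ) (fun y => mul_nonneg (DU2_nonneg _ _) (χ0 y)) (by linarith)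
  refine step1.trans ?_
  rw [hid, int_eq_BI (ρ + d) (fun y hy => by simp [χout y hy, χo1 _ y hy, χo2 y hy])]
  have hd1' : 1 ≤ d⁻¹ := (one_le_inv₀ hd).2 hd1
  set C' := C + a + 3 * a * C + 3 * C with hC'
  have pt : ∀ y ∈ closedBall (0 : E3) (ρ + d), (qU (fun i y => U y i) y * lap χ y + a * (qU (fun i y => U y i) y * χ y)
      + a * (qU (fun i y => U y i) y * ∑ k, y k * pd k χ y)
      + qU (fun i y => U y i) y * (∑ k, U y k * pd k χ y) + (P y - c) * ∑ k, U y k * pd k χ y) ≤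
      (C' * (R * d⁻¹ ^ 2)) * ‖U y‖ ^ 2 + (C' * d⁻¹) * (‖U y‖ * ‖U y‖ ^ 2) + (C' * d⁻¹) * (‖U y‖ * |P y - c|) := by
    intro y hy
    have hy' : ‖y‖ ≤ 2 * R := by have : ‖y‖ ≤ ρ + d := by simpa using hy
                                 linarith
    rw [qU_norm]
    have b1 := sum_mul_le (fun k => y k) (fun k => pd k χ y) (2 * R) (C * d⁻¹) (by linarith)
      (fun k => (abs_coord_le y k).trans hy') (fun k => χb1 k y)
    have b2 := sum_mul_le (fun k => U y k) (fun k => pd k χ y) ‖U y‖ (C * d⁻¹) (norm_nonneg _)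
      (fun k => abs_coord_le (U y) k) (fun k => χb1 k y)
    simp only at b1 b2
    exact energy_alg ‖U y‖ |P y - c| C a R d⁻¹ _ _ _ _ _ (norm_nonneg _) hC ha hR hd1' ((le_abs_self _).trans (χb2 y)) (χ1 y)
      ((le_abs_self _).trans b1) b2 rfl
  have c1 : Continuous (fun y => ‖U y‖ ^ 2) := by fun_prop
  have c2 : Continuous (fun y => ‖U y‖ * ‖U y‖ ^ 2) := by fun_prop
  have c3 : Continuous (fun y => ‖U y‖ * |P y - c|) := by fun_prop
  refine (BI_mono (by fun_prop) (by fun_prop) _ pt).trans ?_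
  rw [BI_add (by fun_prop) (by fun_prop), BI_add (by fun_prop) (by fun_prop), BI_const_mul, BI_const_mul, BI_const_mul]
  apply le_of_eq; ring

lemma Sol.energy2 (h : Sol a U P M σ) : ∃ C, 0 < C ∧ ∀ (R ρ d δ : ℝ), 1 ≤ R → R ≤ ρ → 0 < d → d ≤ 1 → ρ + d ≤ 2 * R → 0 < δ → δ ≤ d →
    BI ρ (DU2 (fun i y => U y i)) ≤ C * (d⁻¹ * δ ^ (2 - σ) * BI (ρ + 2 * d) (DU2 (fun i y => U y i))
      + R ^ 5 * d⁻¹ ^ 2 * δ⁻¹ ^ 5 * (1 + BI (ρ + 2 * d) (fun y => ‖U y‖ ^ 2))) := by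
  obtain ⟨C1, hC1, b1⟩ := h.energy1
  obtain ⟨C2, hC2, b2⟩ := h.cubic
  obtain ⟨C3, hC3, b3⟩ := h.press
  have hUc := h.hU.continuous
  have hDc := h.hc.DU2_cont
  refine ⟨C1 * (1 + C2 + C3), by positivity, fun R ρ d δ hR hρ hd hd1 hρ2 hδ hδd => ?_⟩
  have f1 := b1 R ρ d (∫ z, phiK z * P (δ • z)) hR hρ hd hd1 hρ2
  have f2 := b2 (ρ + d) δ hδ (hδd.trans hd1)
  have f3 := b3 R (ρ + d) δ hR (by linarith) hρ2 hδ (hδd.trans hd1)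
  set A := BI (ρ + 2 * d) (fun y => ‖U y‖ ^ 2) with hA
  set E := BI (ρ + 2 * d) (DU2 (fun i y => U y i)) with hE
  have hA0 : 0 ≤ A := BI_nonneg _ (fun y => by positivity)
  have hE0 : 0 ≤ E := BI_nonneg _ (fun y => DU2_nonneg _ _)
  have mA1 : BI (ρ + d) (fun y => ‖U y‖ ^ 2) ≤ A := BI_mono_radius (by fun_prop) (fun y => by positivity) (by linarith)
  have mA : BI (ρ + d + δ) (fun y => ‖U y‖ ^ 2) ≤ A := BI_mono_radius (by fun_prop) (fun y => by positivity) (by linarith)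
  have mE : BI (ρ + d + δ) (DU2 (fun i y => U y i)) ≤ E := BI_mono_radius hDc (fun y => DU2_nonneg _ _) (by linarith)
  have hd1' : 1 ≤ d⁻¹ := (one_le_inv₀ hd).2 hd1
  have hδ1' : 1 ≤ δ⁻¹ := (one_le_inv₀ hδ).2 (hδd.trans hd1)
  set q := δ ^ (2 - σ) with hq
  have hq0 : 0 < q := by positivity
  have hR5 : R ≤ R ^ 5 := le_self_pow₀ hR (by norm_num)
  have hR5' : 1 ≤ R ^ 5 := one_le_pow₀ hR
  have hd2 : d⁻¹ ≤ d⁻¹ ^ 2 := le_self_pow₀ hd1' (by norm_num)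
  have hδ5 : 1 ≤ δ⁻¹ ^ 5 := one_le_pow₀ hδ1'
  have hδ25 : δ⁻¹ ^ 2 ≤ δ⁻¹ ^ 5 := pow_le_pow_right₀ hδ1' (by norm_num)
  set X := R ^ 5 * d⁻¹ ^ 2 * δ⁻¹ ^ 5 * (1 + A) with hX
  have hX0 : 0 ≤ X := by positivity
  have g1 : R * d⁻¹ ^ 2 * BI (ρ + d) (fun y => ‖U y‖ ^ 2) ≤ X := by
    have hA1 : 0 ≤ BI (ρ + d) (fun y => ‖U y‖ ^ 2) := BI_nonneg _ (fun y => by positivity)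
    calc _ ≤ R ^ 5 * d⁻¹ ^ 2 * A := by gcongr
      _ = R ^ 5 * d⁻¹ ^ 2 * 1 * A := by ring
      _ ≤ _ := by rw [hX]; gcongr; linarith
  have g2 : d⁻¹ * BI (ρ + d) (fun y => ‖U y‖ * ‖U y‖ ^ 2) ≤ C2 * (d⁻¹ * q * E + X) := by
    calc _ ≤ d⁻¹ * (C2 * (q * E + δ⁻¹ ^ 2 * A)) := by
          gcongr; exact f2.trans (by gcongr)
      _ = C2 * (d⁻¹ * q * E + 1 * d⁻¹ * δ⁻¹ ^ 2 * A) := by ring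
      _ ≤ _ := by rw [hX]; gcongr; linarith
  have g3 : d⁻¹ * BI (ρ + d) (fun y => ‖U y‖ * |P y - ∫ z, phiK z * P (δ • z)|) ≤ C3 * (d⁻¹ * q * E + X) := by
    calc _ ≤ d⁻¹ * (C3 * (q * E + R ^ 5 * δ⁻¹ ^ 5 * (1 + A))) := by
          gcongr; exact f3.trans (by gcongr)
      _ = C3 * (d⁻¹ * q * E + R ^ 5 * d⁻¹ * δ⁻¹ ^ 5 * (1 + A)) := by ring
      _ ≤ _ := by rw [hX]; gcongr
  have hqE : 0 ≤ d⁻¹ * q * E := by positivity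
  calc _ ≤ C1 * (X + C2 * (d⁻¹ * q * E + X) + C3 * (d⁻¹ * q * E + X)) := f1.trans (by gcongr)
    _ ≤ C1 * ((1 + C2 + C3) * (d⁻¹ * q * E + X)) := by gcongr; nlinarith
    _ = _ := by ring

lemma Sol.nashU (h : Sol a U P M σ) : ∃ C, 0 < C ∧ ∀ (R ρ δ : ℝ), 1 ≤ R → 1 ≤ ρ → ρ + δ ≤ 2 * R → 0 < δ →
    BI ρ (fun y => ‖U y‖ ^ 2) ≤ 2 * δ ^ 2 * BI (ρ + δ) (DU2 (fun i y => U y i)) + C * δ⁻¹ ^ 3 * R ^ 6 := by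
  have hb := cB_pos
  have hM := h.hM
  refine ⟨2 / cB * (8 * M) ^ 2, by positivity, fun R ρ δ hR hρ1 hρ hδ => ?_⟩
  have hc1 : ContDiff ℝ 1 U := h.hU.of_le (by exact_mod_cast le_top)
  have hcd := hc1.continuous_fderiv one_ne_zero
  refine (nash U hc1 ρ δ hδ).trans ?_
  have e : 2 / cB * (8 * M) ^ 2 * δ⁻¹ ^ 3 * R ^ 6 = 2 / cB * (δ⁻¹ ^ 3) * (M * (2 * R) ^ 3) ^ 2 := by ring
  rw [e]
  gcongr
  · exact BI_mono (by fun_prop) h.hc.DU2_cont _ (fun y _ => fderivU_sq_le U h.hU y)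
  · exact BI_nonneg _ fun y => norm_nonneg _
  · refine (h.l1 (ρ + δ) (by linarith)).trans ?_
    gcongr

set_option maxHeartbeats 1000000 in
lemma Sol.E_poly (h : Sol a U P M σ) : PB (fun R => BI R (DU2 (fun i y => U y i))) := by
  obtain ⟨C1, hC1, b1⟩ := h.energy2
  obtain ⟨C2, hC2, b2⟩ := h.nashU
  have hUc := h.hU.continuous
  have hDc := h.hc.DU2_cont
  have hκ : 0 < 2 - σ := by linarith [h.hσ]
  obtain ⟨m, hm1, hm⟩ := exists_m (2 - σ) hκ
  refine iter_poly _ (fun r => BI_nonneg _ (fun y => DU2_nonneg _ _))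
    (fun r s hrs => BI_mono_radius hDc (fun y => DU2_nonneg _ _) hrs) (5 + 14 * m) 20 ?_
  intro ε hε
  obtain ⟨θ, hθ0, hθ1, hθ⟩ := choose_theta (2 - σ) C1 (ε/2) hκ hC1 (by positivity) m hm
  set τ := min 1 (ε / (4 * C1)) with hτ
  have hτ0 : 0 < τ := by positivity
  have hτ1 : τ ≤ 1 := min_le_left _ _
  have hτ2 : C1 * (2 * τ ^ 2) ≤ ε / 2 := by
    have h1 : τ ≤ ε / (4 * C1) := min_le_right _ _
    rw [le_div_iff₀ (by positivity)] at h1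
    have h2 : τ ^ 2 ≤ τ := by nlinarith
    nlinarith
  refine ⟨C1 * (1 + C2 * τ⁻¹ ^ 3) * θ⁻¹ ^ 14 * 3 ^ (5 + 14 * m), by positivity, ?_⟩
  intro R ρ D hR hρ hD hD1 hRD
  set d := D / 3 with hd
  have hd0 : 0 < d := by positivity
  have hd1 : d ≤ 1 := by rw [hd]; linarith
  have hD3 : D = 3 * d := by rw [hd]; ring
  set δ := θ * d ^ m with hδ
  have hδ0 : 0 < δ := by positivity
  have hδd : δ ≤ d := by
    calc δ ≤ 1 * d ^ 1 := by
          rw [hδ]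
          exact mul_le_mul hθ1 (pow_le_pow_of_le_one hd0.le hd1 hm1) (by positivity) (by norm_num)
      _ = d := by ring
  have hR0 : 0 < R := by linarith
  set δ' := τ * R⁻¹ ^ 3 * d * δ ^ 3 with hδ'
  have hδ'0 : 0 < δ' := by positivity
  have hRi : R⁻¹ ≤ 1 := inv_le_one_of_one_le₀ hR
  have hδ1 : δ ≤ 1 := hδd.trans hd1
  have hδ'd : δ' ≤ d := by
    have : τ * R⁻¹ ^ 3 * δ ^ 3 ≤ 1 := by
      have q1 : R⁻¹ ^ 3 ≤ 1 := pow_le_one₀ (by positivity) hRi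
      have q2 : δ ^ 3 ≤ 1 := pow_le_one₀ (by positivity) hδ1
      calc τ * R⁻¹ ^ 3 * δ ^ 3 ≤ 1 * 1 * 1 := by gcongr
        _ = 1 := by norm_num
    calc δ' = (τ * R⁻¹ ^ 3 * δ ^ 3) * d := by rw [hδ']; ring
      _ ≤ 1 * d := by gcongr
      _ = d := one_mul d
  have f1 := b1 R ρ d δ hR hρ hd0 hd1 (by linarith) hδ0 hδd
  have f2 := b2 R (ρ + 2 * d) δ' hR (by linarith) (by linarith) hδ'0
  simp only
  set E := BI (ρ + D) (DU2 (fun i y => U y i)) with hE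
  have hE0 : 0 ≤ E := BI_nonneg _ (fun y => DU2_nonneg _ _)
  have m1 : BI (ρ + 2 * d) (DU2 (fun i y => U y i)) ≤ E := BI_mono_radius hDc (fun y => DU2_nonneg _ _) (by linarith)
  have m2 : BI (ρ + 2 * d + δ') (DU2 (fun i y => U y i)) ≤ E := BI_mono_radius hDc (fun y => DU2_nonneg _ _) (by linarith)
  have f2' : BI (ρ + 2 * d) (fun y => ‖U y‖ ^ 2) ≤ 2 * δ' ^ 2 * E + C2 * δ'⁻¹ ^ 3 * R ^ 6 := f2.trans (by gcongr)
  set q := δ ^ (2 - σ) with hq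
  have hq0 : 0 < q := by positivity
  have T1 : C1 * (d⁻¹ * q * BI (ρ + 2 * d) (DU2 (fun i y => U y i))) ≤ ε / 2 * E := by
    calc _ ≤ C1 * (d⁻¹ * q * E) := by gcongr
      _ = (C1 * d⁻¹ * q) * E := by ring
      _ ≤ _ := by gcongr; exact hθ d hd0 hd1
  set W := R ^ 5 * d⁻¹ ^ 2 * δ⁻¹ ^ 5 with hW
  have hW0 : 0 < W := by positivity
  have T2 : C1 * (W * (2 * δ' ^ 2 * E)) ≤ ε / 2 * E := by
    have : W * δ' ^ 2 ≤ τ ^ 2 := by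
      have e : W * δ' ^ 2 = τ ^ 2 * (R⁻¹ * δ) := by rw [hW, hδ']; field_simp
      rw [e]
      have : R⁻¹ * δ ≤ 1 * 1 := by gcongr
      nlinarith [sq_nonneg τ]
    calc _ = C1 * (2 * (W * δ' ^ 2)) * E := by ring
      _ ≤ C1 * (2 * τ ^ 2) * E := by gcongr
      _ ≤ _ := by gcongr
  have T3 : C1 * (W * (1 + C2 * δ'⁻¹ ^ 3 * R ^ 6)) ≤ C1 * (1 + C2 * τ⁻¹ ^ 3) * θ⁻¹ ^ 14 * 3 ^ (5 + 14 * m) * R ^ 20 * D⁻¹ ^ (5 + 14 * m) := by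
    have e1 : δ'⁻¹ ^ 3 * R ^ 6 = τ⁻¹ ^ 3 * (R ^ 15 * d⁻¹ ^ 3 * δ⁻¹ ^ 9) := by rw [hδ']; field_simp
    have hd1' : 1 ≤ d⁻¹ := (one_le_inv₀ hd0).2 hd1
    have hδ1' : 1 ≤ δ⁻¹ := (one_le_inv₀ hδ0).2 hδ1
    have e2 : 1 ≤ R ^ 15 * d⁻¹ ^ 3 * δ⁻¹ ^ 9 := by
      calc (1:ℝ) = 1 * 1 * 1 := by norm_num
        _ ≤ _ := by
          gcongr
          · exact one_le_pow₀ hR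
          · exact one_le_pow₀ hd1'
          · exact one_le_pow₀ hδ1'
    have e3 : 1 + C2 * δ'⁻¹ ^ 3 * R ^ 6 ≤ (1 + C2 * τ⁻¹ ^ 3) * (R ^ 15 * d⁻¹ ^ 3 * δ⁻¹ ^ 9) := by
      rw [mul_assoc, e1]
      generalize R ^ 15 * d⁻¹ ^ 3 * δ⁻¹ ^ 9 = Y at e2 ⊢
      have : (1 + C2 * τ⁻¹ ^ 3) * Y = Y + C2 * (τ⁻¹ ^ 3 * Y) := by ring
      rw [this]; gcongr
    have e4 : W * (R ^ 15 * d⁻¹ ^ 3 * δ⁻¹ ^ 9) = R ^ 20 * d⁻¹ ^ 5 * δ⁻¹ ^ 14 := by rw [hW]; ring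
    have e5 : δ⁻¹ ^ 14 = θ⁻¹ ^ 14 * d⁻¹ ^ (14 * m) := by
      rw [hδ, mul_inv, mul_pow, ← inv_pow, ← pow_mul]; ring_nf
    have e6 : d⁻¹ = 3 * D⁻¹ := by rw [hd]; field_simp
    calc C1 * (W * (1 + C2 * δ'⁻¹ ^ 3 * R ^ 6)) ≤ C1 * (W * ((1 + C2 * τ⁻¹ ^ 3) * (R ^ 15 * d⁻¹ ^ 3 * δ⁻¹ ^ 9))) := by gcongr
      _ = C1 * (1 + C2 * τ⁻¹ ^ 3) * (W * (R ^ 15 * d⁻¹ ^ 3 * δ⁻¹ ^ 9)) := by ring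
      _ = C1 * (1 + C2 * τ⁻¹ ^ 3) * (R ^ 20 * d⁻¹ ^ 5 * (θ⁻¹ ^ 14 * d⁻¹ ^ (14 * m))) := by rw [e4, e5]
      _ = C1 * (1 + C2 * τ⁻¹ ^ 3) * θ⁻¹ ^ 14 * R ^ 20 * d⁻¹ ^ (5 + 14 * m) := by rw [pow_add]; ring
      _ = _ := by rw [e6, mul_pow]; ring
  calc _ ≤ C1 * (d⁻¹ * q * BI (ρ + 2 * d) (DU2 (fun i y => U y i)) + W * (1 + BI (ρ + 2 * d) (fun y => ‖U y‖ ^ 2))) := f1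
    _ ≤ C1 * (d⁻¹ * q * BI (ρ + 2 * d) (DU2 (fun i y => U y i)) + W * (1 + (2 * δ' ^ 2 * E + C2 * δ'⁻¹ ^ 3 * R ^ 6))) := by gcongr
    _ = C1 * (d⁻¹ * q * BI (ρ + 2 * d) (DU2 (fun i y => U y i))) + C1 * (W * (2 * δ' ^ 2 * E)) + C1 * (W * (1 + C2 * δ'⁻¹ ^ 3 * R ^ 6)) := by ring
    _ ≤ _ := by linarith

lemma Sol.A_poly (h : Sol a U P M σ) : PB (fun R => BI R (fun y => ‖U y‖ ^ 2)) := by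
  obtain ⟨C2, hC2, b2⟩ := h.nashU
  refine ((h.E_poly.shift.cmul 2 (by norm_num)).add ((PB.pow 6).cmul C2 hC2.le)).mono fun R hR => ?_
  have := b2 R R 1 hR hR (by linarith) one_pos
  simpa using this

end Part10

section Part11
variable {a M σ : ℝ} {U : E3 → E3} {P : E3 → ℝ}

lemma BI_one (R : ℝ) (hR : 0 ≤ R) : BI R (fun _ => 1) = cB * R ^ 3 := by
  have h := Measure.addHaar_closedBall (volume : Measure E3) 0 hR
  rw [BI]
  simp only [integral_const, smul_eq_mul, mul_one, measureReal_restrict_apply_univ]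
  rw [Measure.real, h, ENNReal.toReal_mul, ENNReal.toReal_ofReal (by positivity), cB, cK,
    Measure.addHaar_closedBall (volume : Measure E3) 0 zero_le_one]
  simp
  ring

lemma PB_one : PB (fun R => BI R (fun _ => 1)) :=
  ((PB.pow 3).cmul cB cB_pos.le).mono fun R hR => (BI_one R (by linarith)).le

lemma ennreal_add_sq (x y : ℝ≥0∞) : (x + y) ^ 2 ≤ 2 * (x ^ 2 + y ^ 2) := by
  have h := ENNReal.rpow_add_le_mul_rpow_add_rpow x y (p := 2) (by norm_num)
  have e : (2:ℝ≥0∞) ^ ((2:ℝ) - 1) = 2 := by norm_num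
  rw [e] at h
  simpa only [ENNReal.rpow_two] using h

lemma IA_exp_mono (F : E3 → ℝ≥0∞) (y : E3) : IA 1 1 F y ≤ IA (3/4) 1 F y := by
  unfold IA
  refine setLIntegral_mono' measurableSet_Ioo fun s hs => ?_
  gcongr ENNReal.ofReal ?_ * _
  exact Real.rpow_le_rpow_of_exponent_ge hs.1 hs.2.le (by norm_num)

lemma Sol.P_poly (h : Sol a U P M σ) : ∃ c : ℝ, PB (fun R => BI R (fun y => (P y - c) ^ 2)) := by
  obtain ⟨C, hC, hb⟩ := h.press_pt
  have hUc := h.hU.continuous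
  have hPc := h.hc.hP.continuous
  have hDc := h.hc.DU2_cont
  have hb0 := cB_pos
  set c := ∫ z, phiK z * P ((1:ℝ) • z) with hc
  set E := fun R => BI R (DU2 (fun i y => U y i)) with hE
  set A := fun R => BI R (fun y => ‖U y‖ ^ 2) with hA
  have hE0 : ∀ R, 0 ≤ E R := fun R => BI_nonneg _ fun y => DU2_nonneg _ _
  have hA0 : ∀ R, 0 ≤ A R := fun R => BI_nonneg _ fun y => by positivity
  refine ⟨c, ?_⟩
  have hpbE : PB E := h.E_poly
  have hpbA : PB A := h.A_poly
  have pK : PB (fun R => C * (R ^ 2 * (1 + A (R + 1)))) :=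
    (((PB.pow 2).mul ((PB.cst 1).add hpbA.shift) (fun R hR => by have := hA0 (R + 1); positivity))).cmul C hC.le
  have k0 : ∀ R, 0 ≤ C * (R ^ 2 * (1 + A (R + 1))) := fun R => by have := hA0 (R+1); positivity
  have big : PB (fun R => (2 * (C ^ 2 * (16 * cB))) * (E (R + 1) * E (R + 1)) +
      2 * ((C * (R ^ 2 * (1 + A (R + 1)))) * (C * (R ^ 2 * (1 + A (R + 1)))) * BI R (fun _ => 1))) :=
    ((hpbE.shift.mul hpbE.shift (fun R _ => hE0 _)).cmul _ (by positivity)).add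
      (((pK.mul pK (fun R _ => k0 R)).mul PB_one (fun R _ => BI_nonneg _ fun _ => zero_le_one)).cmul 2 (by norm_num))
  refine big.mono fun R hR => ?_
  set K := C * (R ^ 2 * (1 + A (R + 1))) with hK
  have hK0 : 0 ≤ K := k0 R
  set F : E3 → ℝ≥0∞ := fun x => ENNReal.ofReal (DU2 (fun i y => U y i) x) with hF
  have hFm : Measurable F := hDc.measurable.ennreal_ofReal
  have hT0 : 0 ≤ BI R (fun _ => (1:ℝ)) := BI_nonneg _ fun _ => zero_le_one
  have key : ∫⁻ y in closedBall (0 : E3) R, ‖P y - c‖ₑ ^ 2 ≤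
      2 * (ENNReal.ofReal C ^ 2 * (16 * cK * ENNReal.ofReal (E (R + 1)) ^ 2)
        + ENNReal.ofReal K ^ 2 * ENNReal.ofReal (BI R (fun _ => 1))) := by
    calc _ ≤ ∫⁻ y in closedBall (0 : E3) R, 2 * (ENNReal.ofReal C ^ 2 * IA (3/4) 1 F y ^ 2 + ENNReal.ofReal K ^ 2 * ENNReal.ofReal 1) := by
          refine setLIntegral_mono' measurableSet_closedBall fun y hy => ?_
          have h1 := hb R R 1 y hR (by linarith) one_pos le_rfl (by simpa using hy)
          have h2 : ‖P y - c‖ₑ ≤ ENNReal.ofReal C * IA (3/4) 1 F y + ENNReal.ofReal K := by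
            refine h1.trans ?_
            gcongr
            · exact IA_exp_mono F y
            · rw [hK]; simp [hA, mul_assoc]
          calc _ ≤ (ENNReal.ofReal C * IA (3/4) 1 F y + ENNReal.ofReal K) ^ 2 := by gcongr
            _ ≤ _ := ennreal_add_sq _ _
            _ = _ := by simp [mul_pow]
      _ = 2 * (ENNReal.ofReal C ^ 2 * (∫⁻ y in closedBall (0 : E3) R, IA (3/4) 1 F y ^ 2) +
            ENNReal.ofReal K ^ 2 * ∫⁻ y in closedBall (0 : E3) R, ENNReal.ofReal 1) := by
          have mI := (IA_measurable (3/4) 1 F hFm).pow_const 2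
          rw [lintegral_const_mul _ (by fun_prop), lintegral_add_right _ (by fun_prop), lintegral_const_mul _ mI,
            lintegral_const_mul _ (by fun_prop)]
      _ ≤ _ := by
          gcongr
          · refine (IA_sq F hFm R).trans_eq ?_
            rw [hF, BI_lintegral hDc (fun y => DU2_nonneg _ _)]
          · rw [BI_lintegral (f := fun _ => 1) (by fun_prop) (fun _ => zero_le_one)]
  rw [BI_enorm_sq (fun y => P y - c) (by fun_prop), cK_eq] at key
  have e0 : 0 ≤ E (R + 1) := hE0 _
  have e2 : (2 : ℝ≥0∞) = ENNReal.ofReal 2 := by simp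
  have e16 : (16 : ℝ≥0∞) = ENNReal.ofReal 16 := by simp
  rw [e2, e16, ← ENNReal.ofReal_pow hC.le, ← ENNReal.ofReal_pow e0, ← ENNReal.ofReal_pow hK0,
    ← ENNReal.ofReal_mul (by positivity), ← ENNReal.ofReal_mul (by positivity), ← ENNReal.ofReal_mul (by positivity),
    ← ENNReal.ofReal_mul (by positivity), ← ENNReal.ofReal_add (by positivity) (by positivity),
    ← ENNReal.ofReal_mul (by positivity), ENNReal.ofReal_le_ofReal_iff (by positivity)] at key
  simp only [Real.norm_eq_abs, sq_abs] at key
  refine key.trans (le_of_eq ?_)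
  ring

lemma Sol.Pi_poly (h : Sol a U P M σ) : PB (fun R => BI R (fun y => PiF a (fun i y => U y i) P y ^ 2)) := by
  obtain ⟨c, hP⟩ := h.P_poly
  have hUc := h.hU.continuous
  have hPc := h.hc.hP.continuous
  have hDc := h.hc.DU2_cont
  have hU1 : ContDiff ℝ 1 U := h.hU.of_le (by exact_mod_cast le_top)
  have hcd := hU1.continuous_fderiv one_ne_zero
  have ha := h.ha
  obtain ⟨C, hC, h4⟩ := l4_bound U hU1 M 0 h.hM.le (fun y => by simpa using h.hm 1 one_ne_zero y)
  have hE0 : ∀ R, 0 ≤ BI R (DU2 (fun i y => U y i)) := fun R => BI_nonneg _ fun y => DU2_nonneg _ _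
  have p4 : PB (fun R => BI R (fun y => ‖U y‖ ^ 4)) := by
    refine ((PB_one.add (h.E_poly.shift.mul h.E_poly.shift (fun R _ => hE0 _))).cmul C hC.le).mono fun R hR => ?_
    refine (h4 R).trans ?_
    have : BI (R + 1) (fun y => ‖fderiv ℝ U y‖ ^ 2) ≤ BI (R + 1) (DU2 (fun i y => U y i)) :=
      BI_mono (by fun_prop) hDc _ (fun y _ => fderivU_sq_le U h.hU y)
    have h0 : 0 ≤ BI (R + 1) (fun y => ‖fderiv ℝ U y‖ ^ 2) := BI_nonneg _ fun y => by positivity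
    rw [sq]
    gcongr
    exact hE0 _
  refine (((p4.add (hP.cmul 4 (by norm_num))).add (PB_one.cmul (4 * c ^ 2) (by positivity))).add
    (((PB.pow 2).mul h.A_poly (fun R _ => BI_nonneg _ fun y => by positivity)).cmul (36 * a ^ 2) (by positivity))).mono fun R hR => ?_
  have cPi := h.hc.Pi_sm.continuous
  have pt : ∀ y ∈ closedBall (0 : E3) R, PiF a (fun i y => U y i) P y ^ 2 ≤
      ‖U y‖ ^ 4 + 4 * (P y - c) ^ 2 + (4 * c ^ 2) * 1 + (36 * a ^ 2 * R ^ 2) * ‖U y‖ ^ 2 := by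
    intro y hy
    have hy' : ‖y‖ ≤ R := by simpa using hy
    rw [PiF, qU_norm]
    have b := sum_mul_le (fun k => y k) (fun k => U y k) R ‖U y‖ (by linarith) (fun k => (abs_coord_le y k).trans hy')
      (fun k => abs_coord_le (U y) k)
    simp only at b
    set S := ∑ k, y k * U y k
    have hS : S ^ 2 ≤ 9 * (R ^ 2 * ‖U y‖ ^ 2) := by
      have := sq_le_sq' (abs_le.1 b).1 (abs_le.1 b).2
      nlinarith
    have h4 : ∀ x1 x2 x3 x4 : ℝ, (x1 + x2 + x4) ^ 2 ≤ 4 * x1 ^ 2 + 4 * (x2 - x3) ^ 2 + 4 * x3 ^ 2 + 4 * x4 ^ 2 := by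
      intro x1 x2 x3 x4
      nlinarith [sq_nonneg (x1 - (x2 - x3)), sq_nonneg (x1 - x3), sq_nonneg (x1 - x4), sq_nonneg ((x2 - x3) - x3), sq_nonneg ((x2-x3) - x4), sq_nonneg (x3 - x4)]
    refine (h4 (1/2 * ‖U y‖ ^ 2) (P y) c (a * S)).trans ?_
    have := mul_le_mul_of_nonneg_left hS (by positivity : 0 ≤ 4 * a ^ 2)
    linarith
  refine (BI_mono (by fun_prop) (by fun_prop) _ pt).trans (le_of_eq ?_)
  rw [BI_add (by fun_prop) (by fun_prop), BI_add (by fun_prop) (by fun_prop), BI_add (by fun_prop) (by fun_prop),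
    BI_const_mul, BI_const_mul, BI_const_mul]
  ring

end Part11

section Part12
variable {a M σ : ℝ} {U : E3 → E3} {P : E3 → ℝ} {H : E3 → ℝ}

structure SubS (a : ℝ) (U : E3 → E3) (H : E3 → ℝ) : Prop where
  sm : Sm H
  nn : ∀ y, 0 ≤ H y
  sub : ∀ y, 0 ≤ lap H y - ∑ k, (U y k + a * y k) * pd k H y

def dH2 (H : E3 → ℝ) (y : E3) : ℝ := ∑ k, (pd k H y) ^ 2

lemma dH2_nonneg (H : E3 → ℝ) (y : E3) : 0 ≤ dH2 H y := Finset.sum_nonneg fun k _ => sq_nonneg _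

lemma dH2_cont (hH : Sm H) : Continuous (dH2 H) :=
  continuous_finsetSum _ fun k _ => (hH.pd k).continuous.pow 2

lemma pd_zero_out {f : E3 → ℝ} (ρ : ℝ) (h : ∀ y, ρ < ‖y‖ → f y = 0) (k : Fin 3) (y : E3) (hy : ρ < ‖y‖) : pd k f y = 0 := by
  have : f =ᶠ[nhds y] fun _ => 0 := by
    filter_upwards [(isOpen_lt continuous_const continuous_norm).mem_nhds hy] with z hz
    exact h z hz
  unfold pd
  rw [this.fderiv_eq]; simp

lemma BI_div_zero {V : Fin 3 → E3 → ℝ} (ρ : ℝ) (hf : ∀ k, Sm (V k)) (h : ∀ k y, ρ < ‖y‖ → V k y = 0) :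
    BI ρ (fun y => ∑ k, pd k (V k) y) = 0 := by
  rw [← int_eq_BI ρ, int_div_zero hf fun k => compactSupport_of_norm ρ (h k)]
  intro y hy
  exact Finset.sum_eq_zero fun k _ => pd_zero_out ρ (h k) k y hy

set_option maxHeartbeats 1000000 in
lemma sub_energy (hs : SubS a U H) (h : SolC a (fun i y => U y i) P) {W : E3 → ℝ} (hW : Sm W) (hW0 : ∀ y, 0 ≤ W y)
    (ρ : ℝ) (hout : ∀ y, ρ < ‖y‖ → W y = 0) :
    BI ρ (fun y => 2 * (dH2 H y * W y)) ≤
      BI ρ (fun y => H y ^ 2 * (lap W y + (∑ k, (U y k + a * y k) * pd k W y) + 3 * a * W y)) := by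
  have sH := hs.sm
  have hu := h.hu
  set Q : E3 → ℝ := fun y => H y * H y with hQ
  have sQ : Sm Q := sH.mul sH
  have sb : ∀ k, Sm (fun y => U y k + a * y k) := fun k => (hu k).add ((Sm.cst a).mul (Sm.coord k))
  have pb : ∀ k y, pd k (fun y => U y k + a * y k) y = pd k (fun y => U y k) y + a := by
    intro k y
    rw [pd_add (hu k) ((Sm.cst a).mul (Sm.coord k)), pd_cmul (Sm.coord k), pd_coord]; simp
  set T : Fin 3 → E3 → ℝ := fun k y => pd k Q y - (U y k + a * y k) * Q y with hT
  have sT1 : ∀ k, Sm (fun y => (U y k + a * y k) * Q y) := fun k => (sb k).mul sQ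
  have sT : ∀ k, Sm (T k) := fun k => (sQ.pd k).sub (sT1 k)
  have s1 : ∀ k, Sm (fun y => W y * T k y) := fun k => hW.mul (sT k)
  have s2 : ∀ k, Sm (fun y => Q y * pd k W y) := fun k => sQ.mul (hW.pd k)
  have hz := BI_div_zero (V := fun k y => W y * T k y - Q y * pd k W y) ρ (fun k => (s1 k).sub (s2 k))
    (fun k y hy => by rw [hout y hy, pd_zero_out ρ hout k y hy]; ring)
  have key : ∀ y, ∑ k, pd k (fun y => W y * T k y - Q y * pd k W y) y =
      2 * (dH2 H y * W y) + 2 * (H y * (lap H y - ∑ k, (U y k + a * y k) * pd k H y) * W y)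
      - H y ^ 2 * (lap W y + (∑ k, (U y k + a * y k) * pd k W y) + 3 * a * W y) := by
    intro y
    have pQ : ∀ k y, pd k Q y = 2 * (H y * pd k H y) := fun k y => by rw [hQ, pd_mul sH sH]; ring
    have ppQ : ∀ k, pd k (pd k Q) y = 2 * (pd k H y * pd k H y + H y * pd k (pd k H) y) := by
      intro k
      have : pd k Q = fun y => 2 * (H y * pd k H y) := funext (pQ k)
      rw [this, pd_cmul (sH.mul (sH.pd k)), pd_mul sH (sH.pd k)]
    have pT : ∀ k, pd k (T k) y = pd k (pd k Q) y - ((pd k (fun y => U y k) y + a) * Q y + (U y k + a * y k) * pd k Q y) := by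
      intro k
      rw [hT]
      simp only
      rw [pd_sub (sQ.pd k) (sT1 k), pd_mul (sb k) sQ, pb]
    have pV : ∀ k, pd k (fun y => W y * T k y - Q y * pd k W y) y = pd k W y * T k y + W y * pd k (T k) y
        - (pd k Q y * pd k W y + Q y * pd k (pd k W) y) := by
      intro k
      rw [pd_sub (s1 k) (s2 k), pd_mul hW (sT k), pd_mul sQ (hW.pd k)]
    simp_rw [pV, pT, ppQ]
    have hd := h.hdiv y
    have l2 : lap W y = ∑ k, pd k (pd k W) y := rfl
    have l3 : lap H y = ∑ k, pd k (pd k H) y := rfl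
    rw [l2, l3, dH2]
    simp only [hT, pQ]
    simp only [hQ]
    simp only [Fin.sum_univ_three] at hd ⊢
    linear_combination (- (W y * H y ^ 2)) * hd
  have cH := sH.continuous
  have cW := hW.continuous
  have cU : ∀ k, Continuous fun y => U y k := fun k => (hu k).continuous
  have cd := dH2_cont sH
  have cl := hW.lap.continuous
  have cp := fun k => (hW.pd k).continuous
  have c1 : Continuous (fun y => ∑ k, pd k (fun y => W y * T k y - Q y * pd k W y) y) :=
    continuous_finsetSum _ fun k _ => (Sm.pd (ContDiff.sub (s1 k) (s2 k)) k).continuous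
  have c2 : Continuous (fun y => ∑ k, (U y k + a * y k) * pd k W y) :=
    continuous_finsetSum _ fun k _ => (sb k).continuous.mul (cp k)
  have c3 : Continuous (fun y => H y ^ 2 * (lap W y + (∑ k, (U y k + a * y k) * pd k W y) + 3 * a * W y)) :=
    (cH.pow 2).mul ((cl.add c2).add (continuous_const.mul cW))
  have : BI ρ (fun y => 2 * (dH2 H y * W y)) ≤ BI ρ (fun y => H y ^ 2 * (lap W y + (∑ k, (U y k + a * y k) * pd k W y) + 3 * a * W y)
      + ∑ k, pd k (fun y => W y * T k y - Q y * pd k W y) y) := by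
    refine BI_mono (continuous_const.mul (cd.mul cW)) (c3.add c1) _ fun y _ => ?_
    simp only [Pi.add_apply, Pi.mul_apply]
    rw [key]
    have := mul_nonneg (mul_nonneg (hs.nn y) (hs.sub y)) (hW0 y)
    linarith
  rw [BI_add c3 c1, hz, add_zero] at this
  exact this

lemma lap_mul {f g : E3 → ℝ} (hf : Sm f) (hg : Sm g) (y : E3) :
    lap (fun y => f y * g y) y = lap f y * g y + 2 * (∑ k, pd k f y * pd k g y) + f y * lap g y := by
  have e : ∀ k, pd k (pd k (fun y => f y * g y)) y = pd k (pd k f) y * g y + 2 * (pd k f y * pd k g y) + f y * pd k (pd k g) y := by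
    intro k
    have : pd k (fun y => f y * g y) = fun y => pd k f y * g y + f y * pd k g y := funext (pd_mul hf hg k)
    rw [this, pd_add ((hf.pd k).mul hg) (hf.mul (hg.pd k)), pd_mul (hf.pd k) hg, pd_mul hf (hg.pd k)]; ring
  change ∑ k, pd k (pd k (fun y => f y * g y)) y = (∑ k, pd k (pd k f) y) * g y + _ + f y * ∑ k, pd k (pd k g) y
  simp_rw [e]
  simp only [Fin.sum_univ_three]; ring

/-- The weight `exp (-c⟨y⟩)`. -/
def jb (y : E3) : ℝ := Real.sqrt (1 + ‖y‖ ^ 2)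
def wt (c : ℝ) (y : E3) : ℝ := Real.exp (-c * jb y)

lemma jb_pos (y : E3) : 0 < jb y := Real.sqrt_pos.2 (by positivity)
lemma jb_sq (y : E3) : jb y ^ 2 = 1 + ‖y‖ ^ 2 := Real.sq_sqrt (by positivity)
lemma jb_one (y : E3) : 1 ≤ jb y := by have := jb_sq y; have := jb_pos y; nlinarith [sq_nonneg ‖y‖]
lemma norm_le_jb (y : E3) : ‖y‖ ≤ jb y := by
  refine abs_le_of_sq_le_sq' ?_ (jb_pos y).le |>.2
  rw [jb_sq]; linarith
lemma jb_sm : Sm jb := by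
  have h : Sm (fun y : E3 => 1 + ‖y‖ ^ 2) := contDiff_const.add (contDiff_id.norm_sq ℝ)
  exact h.sqrt (fun y => by positivity)
lemma wt_sm (c : ℝ) : Sm (wt c) := (contDiff_const.mul jb_sm).exp
lemma wt_pos (c : ℝ) (y : E3) : 0 < wt c y := Real.exp_pos _

lemma pd_jb (k : Fin 3) (y : E3) : pd k jb y = y k / jb y := by
  have hs : HasDerivAt (fun r : ℝ => Real.sqrt (1 + r)) (1 / (2 * Real.sqrt (1 + ‖y - 0‖ ^ 2))) (‖y - 0‖ ^ 2) := by
    have := ((hasDerivAt_id (‖y - 0‖ ^ 2)).const_add 1).sqrt (by simp; positivity)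
    simpa using this
  have := pd_radial 0 k y hs
  simp only [sub_zero] at this
  change pd k (fun z => Real.sqrt (1 + ‖z‖ ^ 2)) y = _
  rw [this, jb]
  simp
  have := (jb_pos y).ne'
  rw [jb] at this
  field_simp

lemma pd_wt (c : ℝ) (k : Fin 3) (y : E3) : pd k (wt c) y = -c * (y k / jb y) * wt c y := by
  have hq : HasDerivAt (fun t : ℝ => Real.exp (-c * t)) (Real.exp (-c * jb y) * -c) (jb y) := by
    simpa using ((hasDerivAt_id (jb y)).const_mul (-c)).exp
  have := pd_comp jb_sm k y hq
  change pd k (fun z => Real.exp (-c * jb z)) y = _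
  rw [this, pd_jb, wt]; ring

lemma lap_wt2 (y : E3) : lap (wt 2) y ≤ 4 * wt 2 y := by
  have hj := (jb_pos y).ne'
  have sd : Sm (fun y : E3 => (jb y)⁻¹) := jb_sm.inv fun y => (jb_pos y).ne'
  have e : ∀ k, pd k (pd k (wt 2)) y = wt 2 y * (4 * (y k / jb y) ^ 2 - 2 * (jb y)⁻¹ + 2 * (y k) ^ 2 * (jb y)⁻¹ ^ 3) := by
    intro k
    have : pd k (wt 2) = fun y => (-2) * ((y k * (jb y)⁻¹) * wt 2 y) := funext fun y => by rw [pd_wt]; ring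
    have hi : pd k (fun y : E3 => (jb y)⁻¹) y = - (jb y ^ 2)⁻¹ * (y k / jb y) := by
      rw [pd_comp jb_sm k y (hasDerivAt_inv hj), pd_jb]
    rw [this, pd_cmul (((Sm.coord k).mul sd).mul (wt_sm 2)), pd_mul ((Sm.coord k).mul sd) (wt_sm 2), pd_mul (Sm.coord k) sd,
      pd_wt, hi, pd_coord]
    simp
    field_simp
    ring
  change ∑ k, pd k (pd k (wt 2)) y ≤ _
  simp_rw [e]
  rw [← Finset.mul_sum, mul_comm (4:ℝ)]
  refine mul_le_mul_of_nonneg_left ?_ (wt_pos _ _).le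
  have n := normsq_eq y
  have e2 : ∑ k, (4 * (y k / jb y) ^ 2 - 2 * (jb y)⁻¹ + 2 * (y k) ^ 2 * (jb y)⁻¹ ^ 3)
      = 4 * ‖y‖ ^ 2 * (jb y)⁻¹ ^ 2 - 6 * (jb y)⁻¹ + 2 * ‖y‖ ^ 2 * (jb y)⁻¹ ^ 3 := by
    rw [n]; simp only [Fin.sum_univ_three]; ring
  rw [e2]
  have n2 : ‖y‖ ^ 2 * (jb y)⁻¹ ^ 2 ≤ 1 := by
    rw [inv_pow, jb_sq, ← div_eq_mul_inv, div_le_one (by positivity)]; linarith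
  have i0 : 0 < (jb y)⁻¹ := inv_pos.2 (jb_pos y)
  have := mul_le_mul_of_nonneg_right n2 i0.le
  nlinarith

lemma sum_pd_wt2 (y : E3) (hy : 1 ≤ ‖y‖) : ∑ k, y k * pd k (wt 2) y ≤ - (‖y‖ * wt 2 y) := by
  have : ∑ k, y k * pd k (wt 2) y = - (2 * (‖y‖ ^ 2 / jb y) * wt 2 y) := by
    rw [normsq_eq]; simp only [pd_wt, Fin.sum_univ_three]; ring
  rw [this]
  have hw := wt_pos 2 y
  have h2 : ‖y‖ ≤ 2 * (‖y‖ ^ 2 / jb y) := by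
    have hj : jb y ≤ 2 * ‖y‖ := by
      refine abs_le_of_sq_le_sq' ?_ (by positivity) |>.2
      rw [jb_sq]; nlinarith
    rw [← mul_div_assoc, le_div_iff₀ (jb_pos y)]
    nlinarith [norm_nonneg y]
  have := mul_le_mul_of_nonneg_right h2 hw.le
  linarith

lemma abs_pd_wt (c : ℝ) (hc : 0 ≤ c) (k : Fin 3) (y : E3) : |pd k (wt c) y| ≤ c * wt c y := by
  rw [pd_wt, abs_mul, abs_of_pos (wt_pos c y), abs_mul, abs_neg, abs_of_nonneg hc]
  have : |y k / jb y| ≤ 1 := by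
    rw [abs_div, abs_of_pos (jb_pos y), div_le_one (jb_pos y)]
    exact (abs_coord_le y k).trans (norm_le_jb y)
  have hw := wt_pos c y
  calc c * |y k / jb y| * wt c y ≤ c * 1 * wt c y := by gcongr
    _ = _ := by ring

lemma wt_sq (y : E3) : wt 2 y = wt 1 y ^ 2 := by
  rw [wt, wt, ← Real.exp_nat_mul]; congr 1; push_cast; ring

lemma wt2_le (R : ℝ) (y : E3) (hy : R ≤ ‖y‖) : wt 2 y ≤ Real.exp (-2 * R) := by
  rw [wt]; apply Real.exp_le_exp.2; have := norm_le_jb y; linarith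
lemma wt2_le_one (y : E3) : wt 2 y ≤ 1 := by
  have := wt2_le 0 y (norm_nonneg y); simpa using this

end Part12

section Part13
variable {a M σ : ℝ} {U : E3 → E3} {P : E3 → ℝ} {H : E3 → ℝ}

lemma Sol.cubicH (h : Sol a U P M σ) : ∃ C, 0 < C ∧ ∀ f : E3 → ℝ, Sm f → ∀ ρ δ : ℝ, 0 < δ → δ ≤ 1 →
    BI ρ (fun y => ‖U y‖ * f y ^ 2) ≤ C * (δ ^ (2 - σ) * BI (ρ + δ) (dH2 f) + δ⁻¹ ^ 2 * BI (ρ + δ) (fun y => f y ^ 2)) := by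
  have hM := h.hM
  have hb := cB_pos
  have : 0 < 1 - σ/2 := by linarith [h.hσ]
  refine ⟨2 * M / (cB * (1 - σ/2) ^ 2), by positivity, fun f hf ρ δ hδ hδ1 => ?_⟩
  have hfc := hf.continuous
  have hcd := hf.c1.continuous_fderiv one_ne_zero
  have key := formBound (fun y => ‖U y‖) h.hU.continuous.norm (fun y => norm_nonneg _) M σ hM.le h.hσ0.le h.hσ h.hm' f hf.c1 ρ δ hδ
  simp only [Real.norm_eq_abs, sq_abs] at key
  refine key.trans ?_
  gcongr
  · exact BI_mono (by fun_prop) (dH2_cont hf) _ (fun y _ => fderiv_sq_le f y)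
  · exact BI_nonneg _ fun y => sq_nonneg _
  · exact h.neg_sigma hδ hδ1

lemma sub_alg (N C a R D l x S1 S2 q : ℝ) (hN : 0 ≤ N) (hC : 0 < C) (ha : 0 < a) (hR : 1 ≤ R) (hD : 1 ≤ D) (hq : 0 ≤ q)
    (h1 : l ≤ C * D ^ 2) (h2 : x ≤ 1) (h3 : S1 ≤ 3 * (2 * R * (C * D))) (h4 : S2 ≤ 3 * (N * (C * D))) :
    q * (l + (S2 + a * S1) + 3 * a * x) ≤
      ((C + 3 * a + 6 * a * C + 3 * C) * (R * D ^ 2)) * q + ((C + 3 * a + 6 * a * C + 3 * C) * D) * (N * q) := by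
  have x1 : D ≤ D ^ 2 := le_self_pow₀ hD (by norm_num)
  have x2 : D ^ 2 ≤ R * D ^ 2 := le_mul_of_one_le_left (by positivity) hR
  have x4 : R * D ≤ R * D ^ 2 := by gcongr
  have t1 : l ≤ C * (R * D ^ 2) := h1.trans (by gcongr)
  have t2 : 3 * a * x ≤ 3 * a * (R * D ^ 2) := by gcongr; linarith
  have t3 : a * S1 ≤ a * (6 * C * (R * D ^ 2)) := by
    gcongr
    calc S1 ≤ 6 * C * (R * D) := by linarith
      _ ≤ _ := by gcongr
  have t : l + (S2 + a * S1) + 3 * a * x ≤ (C + 3 * a + 6 * a * C + 3 * C) * (R * D ^ 2) + ((C + 3 * a + 6 * a * C + 3 * C) * D) * N := by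
    have e1 : 0 ≤ 3 * C * (R * D ^ 2) := by positivity
    have e2 : 0 ≤ (C + 3 * a + 6 * a * C) * D * N := by positivity
    linarith
  calc _ ≤ q * ((C + 3 * a + 6 * a * C + 3 * C) * (R * D ^ 2) + ((C + 3 * a + 6 * a * C + 3 * C) * D) * N) := by gcongr
    _ = _ := by ring

lemma sum_split (y v : E3) (a : ℝ) (f : E3 → ℝ) : ∑ k, (v k + a * y k) * pd k f y = (∑ k, v k * pd k f y) + a * ∑ k, y k * pd k f y := by
  simp only [Fin.sum_univ_three]; ring

lemma sub1 (hs : SubS a U H) (h : Sol a U P M σ) : ∃ C, 0 < C ∧ ∀ (R ρ d : ℝ), 1 ≤ R → R ≤ ρ → 0 < d → d ≤ 1 → ρ + d ≤ 2 * R →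
    BI ρ (dH2 H) ≤ C * (R * d⁻¹ ^ 2 * BI (ρ + d) (fun y => H y ^ 2) + d⁻¹ * BI (ρ + d) (fun y => ‖U y‖ * H y ^ 2)) := by
  obtain ⟨C, hC, hcut⟩ := cutoff_exists
  have ha := h.ha
  have hUc := h.hU.continuous
  have hHc := hs.sm.continuous
  have hDc := dH2_cont hs.sm
  refine ⟨C + 3 * a + 6 * a * C + 3 * C, by positivity, fun R ρ d hR hρ hd hd1 hρ2 => ?_⟩
  obtain ⟨χ, sχ, χ0, χ1, χin, χout, χb1, χb2, χo1, χo2, -, -⟩ := hcut ρ d (by linarith) hd hd1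
  have hid := sub_energy hs h.hc sχ χ0 (ρ + d) χout
  have cχ1 := fun k => (sχ.pd k).continuous
  have cχ2 := sχ.lap.continuous
  have cχ := sχ.continuous
  have cu : ∀ k, Continuous (fun y => U y k) := fun k => (h.hc.hu k).continuous
  have hd1' : 1 ≤ d⁻¹ := (one_le_inv₀ hd).2 hd1
  have step1 : BI ρ (dH2 H) ≤ BI (ρ + d) (fun y => 2 * (dH2 H y * χ y)) := by
    have cc : Continuous (fun y => 2 * (dH2 H y * χ y)) := by fun_prop
    calc _ ≤ BI ρ (fun y => 2 * (dH2 H y * χ y)) := by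
          refine BI_mono hDc cc _ fun y hy => ?_
          rw [χin y (by simpa using hy), mul_one]; linarith [dH2_nonneg H y]
      _ ≤ _ := BI_mono_radius cc (fun y => mul_nonneg (by norm_num) (mul_nonneg (dH2_nonneg _ _) (χ0 y))) (by linarith)
  refine step1.trans (hid.trans ?_)
  set C' := C + 3 * a + 6 * a * C + 3 * C with hC'
  have pt : ∀ y ∈ closedBall (0 : E3) (ρ + d), H y ^ 2 * (lap χ y + (∑ k, (U y k + a * y k) * pd k χ y) + 3 * a * χ y) ≤
      (C' * (R * d⁻¹ ^ 2)) * H y ^ 2 + (C' * d⁻¹) * (‖U y‖ * H y ^ 2) := by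
    intro y hy
    have hy' : ‖y‖ ≤ 2 * R := by have : ‖y‖ ≤ ρ + d := by simpa using hy
                                 linarith
    have b1 := sum_mul_le (fun k => y k) (fun k => pd k χ y) (2 * R) (C * d⁻¹) (by linarith)
      (fun k => (abs_coord_le y k).trans hy') (fun k => χb1 k y)
    have b2 := sum_mul_le (fun k => U y k) (fun k => pd k χ y) ‖U y‖ (C * d⁻¹) (norm_nonneg _)
      (fun k => abs_coord_le (U y) k) (fun k => χb1 k y)
    rw [sum_split]
    exact sub_alg ‖U y‖ C a R d⁻¹ _ _ _ _ _ (norm_nonneg _) hC ha hR hd1' (sq_nonneg _) ((le_abs_self _).trans (χb2 y)) (χ1 y)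
      ((le_abs_self _).trans b1) ((le_abs_self _).trans b2)
  have cs : Continuous (fun y => ∑ k, (U y k + a * y k) * pd k χ y) :=
    continuous_finsetSum _ fun k _ => ((cu k).add (continuous_const.mul (Sm.coord k).continuous)).mul (cχ1 k)
  refine (BI_mono (by fun_prop) (by fun_prop) _ pt).trans ?_
  rw [BI_add (by fun_prop) (by fun_prop), BI_const_mul, BI_const_mul]
  apply le_of_eq; ring

lemma D_poly (hs : SubS a U H) (h : Sol a U P M σ) (hp : PB (fun R => BI R (fun y => H y ^ 2))) : PB (fun R => BI R (dH2 H)) := by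
  obtain ⟨C1, hC1, b1⟩ := sub1 hs h
  obtain ⟨C2, hC2, b2⟩ := h.cubicH
  obtain ⟨C3, hC3, N, b3⟩ := hp
  have hHc := hs.sm.continuous
  have hDc := dH2_cont hs.sm
  have hκ : 0 < 2 - σ := by linarith [h.hσ]
  obtain ⟨m, hm1, hm⟩ := exists_m (2 - σ) hκ
  refine iter_poly _ (fun r => BI_nonneg _ (fun y => dH2_nonneg _ _))
    (fun r s hrs => BI_mono_radius hDc (fun y => dH2_nonneg _ _) hrs) (2 + 2 * m) (1 + N) ?_
  intro ε hε
  obtain ⟨θ, hθ0, hθ1, hθ⟩ := choose_theta (2 - σ) (C1 * C2) ε hκ (by positivity) (by positivity) m hm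
  refine ⟨C1 * (1 + C2) * θ⁻¹ ^ 2 * 2 ^ (2 + 2 * m) * (C3 * 2 ^ N), by positivity, ?_⟩
  intro R ρ D hR hρ hD hD1 hRD
  set d := D / 2 with hd
  have hd0 : 0 < d := by positivity
  have hd1 : d ≤ 1 := by rw [hd]; linarith
  have hD3 : D = 2 * d := by rw [hd]; ring
  set δ := θ * d ^ m with hδ
  have hδ0 : 0 < δ := by positivity
  have hδd : δ ≤ d := by
    calc δ ≤ 1 * d ^ 1 := by
          rw [hδ]
          exact mul_le_mul hθ1 (pow_le_pow_of_le_one hd0.le hd1 hm1) (by positivity) (by norm_num)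
      _ = d := by ring
  have hδ1 : δ ≤ 1 := hδd.trans hd1
  have f1 := b1 R ρ d hR hρ hd0 hd1 (by linarith)
  have f2 := b2 H hs.sm (ρ + d) δ hδ0 hδ1
  have f3 := b3 (R + 1) (by linarith)
  simp only at f3 ⊢
  set E := BI (ρ + D) (dH2 H) with hE
  set X := BI (ρ + D) (fun y => H y ^ 2) with hX
  have hE0 : 0 ≤ E := BI_nonneg _ (fun y => dH2_nonneg _ _)
  have hX0 : 0 ≤ X := BI_nonneg _ (fun y => sq_nonneg _)
  have hX3 : X ≤ C3 * 2 ^ N * R ^ N := by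
    calc X ≤ BI (R + 1) (fun y => H y ^ 2) := BI_mono_radius (by fun_prop) (fun y => sq_nonneg _) (by linarith)
      _ ≤ _ := f3
      _ ≤ C3 * (2 * R) ^ N := by gcongr; linarith
      _ = _ := by rw [mul_pow]; ring
  have m1 : BI (ρ + d + δ) (dH2 H) ≤ E := BI_mono_radius hDc (fun y => dH2_nonneg _ _) (by linarith)
  have m2 : BI (ρ + d + δ) (fun y => H y ^ 2) ≤ X := BI_mono_radius (by fun_prop) (fun y => sq_nonneg _) (by linarith)
  have m3 : BI (ρ + d) (fun y => H y ^ 2) ≤ X := BI_mono_radius (by fun_prop) (fun y => sq_nonneg _) (by linarith)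
  set q := δ ^ (2 - σ) with hq
  have hq0 : 0 < q := by positivity
  have f2' : BI (ρ + d) (fun y => ‖U y‖ * H y ^ 2) ≤ C2 * (q * E + δ⁻¹ ^ 2 * X) := f2.trans (by gcongr)
  have hd1' : 1 ≤ d⁻¹ := (one_le_inv₀ hd0).2 hd1
  have hδ1' : 1 ≤ δ⁻¹ := (one_le_inv₀ hδ0).2 hδ1
  have hδ2 : 1 ≤ δ⁻¹ ^ 2 := one_le_pow₀ hδ1'
  have T1 : C1 * (d⁻¹ * (C2 * (q * E))) ≤ ε * E := by
    calc _ = (C1 * C2 * d⁻¹ * q) * E := by ring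
      _ ≤ _ := by gcongr; exact hθ d hd0 hd1
  have T2 : R * d⁻¹ ^ 2 * X ≤ R * d⁻¹ ^ 2 * δ⁻¹ ^ 2 * X := by
    have hh := mul_le_mul_of_nonneg_left hδ2 (by positivity : 0 ≤ R * d⁻¹ ^ 2 * X)
    linarith
  have T3 : d⁻¹ * (C2 * (δ⁻¹ ^ 2 * X)) ≤ C2 * (R * d⁻¹ ^ 2 * δ⁻¹ ^ 2 * X) := by
    have : d⁻¹ ≤ R * d⁻¹ ^ 2 := by nlinarith
    calc _ = C2 * (d⁻¹ * δ⁻¹ ^ 2 * X) := by ring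
      _ ≤ _ := by gcongr
  have e5 : δ⁻¹ ^ 2 = θ⁻¹ ^ 2 * d⁻¹ ^ (2 * m) := by
    rw [hδ, mul_inv, mul_pow, ← inv_pow, ← pow_mul, mul_comm m 2]
  have e6 : d⁻¹ = 2 * D⁻¹ := by rw [hd]; field_simp
  have T4 : C1 * ((1 + C2) * (R * d⁻¹ ^ 2 * δ⁻¹ ^ 2 * X)) ≤
      C1 * (1 + C2) * θ⁻¹ ^ 2 * 2 ^ (2 + 2 * m) * (C3 * 2 ^ N) * R ^ (1 + N) * D⁻¹ ^ (2 + 2 * m) := by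
    calc _ ≤ C1 * ((1 + C2) * (R * d⁻¹ ^ 2 * δ⁻¹ ^ 2 * (C3 * 2 ^ N * R ^ N))) := by gcongr
      _ = C1 * (1 + C2) * θ⁻¹ ^ 2 * (C3 * 2 ^ N) * (R * R ^ N) * (d⁻¹ ^ 2 * d⁻¹ ^ (2 * m)) := by rw [e5]; ring
      _ = C1 * (1 + C2) * θ⁻¹ ^ 2 * (C3 * 2 ^ N) * R ^ (1 + N) * (2 * D⁻¹) ^ (2 + 2 * m) := by rw [← pow_add, ← e6, pow_add R, pow_one]
      _ = _ := by rw [mul_pow]; ring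
  calc _ ≤ C1 * (R * d⁻¹ ^ 2 * X + d⁻¹ * (C2 * (q * E + δ⁻¹ ^ 2 * X))) := f1.trans (by gcongr)
    _ = C1 * (R * d⁻¹ ^ 2 * X + d⁻¹ * (C2 * (δ⁻¹ ^ 2 * X))) + C1 * (d⁻¹ * (C2 * (q * E))) := by ring
    _ ≤ C1 * (R * d⁻¹ ^ 2 * δ⁻¹ ^ 2 * X + C2 * (R * d⁻¹ ^ 2 * δ⁻¹ ^ 2 * X)) + ε * E := by gcongr
    _ = C1 * ((1 + C2) * (R * d⁻¹ ^ 2 * δ⁻¹ ^ 2 * X)) + ε * E := by ring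
    _ ≤ _ := by linarith

lemma UH_poly (hs : SubS a U H) (h : Sol a U P M σ) (hp : PB (fun R => BI R (fun y => H y ^ 2))) :
    PB (fun R => BI R (fun y => ‖U y‖ * H y ^ 2)) := by
  obtain ⟨C2, hC2, b2⟩ := h.cubicH
  refine (((D_poly hs h hp).shift.add hp.shift).cmul C2 hC2.le).mono fun R hR => ?_
  have := b2 H hs.sm R 1 one_pos le_rfl
  simpa using this

lemma BI_annulus {F : E3 → ℝ} (hF : Continuous F) (hF0 : ∀ y, 0 ≤ F y) {R R' : ℝ} (hR : R ≤ R') :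
    BI R' (fun y => F y * wt 2 y) ≤ BI R (fun y => F y * wt 2 y) + Real.exp (-2 * R) * BI R' F := by
  have cw := (wt_sm 2).continuous
  have cc : Continuous (fun y => F y * wt 2 y) := by fun_prop
  have hsub : closedBall (0 : E3) R ⊆ closedBall 0 R' := closedBall_subset_closedBall hR
  have h1 := setIntegral_sdiff (μ := volume) measurableSet_closedBall (intOn_ball cc R') hsub
  have h2 : ∫ y in closedBall (0 : E3) R' \ closedBall 0 R, F y * wt 2 y ≤ ∫ y in closedBall (0 : E3) R' \ closedBall 0 R, Real.exp (-2 * R) * F y := by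
    refine setIntegral_mono_on ((intOn_ball cc R').mono_set sdiff_subset) ((intOn_ball (by fun_prop) R').mono_set sdiff_subset)
      (measurableSet_closedBall.diff measurableSet_closedBall) fun y hy => ?_
    have : R ≤ ‖y‖ := by have := hy.2; simp at this; exact this.le
    rw [mul_comm]
    exact mul_le_mul_of_nonneg_right (wt2_le R y this) (hF0 y)
  have h3 : ∫ y in closedBall (0 : E3) R' \ closedBall 0 R, Real.exp (-2 * R) * F y ≤ ∫ y in closedBall (0 : E3) R', Real.exp (-2 * R) * F y :=
    setIntegral_mono_set (intOn_ball (by fun_prop) R') (ae_of_all _ fun y => mul_nonneg (Real.exp_pos _).le (hF0 y)) (Eventually.of_forall sdiff_subset)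
  simp only [integral_const_mul] at h2 h3
  simp only [BI]
  linarith

end Part13

section Part14
variable {a M σ : ℝ} {U : E3 → E3} {P : E3 → ℝ} {H : E3 → ℝ}

lemma dH2_mul_wt (hH : Sm H) (y : E3) :
    dH2 (fun y => H y * wt 1 y) y ≤ 2 * (dH2 H y * wt 2 y) + 6 * (H y ^ 2 * wt 2 y) := by
  have key : ∀ k, (pd k (fun y => H y * wt 1 y) y) ^ 2 ≤ 2 * (pd k H y ^ 2 * wt 2 y) + 2 * (H y ^ 2 * wt 2 y) := by
    intro k
    rw [pd_mul hH (wt_sm 1) k y, wt_sq]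
    have h1 := abs_pd_wt 1 zero_le_one k y
    rw [one_mul] at h1
    have h2 : (pd k (wt 1) y) ^ 2 ≤ wt 1 y ^ 2 := by rw [← sq_abs]; gcongr
    have h3 := mul_le_mul_of_nonneg_left h2 (sq_nonneg (H y))
    have h4 := sq_nonneg (pd k H y * wt 1 y - H y * pd k (wt 1) y)
    linarith
  have := key 0; have := key 1; have := key 2
  simp only [dH2, Fin.sum_univ_three]
  linarith

lemma decay_alg (w z N a C R R0 K n q lw lz s1 s2 s3 s4 s5 E : ℝ) (ha : 0 < a) (hC : 0 < C) (hw : 0 < w) (hz : 0 ≤ z) (hz1 : z ≤ 1)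
    (hN : 0 ≤ N) (hq : 0 ≤ q) (hE : 0 ≤ E) (hR : 1 ≤ R)
    (hR0 : 4 + 3 * a + K + 1 ≤ a * R0) (hn : R0 ≤ n)
    (h1 : lw ≤ 4 * w) (h2 : s1 ≤ 3 * (N * (2 * w))) (h3 : s2 ≤ -(n * w))
    (h4 : 2 * s3 + w * lz + w * s4 + a * (w * s5) ≤ (16 * C + 3 * a * C) * ((R + 1) * (E * (1 + N)))) :
    q * ((lw * z + 2 * s3 + w * lz) + ((z * s1 + w * s4) + a * (z * s2 + w * s5)) + 3 * a * (w * z)) ≤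
      -(K + 1) * (q * w * z) + 6 * (N * (q * w)) + ((16 * C + 3 * a * C) * (R + 1) * E) * (q + N * q) := by
  have e1 : lw * z ≤ 4 * w * z := by gcongr
  have e2 : z * s1 ≤ 6 * (N * w) := by
    calc z * s1 ≤ z * (3 * (N * (2 * w))) := by gcongr
      _ ≤ 1 * (3 * (N * (2 * w))) := by gcongr
      _ = _ := by ring
  have e3 : a * (z * s2) ≤ - ((4 + 3 * a + K + 1) * (w * z)) := by
    have x1 : a * (z * s2) ≤ a * (z * (-(n * w))) := by gcongr
    have x2 : a * R0 ≤ a * n := by gcongr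
    have x3 := mul_le_mul_of_nonneg_right (hR0.trans x2) (by positivity : 0 ≤ w * z)
    linarith
  have t : (lw * z + 2 * s3 + w * lz) + ((z * s1 + w * s4) + a * (z * s2 + w * s5)) + 3 * a * (w * z) ≤
      -(K + 1) * (w * z) + 6 * (N * w) + (16 * C + 3 * a * C) * ((R + 1) * (E * (1 + N))) := by linarith
  calc _ ≤ q * (-(K + 1) * (w * z) + 6 * (N * w) + (16 * C + 3 * a * C) * ((R + 1) * (E * (1 + N)))) := by gcongr
    _ = _ := by ring

lemma decay_alg2 (w N a C R E s3 lz s4 s5 : ℝ) (ha : 0 < a) (hC : 0 < C) (hw : 0 < w) (hN : 0 ≤ N) (hwE : w ≤ E) (hR : 1 ≤ R)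
    (h3 : s3 ≤ 3 * (2 * w * C)) (hl : lz ≤ C) (h4 : s4 ≤ 3 * (N * C)) (h5 : s5 ≤ 3 * ((R + 1) * C)) :
    2 * s3 + w * lz + w * s4 + a * (w * s5) ≤ (16 * C + 3 * a * C) * ((R + 1) * (E * (1 + N))) := by
  have e1 : w * lz ≤ w * C := by gcongr
  have e2 : w * s4 ≤ w * (3 * (N * C)) := by gcongr
  have e3 : a * (w * s5) ≤ a * (w * (3 * ((R + 1) * C))) := by gcongr
  have f1 : w ≤ (R + 1) * (w * (1 + N)) := by
    have : 0 ≤ R * w + (R + 1) * (w * N) := by positivity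
    linarith
  have f2 : w * N ≤ (R + 1) * (w * (1 + N)) - w := by
    have : 0 ≤ R * w + R * (w * N) := by positivity
    linarith
  have f3 : (R + 1) * w ≤ (R + 1) * (w * (1 + N)) := by
    have : 0 ≤ (R + 1) * (w * N) := by positivity
    linarith
  have g1 := mul_le_mul_of_nonneg_left f1 (by positivity : 0 ≤ 13 * C)
  have g2 := mul_le_mul_of_nonneg_left f2 (by positivity : 0 ≤ 3 * C)
  have g3 := mul_le_mul_of_nonneg_left f3 (by positivity : 0 ≤ 3 * a * C)
  have : 0 ≤ C * w := by positivity
  calc _ ≤ (16 * C + 3 * a * C) * ((R + 1) * (w * (1 + N))) := by linarith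
    _ ≤ _ := by gcongr

lemma exp_poly_zero (g : ℝ → ℝ) (hg : Monotone g) (h0 : ∀ r, 0 ≤ g r) (Q : ℝ → ℝ) (hQ : PB Q)
    (hb : ∀ R, 1 ≤ R → g R ≤ Real.exp (-2 * R) * Q R) (r : ℝ) : g r = 0 := by
  obtain ⟨C, hC, N, hN⟩ := hQ
  refine le_antisymm ?_ (h0 r)
  have lim : Tendsto (fun R : ℝ => C * (R ^ N * Real.exp (-2 * R))) atTop (nhds (C * 0)) := by
    refine Tendsto.const_mul C ?_
    have := Real.tendsto_pow_mul_exp_neg_atTop_nhds_zero N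
    refine squeeze_zero' ?_ ?_ this
    · filter_upwards [eventually_ge_atTop 0] with R hR
      positivity
    · filter_upwards [eventually_ge_atTop 0] with R hR
      gcongr
      linarith
  rw [mul_zero] at lim
  refine ge_of_tendsto lim ?_
  filter_upwards [eventually_ge_atTop 1, eventually_ge_atTop r] with R h1 h2
  calc g r ≤ g R := hg h2
    _ ≤ _ := hb R h1
    _ ≤ Real.exp (-2 * R) * (C * R ^ N) := by gcongr; exact hN R h1
    _ = _ := by ring

lemma BI_zero_imp {f : E3 → ℝ} (hf : Continuous f) (h0 : ∀ y, 0 ≤ f y) (h : ∀ r, BI r f = 0) (y : E3) : f y = 0 := by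
  by_contra hne
  have h1 : 0 < ∫ x in closedBall (0 : E3) (‖y‖ + 1), f x := by
    rw [setIntegral_pos_iff_support_of_nonneg_ae (ae_of_all _ h0) (intOn_ball hf _)]
    have : IsOpen (Function.support f ∩ ball (0 : E3) (‖y‖ + 1)) := (hf.isOpen_support).inter isOpen_ball
    exact (this.measure_pos volume ⟨y, hne, by simp⟩).trans_le (measure_mono (inter_subset_inter_right _ ball_subset_closedBall))
  exact h1.ne' (h _)

set_option maxHeartbeats 1000000 in
lemma Sol.decay (h : Sol a U P M σ) : ∃ R0, 1 ≤ R0 ∧ ∀ H, SubS a U H → PB (fun R => BI R (fun y => H y ^ 2)) →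
    (∀ y, ‖y‖ ≤ R0 → H y = 0) → ∀ y, H y = 0 := by
  obtain ⟨C, hC, hcut⟩ := cutoff_exists
  obtain ⟨C2, hC2, b2⟩ := h.cubicH
  have ha := h.ha
  have hUc := h.hU.continuous
  have hκ : 0 < 2 - σ := by linarith [h.hσ]
  obtain ⟨m, hm1, hm⟩ := exists_m (2 - σ) hκ
  obtain ⟨θ, hθ0, hθ1, hθ⟩ := choose_theta (2 - σ) (12 * C2) 1 hκ (by positivity) (by positivity) m hm
  have hθ' := hθ 1 one_pos le_rfl
  simp only [inv_one, mul_one, one_pow] at hθ'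
  clear hθ
  set q := θ ^ (2 - σ) with hq
  have hq0 : 0 < q := by positivity
  set K := 3 + 6 * C2 * θ⁻¹ ^ 2 with hK
  have hK0 : 0 < K := by positivity
  refine ⟨max 1 ((4 + 3 * a + K + 1) / a), le_max_left _ _, fun H hs hp hz => ?_⟩
  set R0 := max 1 ((4 + 3 * a + K + 1) / a) with hR0
  have hR01 : 1 ≤ R0 := le_max_left _ _
  have hR0a : 4 + 3 * a + K + 1 ≤ a * R0 := by
    have : (4 + 3 * a + K + 1) / a ≤ R0 := le_max_right _ _
    rw [div_le_iff₀ ha] at this; linarith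
  have hHc := hs.sm.continuous
  have hDc := dH2_cont hs.sm
  have hwc := (wt_sm 2).continuous
  have cu : ∀ k, Continuous (fun y => U y k) := fun k => (h.hc.hu k).continuous
  set C' := 16 * C + 3 * a * C with hC'
  set e : ℝ → ℝ := fun R => BI R (fun y => dH2 H y * wt 2 y) with he
  set g : ℝ → ℝ := fun R => BI R (fun y => H y ^ 2 * wt 2 y) with hg
  have hcg : Continuous (fun y => H y ^ 2 * wt 2 y) := by fun_prop
  have hce : Continuous (fun y => dH2 H y * wt 2 y) := by fun_prop
  have pg : ∀ y, 0 ≤ H y ^ 2 * wt 2 y := fun y => mul_nonneg (sq_nonneg _) (wt_pos 2 y).le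
  have pe : ∀ y, 0 ≤ dH2 H y * wt 2 y := fun y => mul_nonneg (dH2_nonneg _ _) (wt_pos 2 y).le
  have e0 : ∀ R, 0 ≤ e R := fun R => BI_nonneg _ pe
  have g0 : ∀ R, 0 ≤ g R := fun R => BI_nonneg _ pg
  have gm : Monotone g := fun r s hrs => BI_mono_radius hcg pg hrs
  -- cubic term
  have cub : ∀ R, 6 * BI (R + 1) (fun y => ‖U y‖ * (H y ^ 2 * wt 2 y)) ≤ e (R + 2) + K * g (R + 2) := by
    intro R
    have sf : Sm (fun y => H y * wt 1 y) := hs.sm.mul (wt_sm 1)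
    have f1 := b2 _ sf (R + 1) θ hθ0 hθ1
    have q1 : (fun y => (H y * wt 1 y) ^ 2) = fun y => H y ^ 2 * wt 2 y := by
      funext y; rw [wt_sq]; ring
    have q2 : (fun y => ‖U y‖ * (H y * wt 1 y) ^ 2) = fun y => ‖U y‖ * (H y ^ 2 * wt 2 y) := by
      funext y; rw [wt_sq]; ring
    rw [q1, q2] at f1
    have m1 : BI (R + 1 + θ) (fun y => H y ^ 2 * wt 2 y) ≤ g (R + 2) := BI_mono_radius hcg pg (by linarith)
    have m2 : BI (R + 1 + θ) (dH2 (fun y => H y * wt 1 y)) ≤ 2 * e (R + 2) + 6 * g (R + 2) := by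
      calc _ ≤ BI (R + 2) (dH2 (fun y => H y * wt 1 y)) := BI_mono_radius (dH2_cont sf) (dH2_nonneg _) (by linarith)
        _ ≤ BI (R + 2) (fun y => 2 * (dH2 H y * wt 2 y) + 6 * (H y ^ 2 * wt 2 y)) :=
          BI_mono (dH2_cont sf) (by fun_prop) _ fun y _ => dH2_mul_wt hs.sm y
        _ = _ := by rw [BI_add (by fun_prop) (by fun_prop), BI_const_mul, BI_const_mul]
    have f2 := mul_le_mul_of_nonneg_left m2 (by positivity : 0 ≤ C2 * q)
    have f3 := mul_le_mul_of_nonneg_left m1 (by positivity : 0 ≤ C2 * θ⁻¹ ^ 2)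
    have f4 := mul_le_mul_of_nonneg_right hθ' (e0 (R + 2))
    have f5 := mul_le_mul_of_nonneg_right hθ' (g0 (R + 2))
    rw [hK]
    linarith
  set Er : ℝ → ℝ := fun R => BI (R + 1) (fun y => H y ^ 2) + BI (R + 1) (fun y => ‖U y‖ * H y ^ 2) with hEr
  have main : ∀ R, 1 ≤ R → 2 * e R + (K + 1) * g R ≤ e (R + 2) + K * g (R + 2) + Real.exp (-2 * R) * (C' * (R + 1) * Er R) := by
    intro R hR
    obtain ⟨ζ, sζ, ζ0, ζ1, ζin, ζout, ζb1, ζb2, ζo1, ζo2, ζi1, ζi2⟩ := hcut R 1 (by linarith) one_pos le_rfl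
    simp only [inv_one, mul_one, one_pow] at ζb1 ζb2
    have sW : Sm (fun y => wt 2 y * ζ y) := (wt_sm 2).mul sζ
    have hid := sub_energy hs h.hc sW (fun y => mul_nonneg (wt_pos 2 y).le (ζ0 y)) (R + 1) (fun y hy => by rw [ζout y hy, mul_zero])
    have cζ := sζ.continuous
    have l1 : 2 * e R ≤ BI (R + 1) (fun y => 2 * (dH2 H y * (wt 2 y * ζ y))) := by
      rw [he]; simp only
      rw [← BI_const_mul]
      have cc : Continuous (fun y => 2 * (dH2 H y * (wt 2 y * ζ y))) := by fun_prop
      calc _ ≤ BI R (fun y => 2 * (dH2 H y * (wt 2 y * ζ y))) := by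
            refine BI_mono (by fun_prop) cc _ fun y hy => ?_
            rw [ζin y (by simpa using hy), mul_one]
        _ ≤ _ := BI_mono_radius cc (fun y => mul_nonneg (by norm_num) (mul_nonneg (dH2_nonneg _ _) (mul_nonneg (wt_pos 2 y).le (ζ0 y)))) (by linarith)
    have l2 : g R ≤ BI (R + 1) (fun y => H y ^ 2 * wt 2 y * ζ y) := by
      have cc : Continuous (fun y => H y ^ 2 * wt 2 y * ζ y) := by fun_prop
      calc _ ≤ BI R (fun y => H y ^ 2 * wt 2 y * ζ y) := by
            refine BI_mono (by fun_prop) cc _ fun y hy => ?_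
            rw [ζin y (by simpa using hy), mul_one]
        _ ≤ _ := BI_mono_radius cc (fun y => mul_nonneg (pg y) (ζ0 y)) (by linarith)
    have pt : ∀ y ∈ closedBall (0 : E3) (R + 1), H y ^ 2 * (lap (fun y => wt 2 y * ζ y) y +
        (∑ k, (U y k + a * y k) * pd k (fun y => wt 2 y * ζ y) y) + 3 * a * (wt 2 y * ζ y)) ≤
        (-(K + 1) * (H y ^ 2 * wt 2 y * ζ y) + 6 * (‖U y‖ * (H y ^ 2 * wt 2 y))) +
          (C' * (R + 1) * Real.exp (-2 * R)) * (H y ^ 2 + ‖U y‖ * H y ^ 2) := by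
      intro y hy
      have hy' : ‖y‖ ≤ R + 1 := by simpa using hy
      rcases le_or_gt ‖y‖ R0 with hy0 | hy0
      · simp [hz y hy0]
      rw [lap_mul (wt_sm 2) sζ, sum_split]
      have s1 : ∑ k, U y k * pd k (fun y => wt 2 y * ζ y) y = ζ y * (∑ k, U y k * pd k (wt 2) y) + wt 2 y * ∑ k, U y k * pd k ζ y := by
        simp only [fun k => pd_mul (wt_sm 2) sζ k y, Fin.sum_univ_three]; ring
      have s2 : ∑ k, y k * pd k (fun y => wt 2 y * ζ y) y = ζ y * (∑ k, y k * pd k (wt 2) y) + wt 2 y * ∑ k, y k * pd k ζ y := by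
        simp only [fun k => pd_mul (wt_sm 2) sζ k y, Fin.sum_univ_three]; ring
      rw [s1, s2]
      have hw := wt_pos 2 y
      refine decay_alg (wt 2 y) (ζ y) ‖U y‖ a C R R0 K ‖y‖ (H y ^ 2) _ _ _ _ _ _ _ (Real.exp (-2 * R)) ha hC hw (ζ0 y) (ζ1 y)
        (norm_nonneg _) (sq_nonneg _) (Real.exp_pos _).le hR hR0a hy0.le (lap_wt2 y) ?_ (sum_pd_wt2 y (hR01.trans hy0.le)) ?_
      · exact (le_abs_self _).trans (sum_mul_le _ _ _ _ (norm_nonneg _) (fun k => abs_coord_le (U y) k) (fun k => abs_pd_wt 2 (by norm_num) k y))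
      · rcases lt_or_ge ‖y‖ R with hyR | hyR
        · have z1 := fun k => ζi1 k y hyR
          have z2 := ζi2 y hyR
          simp only [z1, z2, mul_zero, Finset.sum_const_zero, add_zero]
          have := Real.exp_pos (-2 * R)
          positivity
        · refine decay_alg2 _ _ _ _ _ _ _ _ _ _ ha hC hw (norm_nonneg _) (wt2_le R y hyR) hR ?_ ((le_abs_self _).trans (ζb2 y)) ?_ ?_
          · exact (le_abs_self _).trans (sum_mul_le _ _ _ _ (by positivity) (fun k => abs_pd_wt 2 (by norm_num) k y) (fun k => ζb1 k y))
          · exact (le_abs_self _).trans (sum_mul_le _ _ _ _ (norm_nonneg _) (fun k => abs_coord_le (U y) k) (fun k => ζb1 k y))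
          · exact (le_abs_self _).trans (sum_mul_le _ _ _ _ (by linarith) (fun k => (abs_coord_le y k).trans hy') (fun k => ζb1 k y))
    have cs : Continuous (fun y => ∑ k, (U y k + a * y k) * pd k (fun y => wt 2 y * ζ y) y) :=
      continuous_finsetSum _ fun k _ => ((cu k).add (continuous_const.mul (Sm.coord k).continuous)).mul (sW.pd k).continuous
    have cl := sW.lap.continuous
    have := hid.trans (BI_mono (by fun_prop) (by fun_prop) _ pt)
    rw [BI_add (by fun_prop) (by fun_prop), BI_add (by fun_prop) (by fun_prop), BI_const_mul, BI_const_mul, BI_const_mul, BI_const_mul,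
      BI_add (by fun_prop) (by fun_prop)] at this
    rw [BI_const_mul] at l1
    have c := cub R
    have l3 := mul_le_mul_of_nonneg_left l2 (by positivity : 0 ≤ K + 1)
    simp only [hEr]
    linarith
  refine fun y => ?_
  have hpU := UH_poly hs h hp
  have hpD := D_poly hs h hp
  have fin : ∀ r, g r = 0 := by
    refine exp_poly_zero g gm g0 (fun R => C' * (R + 1) * Er R + (BI (R + 2) (dH2 H) + K * BI (R + 2) (fun y => H y ^ 2))) ?_ ?_
    · have p2 : ∀ f : ℝ → ℝ, PB f → PB (fun R => f (R + 2)) := by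
        intro f hf
        have := hf.shift.shift
        simpa only [add_assoc, one_add_one_eq_two] using this
      have p1 : PB (fun R => C' * (R + 1)) := by
        have := (((PB.pow 1).add (PB.cst 1)).cmul C' (by positivity))
        simpa using this
      refine (p1.mul (hp.shift.add hpU.shift) fun R hR => ?_).add ((p2 _ hpD).add ((p2 _ hp).cmul K hK0.le))
      exact add_nonneg (BI_nonneg _ fun y => sq_nonneg _) (BI_nonneg _ fun y => mul_nonneg (norm_nonneg _) (sq_nonneg _))
    · intro R hR
      have A1 := BI_annulus hDc (dH2_nonneg H) (by linarith : R ≤ R + 2)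
      have A2 := BI_annulus (F := fun y => H y ^ 2) (by fun_prop) (fun y => sq_nonneg _) (by linarith : R ≤ R + 2)
      have A3 := main R hR
      have A4 := mul_le_mul_of_nonneg_left A2 hK0.le
      have A5 := e0 R
      simp only [he, hg] at A3 A5 ⊢
      linarith
  have := BI_zero_imp hcg pg fin y
  have hw := wt_pos 2 y
  simpa [hw.ne'] using this

end Part14

section Part15
variable {a M σ : ℝ} {U : E3 → E3} {P : E3 → ℝ} {H : E3 → ℝ}

/-- Smooth convex version of the positive part. -/
def hplus (t : ℝ) : ℝ := ∫ s in (0:ℝ)..t, Real.smoothTransition s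

lemma hplus_deriv (t : ℝ) : HasDerivAt hplus (Real.smoothTransition t) t :=
  intervalIntegral.integral_hasDerivAt_right (Real.smoothTransition.continuous.intervalIntegrable _ _)
    (Real.smoothTransition.continuous.stronglyMeasurableAtFilter _ _) Real.smoothTransition.continuous.continuousAt

lemma hplus_contDiff : ContDiff ℝ (⊤ : ℕ∞) hplus := by
  refine contDiff_infty_iff_deriv.2 ⟨fun t => (hplus_deriv t).differentiableAt, ?_⟩
  have : deriv hplus = Real.smoothTransition := funext fun t => (hplus_deriv t).deriv
  rw [this]; exact st_contDiff

lemma hplus_nonpos {t : ℝ} (ht : t ≤ 0) : hplus t = 0 := by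
  unfold hplus
  rw [intervalIntegral.integral_congr (g := fun _ => (0:ℝ))]
  · simp
  · intro s hs
    rw [uIcc_of_ge ht] at hs
    exact Real.smoothTransition.zero_of_nonpos hs.2

lemma hplus_pos {t : ℝ} (ht : 0 < t) : 0 < hplus t :=
  intervalIntegral.intervalIntegral_pos_of_pos_on (Real.smoothTransition.continuous.intervalIntegrable _ _)
    (fun s hs => Real.smoothTransition.pos_of_pos hs.1) ht

lemma hplus_nonneg (t : ℝ) : 0 ≤ hplus t := by
  rcases le_or_gt t 0 with h | h
  · exact (hplus_nonpos h).ge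
  · exact (hplus_pos h).le

lemma hplus_le (t : ℝ) : hplus t ≤ |t| := by
  rcases le_or_gt t 0 with h | h
  · rw [hplus_nonpos h]; positivity
  · have := intervalIntegral.integral_mono_on h.le (Real.smoothTransition.continuous.intervalIntegrable 0 t)
      ((continuous_const (y := (1:ℝ))).intervalIntegrable (μ := volume) 0 t) fun s _ => Real.smoothTransition.le_one s
    simp at this
    exact this.trans (le_abs_self t)

lemma st1_nonneg (t : ℝ) : 0 ≤ st1 t := Real.smoothTransition.monotone.deriv_nonneg

lemma Sol.weak_max (h : Sol a U P M σ) : ∃ R0, 1 ≤ R0 ∧ ∃ x, ‖x‖ ≤ R0 ∧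
    ∀ y, PiF a (fun i y => U y i) P y ≤ PiF a (fun i y => U y i) P x := by
  obtain ⟨R0, hR0, dec⟩ := h.decay
  set Q := PiF a (fun i y => U y i) P with hQ
  have sQ : Sm Q := h.hc.Pi_sm
  obtain ⟨x, hx, hmax⟩ := (isCompact_closedBall (0 : E3) R0).exists_isMaxOn ⟨0, by simp; linarith⟩ sQ.continuous.continuousOn
  refine ⟨R0, hR0, x, by simpa using hx, fun y => ?_⟩
  have sF : Sm (fun y => Q y - Q x) := sQ.sub (Sm.cst _)
  have pF : ∀ k y, pd k (fun y => Q y - Q x) y = pd k Q y := fun k y => by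
    rw [pd_sub sQ (Sm.cst _), pd_const, sub_zero]
  have pH : ∀ k, pd k (fun y => hplus (Q y - Q x)) = fun y => Real.smoothTransition (Q y - Q x) * pd k Q y := by
    intro k; funext y
    rw [pd_comp sF k y (hplus_deriv _), pF]
  have sS : Sm (fun y => Real.smoothTransition (Q y - Q x)) := st_contDiff.comp sF
  have hs : SubS a U (fun y => hplus (Q y - Q x)) := by
    refine ⟨hplus_contDiff.comp sF, fun y => hplus_nonneg _, fun y => ?_⟩
    have e : ∀ k, pd k (pd k (fun y => hplus (Q y - Q x))) y =
        st1 (Q y - Q x) * pd k Q y ^ 2 + Real.smoothTransition (Q y - Q x) * pd k (pd k Q) y := by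
      intro k
      rw [pH k, pd_mul sS (sQ.pd k), pd_comp sF k y (st_hasDerivAt _), pF]; ring
    have L := h.hc.LPi y
    have E : lap (fun y => hplus (Q y - Q x)) y - ∑ k, (U y k + a * y k) * pd k (fun y => hplus (Q y - Q x)) y =
        st1 (Q y - Q x) * (∑ k, pd k Q y ^ 2) + Real.smoothTransition (Q y - Q x) * (lap Q y - ∑ k, (U y k + a * y k) * pd k Q y) := by
      change (∑ k, pd k (pd k (fun y => hplus (Q y - Q x))) y) - _ = _ + _ * ((∑ k, pd k (pd k Q) y) - _)
      simp only [e]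
      simp only [pH, Fin.sum_univ_three]; ring
    rw [E, hQ, L]
    exact add_nonneg (mul_nonneg (st1_nonneg _) (Finset.sum_nonneg fun k _ => sq_nonneg _))
      (mul_nonneg (Real.smoothTransition.nonneg _) (by positivity))
  have hH0 := dec _ hs ?_ ?_ y
  · by_contra hc
    exact (hplus_pos (sub_pos.2 (not_le.1 hc))).ne' hH0
  · have cQ := sQ.continuous
    have cH := hs.sm.continuous
    refine ((h.Pi_poly.cmul 2 (by norm_num)).add (PB_one.cmul (2 * Q x ^ 2) (by positivity))).mono fun R hR => ?_
    have hfold : PiF a (fun i y => U y i) P = Q := rfl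
    simp only [hfold]
    rw [← BI_const_mul, ← BI_const_mul, ← BI_add (by fun_prop) (by fun_prop)]
    refine BI_mono (by fun_prop) (by fun_prop) _ fun y _ => ?_
    have h1 : hplus (Q y - Q x) ^ 2 ≤ (Q y - Q x) ^ 2 := by
      rw [← sq_abs (Q y - Q x)]; have := hplus_nonneg (Q y - Q x); gcongr; exact hplus_le _
    have h2 := sq_nonneg (Q y + Q x)
    linarith
  · intro y hy
    exact hplus_nonpos (sub_nonpos.2 (hmax (by simpa using hy)))

/-- First and second order conditions at an interior maximum. -/
lemma local_max_test {F : E3 → ℝ} (sF : Sm F) {z : E3} (hz : IsLocalMax F z) (k : Fin 3) :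
    pd k F z = 0 ∧ pd k (pd k F) z ≤ 0 := by
  have h1 : ∀ f : E3 → ℝ, Sm f → ∀ s : ℝ, HasDerivAt (fun s : ℝ => f (z + s • (EuclideanSpace.single k (1:ℝ) : E3))) (pd k f (z + s • (EuclideanSpace.single k (1:ℝ) : E3))) s := by
    intro f sf s
    have := hasDerivAt_along sf z (EuclideanSpace.single k (1:ℝ) : E3) s
    simpa [Pi.single_apply] using this
  set φ : ℝ → ℝ := fun s => F (z + s • (EuclideanSpace.single k (1:ℝ) : E3)) with hφ
  have d1 : deriv φ = fun s => pd k F (z + s • (EuclideanSpace.single k (1:ℝ) : E3)) := funext fun s => (h1 F sF s).deriv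
  have d2 : deriv (deriv φ) 0 = pd k (pd k F) z := by
    rw [d1, (h1 (pd k F) (sF.pd k) 0).deriv]; simp
  have hm : IsLocalMax φ 0 := by
    have ct : Tendsto (fun s : ℝ => z + s • (EuclideanSpace.single k (1:ℝ) : E3)) (nhds 0) (nhds z) := by
      have : Continuous (fun s : ℝ => z + s • (EuclideanSpace.single k (1:ℝ) : E3)) := by fun_prop
      simpa using this.tendsto 0
    have := ct.eventually hz
    filter_upwards [this] with s hs
    simpa [hφ] using hs
  have p1 : deriv φ 0 = 0 := hm.deriv_eq_zero
  refine ⟨by rw [d1] at p1; simpa using p1, ?_⟩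
  by_contra hc
  rw [← d2, not_le] at hc
  have hmin := isLocalMin_of_deriv_deriv_pos hc p1 (h1 F sF 0).continuousAt
  have heq : φ =ᶠ[nhds 0] fun _ => φ 0 := by
    filter_upwards [hm, hmin] with s hs1 hs2
    exact le_antisymm hs1 hs2
  have := heq.deriv
  have h0 := this.deriv_eq
  simp at h0
  linarith

lemma gauss_sm (α : ℝ) (x0 : E3) : Sm (fun y => Real.exp (-α * ‖y - x0‖ ^ 2)) :=
  (contDiff_const.mul (Sm.normsq x0)).exp

lemma gauss_pd (α : ℝ) (x0 : E3) (k : Fin 3) (y : E3) : pd k (fun y => Real.exp (-α * ‖y - x0‖ ^ 2)) y =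
    2 * (y k - x0 k) * (-α * Real.exp (-α * ‖y - x0‖ ^ 2)) := by
  have hq : HasDerivAt (fun t : ℝ => Real.exp (-α * t)) (-α * Real.exp (-α * ‖y - x0‖ ^ 2)) (‖y - x0‖ ^ 2) := by
    have := ((hasDerivAt_id (‖y - x0‖ ^ 2)).const_mul (-α)).exp
    simpa [mul_comm] using this
  exact pd_radial x0 k y hq

lemma gauss_lap (α : ℝ) (x0 : E3) (y : E3) : lap (fun y => Real.exp (-α * ‖y - x0‖ ^ 2)) y =
    (4 * α ^ 2 * ‖y - x0‖ ^ 2 - 6 * α) * Real.exp (-α * ‖y - x0‖ ^ 2) := by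
  have hq : ∀ t, HasDerivAt (fun t : ℝ => Real.exp (-α * t)) (-α * Real.exp (-α * t)) t := by
    intro t
    have := ((hasDerivAt_id t).const_mul (-α)).exp
    simpa [mul_comm] using this
  have := lap_radial x0 (q := fun t => Real.exp (-α * t)) (q1 := fun t => -α * Real.exp (-α * t)) y (fun r _ => hq r)
    (contDiff_const.mul (gauss_sm α x0)) ((hq _).const_mul (-α))
  rw [this]; ring

lemma Sol.curl_zero (h : Sol a U P M σ) (x0 : E3) (i j : Fin 3) : pd i (fun y => U y j) x0 = pd j (fun y => U y i) x0 := by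
  obtain ⟨R0, hR0, x, hx, hmax⟩ := h.weak_max
  set Q := PiF a (fun i y => U y i) P with hQ
  have sQ : Sm Q := h.hc.Pi_sm
  by_contra hne
  set L : E3 → ℝ := fun y => lap Q y - ∑ k, (U y k + a * y k) * pd k Q y with hL
  have cb : ∀ k, Continuous (fun y => U y k + a * y k) := fun k =>
    (h.hc.hu k).continuous.add (continuous_const.mul (Sm.coord k).continuous)
  have cL : Continuous L := sQ.lap.continuous.sub (continuous_finsetSum _ fun k _ => (cb k).mul (sQ.pd k).continuous)
  have L0 : ∀ y, 0 ≤ L y := fun y => by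
    simp only [hL]; rw [hQ, h.hc.LPi y]; positivity
  have Lpos : 0 < L x0 := by
    simp only [hL]; rw [hQ, h.hc.LPi x0]
    have h1 : 0 < (pd i (fun y => U y j) x0 - pd j (fun y => U y i) x0) ^ 2 := by
      have := sub_ne_zero.2 hne; positivity
    have h2 : (pd i (fun y => U y j) x0 - pd j (fun y => U y i) x0) ^ 2 ≤ ∑ i, ∑ j, (pd i (fun y => U y j) x0 - pd j (fun y => U y i) x0) ^ 2 := by
      refine le_trans ?_ (Finset.single_le_sum (f := fun i => ∑ j, (pd i (fun y => U y j) x0 - pd j (fun y => U y i) x0) ^ 2)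
        (fun i _ => Finset.sum_nonneg fun j _ => sq_nonneg _) (Finset.mem_univ i))
      exact Finset.single_le_sum (f := fun j => (pd i (fun y => U y j) x0 - pd j (fun y => U y i) x0) ^ 2)
        (fun j _ => sq_nonneg _) (Finset.mem_univ j)
    linarith
  obtain ⟨η, hη, hηL⟩ := Metric.eventually_nhds_iff.1 (cL.continuousAt.eventually (lt_mem_nhds (half_lt_self Lpos)))
  set R1 := R0 + 2 * ‖x0‖ + 1 with hR1
  have hx0 := norm_nonneg x0
  -- bound on the drift
  set D : E3 → ℝ := fun y => ∑ k, (U y k + a * y k) * (y k - x0 k) with hD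
  have cD : Continuous D := continuous_finsetSum _ fun k _ => (cb k).mul ((Sm.coord k).continuous.sub continuous_const)
  obtain ⟨B, hB⟩ := (isCompact_closedBall (0 : E3) R1).exists_bound_of_continuousOn cD.continuousOn
  have hB0 : 0 ≤ B := (norm_nonneg _).trans (hB 0 (by simp; linarith))
  set α := (4 + B) / η ^ 2 with hα
  have hα0 : 0 < α := by positivity
  have hαη : α * η ^ 2 = 4 + B := by rw [hα]; field_simp
  set G : E3 → ℝ := fun y => Real.exp (-α * ‖y - x0‖ ^ 2) with hG
  have sG : Sm G := gauss_sm α x0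
  have LG : ∀ y, lap G y - ∑ k, (U y k + a * y k) * pd k G y = 2 * α * (2 * (α * ‖y - x0‖ ^ 2) - 3 + D y) * G y := by
    intro y
    have e1 : lap G y = (4 * α ^ 2 * ‖y - x0‖ ^ 2 - 6 * α) * G y := gauss_lap α x0 y
    have e2 : ∀ k, pd k G y = 2 * (y k - x0 k) * (-α * G y) := fun k => gauss_pd α x0 k y
    rw [e1]; simp only [e2, hD, Fin.sum_univ_three]; ring
  set K := 2 * α * (3 + B) + 1 with hK
  have hK0 : 0 < K := by positivity
  set ε := L x0 / 2 / K with hε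
  have hε0 : 0 < ε := by positivity
  have hεK : ε * K = L x0 / 2 := by rw [hε]; field_simp
  have LF : ∀ y, ‖y‖ ≤ R1 → 0 < L y + ε * (lap G y - ∑ k, (U y k + a * y k) * pd k G y) := by
    intro y hy
    have hDy := (abs_le.1 (hB y (by simpa using hy))).1
    have G0 : 0 < G y := Real.exp_pos _
    have G1 : G y ≤ 1 := Real.exp_le_one_iff.2 (by have := mul_nonneg hα0.le (sq_nonneg ‖y - x0‖); linarith)
    rw [LG]
    rcases lt_or_ge (dist y x0) η with hd | hd
    · have l1 := hηL hd
      have l2 : -(3 + B) ≤ 2 * (α * ‖y - x0‖ ^ 2) - 3 + D y := by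
        have := mul_nonneg hα0.le (sq_nonneg ‖y - x0‖); linarith
      have l3 : -(2 * α * (3 + B)) ≤ 2 * α * (2 * (α * ‖y - x0‖ ^ 2) - 3 + D y) * G y := by
        calc -(2 * α * (3 + B)) ≤ -(2 * α * (3 + B)) * G y := by
              have : 2 * α * (3 + B) * G y ≤ 2 * α * (3 + B) * 1 := by gcongr
              linarith
          _ = 2 * α * (-(3 + B)) * G y := by ring
          _ ≤ _ := by gcongr
      have l4 := mul_le_mul_of_nonneg_left l3 hε0.le
      have l5 : ε * (2 * α * (3 + B)) = L x0 / 2 - ε := by rw [← hεK, hK]; ring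
      linarith
    · have l1 : 4 + B ≤ α * ‖y - x0‖ ^ 2 := by
        rw [← hαη, ← dist_eq_norm]; gcongr
      have l2 : 0 < 2 * (α * ‖y - x0‖ ^ 2) - 3 + D y := by linarith
      have := L0 y
      positivity
  have sF : Sm (fun y => Q y + ε * G y) := sQ.add ((Sm.cst ε).mul sG)
  obtain ⟨z, hz, hzm⟩ := (isCompact_closedBall (0 : E3) R1).exists_isMaxOn ⟨0, by simp; linarith⟩ sF.continuous.continuousOn
  have hz' : ‖z‖ ≤ R1 := by simpa using hz
  rcases hz'.lt_or_eq with hlt | heq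
  · have hloc : IsLocalMax (fun y => Q y + ε * G y) z :=
      hzm.isLocalMax (closedBall_mem_nhds_of_mem (by simpa using hlt))
    have t := local_max_test sF hloc
    have p1 : ∀ k, pd k (fun y => Q y + ε * G y) = fun y => pd k Q y + ε * pd k G y := fun k => funext fun y => by
      rw [pd_add sQ ((Sm.cst ε).mul sG), pd_cmul sG]
    have t1 : ∀ k, pd k Q z + ε * pd k G z = 0 := fun k => by have := (t k).1; rwa [p1] at this
    have t2 : ∀ k, pd k (pd k Q) z + ε * pd k (pd k G) z ≤ 0 := fun k => by
      have := (t k).2; rwa [p1, pd_add (sQ.pd k) ((Sm.cst ε).mul (sG.pd k)), pd_cmul (sG.pd k)] at this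
    have c := LF z hz'
    have e : L z + ε * (lap G z - ∑ k, (U z k + a * z k) * pd k G z) =
        (∑ k, (pd k (pd k Q) z + ε * pd k (pd k G) z)) - ∑ k, (U z k + a * z k) * (pd k Q z + ε * pd k G z) := by
      change ((∑ k, pd k (pd k Q) z) - _) + ε * ((∑ k, pd k (pd k G) z) - _) = _
      simp only [Fin.sum_univ_three]; ring
    rw [e] at c
    simp only [t1, mul_zero, Finset.sum_const_zero, sub_zero] at c
    exact absurd c (not_lt.2 (Finset.sum_nonpos fun k _ => t2 k))
  · have h1 : Q x + ε * G x ≤ Q z + ε * G z := hzm (by simp; linarith : x ∈ closedBall (0 : E3) R1)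
    have h2 := hmax z
    have h3 : G z < G x := by
      apply Real.exp_lt_exp.2
      have n1 : ‖x - x0‖ ≤ R0 + ‖x0‖ := (norm_sub_le _ _).trans (by linarith)
      have n2 : R1 - ‖x0‖ ≤ ‖z - x0‖ := by rw [← heq]; exact norm_sub_norm_le _ _
      have n3 : ‖x - x0‖ < ‖z - x0‖ := by linarith
      have n4 : ‖x - x0‖ ^ 2 < ‖z - x0‖ ^ 2 := by gcongr
      have := mul_lt_mul_of_pos_left n4 hα0
      linarith
    have := mul_lt_mul_of_pos_left h3 hε0
    linarith

lemma Sol.zero (h : Sol a U P M σ) (y : E3) : U y = 0 := by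
  have hu := h.hc.hu
  have hl : ∀ i y, lap (fun y => U y i) y = 0 := by
    intro i y
    have e : ∀ k, pd k (fun y => U y i) = pd i (fun y => U y k) := fun k => funext fun z => h.curl_zero z k i
    change ∑ k, pd k (pd k (fun y => U y i)) y = 0
    have : ∀ k, pd k (pd k (fun y => U y i)) y = pd i (pd k (fun y => U y k)) y := fun k => by
      rw [e k, pd_comm (hu k)]
    simp only [this]
    exact h.hc.div1 i y
  obtain ⟨C, hC, avg⟩ := avg_bound
  obtain ⟨C', hC', kb⟩ := kernel_bound phiK phiK_sm.continuous (fun z => phiK_out)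
  ext i
  have key : ∀ s : ℝ, 0 < s → ‖U y i‖ₑ ≤ ENNReal.ofReal C' * ENNReal.ofReal (M * |s| ^ (-σ)) := by
    intro s hs
    have h1 := avg _ (hu i) y s hs
    have z0 : IA 1 s (fun x => ‖lap (fun y => U y i) x‖ₑ) y = 0 := by
      simp only [hl, enorm_zero]
      simp [IA, AV]
    rw [z0, mul_zero, nonpos_iff_eq_zero, enorm_eq_zero, sub_eq_zero] at h1
    rw [h1]
    refine (kernel_int_le _ (fun y => U y i) phiK_sm.continuous (fun z => phiK_out) C' kb y s).trans ?_
    gcongr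
    refine le_trans ?_ (h.hm s hs.ne' y)
    unfold AV
    refine lintegral_mono fun z => ?_
    simp only
    rw [← ofReal_norm, ← ofReal_norm]
    exact ENNReal.ofReal_le_ofReal (abs_coord_le (U (y + s • z)) i)
  have lim : Tendsto (fun s : ℝ => C' * (M * s ^ (-σ))) atTop (nhds (C' * (M * 0))) :=
    ((tendsto_rpow_neg_atTop h.hσ0).const_mul M).const_mul C'
  simp only [mul_zero] at lim
  have hle : |U y i| ≤ 0 := by
    refine ge_of_tendsto lim ?_
    filter_upwards [eventually_gt_atTop 0] with s hs
    have := key s hs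
    have hM := h.hM
    rw [← ENNReal.ofReal_mul hC'.le, ← ofReal_norm, abs_of_pos hs] at this
    exact (ENNReal.ofReal_le_ofReal_iff (by positivity)).1 this
  simpa using abs_nonpos_iff.1 hle

end Part15

/-- Theorem 1.4: Liouville theorem for Leray's backward self-similar profiles: a smooth
solution `(U, P)` of `−ΔU + aU + a(y·∇)U + (U·∇)U + ∇P = 0`, `div U = 0` on ℝ³ with
`U ∈ L^{p⃗}(ℝ³)`, `1 < p_j < ∞`, `1/p₁ + 1/p₂ + 1/p₃ < 2`, is identically zero. -/
theorem leray_self_similar_trivial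
    (a : ℝ) (ha : 0 < a)
    (U : E3 → E3) (P : E3 → ℝ)
    (hU : ContDiff ℝ (⊤ : ℕ∞) U) (hP : ContDiff ℝ (⊤ : ℕ∞) P)
    (heq : ∀ (y : E3) (i : Fin 3),
      - lap (fun z => U z i) y + a * U y i
        + a * (∑ k : Fin 3, y k * pd k (fun z => U z i) y)
        + (∑ k : Fin 3, U y k * pd k (fun z => U z i) y)
        + pd i P y = 0)
    (hdiv : ∀ y : E3, (∑ k : Fin 3, pd k (fun z => U z k) y) = 0)
    (p1 p2 p3 : ℝ) (hp1 : 1 < p1) (hp2 : 1 < p2) (hp3 : 1 < p3)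
    (hsum : 1/p1 + 1/p2 + 1/p3 < 2)
    (hfin : anisoNorm p1 p2 p3 univ (fun x => ‖U x‖) < ∞) :
    ∀ y : E3, U y = 0 := by
  obtain ⟨M, hM, σ, hσ0, hσ, hm⟩ := AV_morrey U hU.continuous p1 p2 p3 hp1 hp2 hp3 hsum hfin
  have hc : ∀ i, Sm (fun y => U y i) := fun i => by
    unfold Sm
    exact contDiff_euclidean.1 hU i
  have h : Sol a U P M σ := ⟨ha, hU, ⟨hc, hP, heq, hdiv⟩, hM, hσ0, hσ, hm⟩
  exact h.zero
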